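/- Let d ∈ {2,3,4} and let σ = 3/4 if d = 2, σ = 7/6 if d = 3, and σ = 3/2 − δ for an arbitrary fixed δ > 0 if d = 4. For every p ∈ [2, ∞] there is a constant C_p (also depending on δ when d = 4) such that the solution u(t) = cos(t√(1−Δ))f + (sin(t√(1−Δ))/√(1−Δ))g of the linear discrete Klein–Gordon equation u_tt − Δu + u = 0 with data (u(0), u_t(0)) = (f,g) satisfies ‖u(t)‖_{ℓ^{p}(ℤ^d)} ≤ C_p (1 + |t|)^{−σ(p−2)/p} (‖f‖_{ℓ^{p'}} + ‖g‖_{ℓ^{p'}}) for all t ∈ ℝ. -/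

import Mathlib

open MeasureTheory Real
open scoped ENNReal

noncomputable section

/-- Dispersion relation of the discrete Klein--Gordon equation on `ℤ^d`. -/
def omegaKG (d : ℕ) (ξ : Fin d → ℝ) : ℝ :=
  Real.sqrt (1 + ∑ j : Fin d, 2 * (1 - Real.cos (ξ j)))

/-- The fundamental domain `[0, 2π]^d` of the torus. -/
def cube (d : ℕ) : Set (Fin d → ℝ) := Set.Icc 0 (fun _ => 2 * Real.pi)

/-- The convolution kernel of the Fourier multiplier on `ℤ^d` with symbol `m(ξ)`. -/
def multKernel (d : ℕ) (m : (Fin d → ℝ) → ℝ) (x : Fin d → ℤ) : ℂ :=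
  ((((2 * Real.pi) ^ d)⁻¹ : ℝ) : ℂ) *
    ∫ ξ in cube d,
      Complex.exp (Complex.I * ((∑ j : Fin d, (x j : ℝ) * ξ j : ℝ) : ℂ)) * ((m ξ : ℝ) : ℂ)

/-- The propagator `cos(t√(1−Δ))`, realized as the Fourier multiplier with symbol
`cos(t ω(ξ))`. -/
def cosProp (d : ℕ) (t : ℝ) (f : (Fin d → ℤ) → ℂ) (x : Fin d → ℤ) : ℂ :=
  ∑' y : Fin d → ℤ, multKernel d (fun ξ => Real.cos (t * omegaKG d ξ)) (x - y) * f y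

/-- The propagator `sin(t√(1−Δ))/√(1−Δ)`, realized as the Fourier multiplier with symbol
`sin(t ω(ξ))/ω(ξ)`. -/
def sinProp (d : ℕ) (t : ℝ) (f : (Fin d → ℤ) → ℂ) (x : Fin d → ℤ) : ℂ :=
  ∑' y : Fin d → ℤ, multKernel d (fun ξ => Real.sin (t * omegaKG d ξ) / omegaKG d ξ) (x - y) * f y

/-- The operator `√(1−Δ)`, realized as the Fourier multiplier with symbol `ω(ξ)`. -/
def sqrtOneSubLap (d : ℕ) (f : (Fin d → ℤ) → ℂ) (x : Fin d → ℤ) : ℂ :=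
  ∑' y : Fin d → ℤ, multKernel d (omegaKG d) (x - y) * f y

/-- The solution of the inhomogeneous discrete Klein--Gordon equation with data `(f,g)`
and forcing term `F`, given by Duhamel's formula. -/
def duhamel (d : ℕ) (t : ℝ) (f g : (Fin d → ℤ) → ℂ) (F : ℝ → (Fin d → ℤ) → ℂ)
    (x : Fin d → ℤ) : ℂ :=
  cosProp d t f x + sinProp d t g x + ∫ s in (0:ℝ)..t, sinProp d (t - s) (F s) x

/-- The `L^q` norm in time of an `ℝ≥0∞`-valued function. -/
def lqNorm (q : ℝ≥0∞) (g : ℝ → ℝ≥0∞) : ℝ≥0∞ :=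
  if q = ∞ then essSup g volume else (∫⁻ t, g t ^ q.toReal) ^ (1 / q.toReal)

/-- The mixed space-time norm `‖F‖_{L^q_t ℓ^r_x}`. -/
def mixedNorm (d : ℕ) (q r : ℝ≥0∞) (F : ℝ → (Fin d → ℤ) → ℂ) : ℝ≥0∞ :=
  lqNorm q fun t => eLpNorm (F t) r Measure.count

/-- The dispersive decay rate: `σ = 3/4` for `d = 2`, `σ = 7/6` for `d = 3`,
and `σ = 3/2 − δ` for `d = 4`. -/
def sigmaD (d : ℕ) (δ : ℝ) : ℝ :=
  if d = 2 then 3/4 else if d = 3 then 7/6 else 3/2 - δ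

/-- Every integral of `g` over a subinterval of `[a, b]` on which `P` holds has norm at most `B`. -/
def IntegralBoundOn (g : ℝ → ℂ) (a b : ℝ) (P : ℝ → Prop) (B : ℝ) : Prop :=
  ∀ c d, a ≤ c → c ≤ d → d ≤ b → (∀ r ∈ Set.Icc c d, P r) → ‖∫ r in c..d, g r‖ ≤ B

lemma intervalIntegrable_of_continuousOn_Icc {E : Type*} [NormedAddCommGroup E]
    {g : ℝ → E} {a b c d : ℝ}
    (hg : ContinuousOn g (Set.Icc a b)) (hac : a ≤ c) (hcd : c ≤ d) (hdb : d ≤ b) :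
    IntervalIntegrable g volume c d := by
  apply ContinuousOn.intervalIntegrable
  rw [Set.uIcc_of_le hcd]
  exact hg.mono (Set.Icc_subset_Icc hac hdb)

lemma norm_integral_le_of_monotone_split {g : ℝ → ℂ} {f : ℝ → ℝ} {a b y B₁ B₂ : ℝ} (hab : a ≤ b)
    (hg : ContinuousOn g (Set.Icc a b)) (hc : ContinuousOn f (Set.Icc a b))
    (hm : MonotoneOn f (Set.Icc a b)) (hB₁ : 0 ≤ B₁) (hB₂ : 0 ≤ B₂)
    (h₁ : IntegralBoundOn g a b (fun r => f r ≤ y) B₁)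
    (h₂ : IntegralBoundOn g a b (fun r => y ≤ f r) B₂) :
    ‖∫ r in a..b, g r‖ ≤ B₁ + B₂ := by
  rcases le_total (f b) y with h | h
  · have := h₁ a b le_rfl hab le_rfl fun r hr => (hm hr ⟨hab, le_rfl⟩ hr.2).trans h
    linarith
  rcases le_total y (f a) with h' | h'
  · have := h₂ a b le_rfl hab le_rfl fun r hr => h'.trans (hm ⟨le_rfl, hab⟩ hr hr.1)
    linarith
  obtain ⟨c, hcm, hcy⟩ := intermediate_value_Icc hab hc ⟨h', h⟩
  rw [← intervalIntegral.integral_add_adjacent_intervals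
    (intervalIntegrable_of_continuousOn_Icc hg le_rfl hcm.1 hcm.2)
    (intervalIntegrable_of_continuousOn_Icc hg hcm.1 hcm.2 le_rfl)]
  refine (norm_add_le _ _).trans (add_le_add ?_ ?_)
  · exact h₁ a c le_rfl hcm.1 hcm.2 fun r hr =>
      hcy ▸ hm ⟨hr.1, hr.2.trans hcm.2⟩ hcm hr.2
  · exact h₂ c b hcm.1 hcm.2 le_rfl fun r hr =>
      hcy ▸ hm hcm ⟨hcm.1.trans hr.1, hr.2⟩ hr.1

lemma norm_integral_le_of_abs_split {g : ℝ → ℂ} {f : ℝ → ℝ} {a b δ B₁ B₂ : ℝ} (hab : a ≤ b)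
    (hg : ContinuousOn g (Set.Icc a b)) (hc : ContinuousOn f (Set.Icc a b))
    (hm : MonotoneOn f (Set.Icc a b) ∨ AntitoneOn f (Set.Icc a b)) (hB₁ : 0 ≤ B₁) (hB₂ : 0 ≤ B₂)
    (h₁ : IntegralBoundOn g a b (fun r => δ ≤ |f r|) B₁)
    (h₂ : IntegralBoundOn g a b (fun r => |f r| ≤ δ) B₂) :
    ‖∫ r in a..b, g r‖ ≤ 2 * B₁ + B₂ := by
  wlog hmono : MonotoneOn f (Set.Icc a b) generalizing f
  · have hanti := hm.resolve_left hmono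
    exact this (f := fun r => - f r) hc.neg (Or.inl hanti.neg) (by simpa using h₁)
      (by simpa using h₂) hanti.neg
  have key : ‖∫ r in a..b, g r‖ ≤ B₁ + (B₂ + B₁) := by
    refine norm_integral_le_of_monotone_split (y := -δ) hab hg hc hmono hB₁ (by positivity) ?_ ?_
    · intro c d hac hcd hdb h
      exact h₁ c d hac hcd hdb fun r hr => by
        have := h r hr
        have := neg_abs_le (f r)
        linarith
    · intro c d hac hcd hdb h
      have hsub := Set.Icc_subset_Icc hac hdb
      refine norm_integral_le_of_monotone_split (y := δ) hcd (hg.mono hsub) (hc.mono hsub)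
        (hmono.mono hsub) hB₂ hB₁ ?_ ?_
      · intro c' d' hac' hcd' hdb' h'
        exact h₂ c' d' (hac.trans hac') hcd' (hdb'.trans hdb) fun r hr =>
          abs_le.2 ⟨h r ⟨hac'.trans hr.1, hr.2.trans hdb'⟩, h' r hr⟩
      · intro c' d' hac' hcd' hdb' h'
        exact h₁ c' d' (hac.trans hac') hcd' (hdb'.trans hdb) fun r hr =>
          (h' r hr).trans (le_abs_self _)
  linarith

lemma norm_exp_I_mul_ofReal' (x : ℝ) : ‖Complex.exp (Complex.I * x)‖ = 1 := by
  rw [mul_comm, Complex.norm_exp_ofReal_mul_I]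

lemma norm_integral_le_of_deriv_ge {g : ℝ → ℂ} {f f' : ℝ → ℝ} {a b δ l B : ℝ} (hab : a ≤ b)
    (hg : ContinuousOn g (Set.Icc a b)) (hg1 : ∀ r ∈ Set.Icc a b, ‖g r‖ ≤ 1)
    (hf : ∀ r ∈ Set.Icc a b, HasDerivAt f (f' r) r) (hl : 0 < l) (hδ : 0 ≤ δ)
    (hf' : (∀ r ∈ Set.Icc a b, l ≤ f' r) ∨ (∀ r ∈ Set.Icc a b, f' r ≤ -l)) (hB : 0 ≤ B)
    (h₁ : IntegralBoundOn g a b (fun r => δ ≤ |f r|) B) :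
    ‖∫ r in a..b, g r‖ ≤ 2 * B + 2 * δ / l := by
  wlog hpos : ∀ r ∈ Set.Icc a b, l ≤ f' r generalizing f f'
  · have hneg := hf'.resolve_left hpos
    have hneg' : ∀ r ∈ Set.Icc a b, l ≤ (fun r => - f' r) r := fun r hr => by
      have := hneg r hr
      simp only
      linarith
    exact this (f := fun r => - f r) (f' := fun r => - f' r) (fun r hr => (hf r hr).neg)
      (Or.inl hneg') (by simpa using h₁) hneg'
  have hinc : ∀ c d, a ≤ c → c ≤ d → d ≤ b → l * (d - c) ≤ f d - f c := by
    intro c d hac hcd hdb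
    have hsub := Set.Icc_subset_Icc hac hdb
    refine (convex_Icc c d).mul_sub_le_image_sub_of_le_deriv (f := f)
      (fun r hr => (hf r (hsub hr)).continuousAt.continuousWithinAt) ?_ ?_ c ⟨le_rfl, hcd⟩ d
      ⟨hcd, le_rfl⟩ hcd
    · intro r hr
      exact (hf r (hsub (interior_subset hr))).differentiableAt.differentiableWithinAt
    · intro r hr
      rw [(hf r (hsub (interior_subset hr))).deriv]
      exact hpos r (hsub (interior_subset hr))
  refine norm_integral_le_of_abs_split hab hg
    (fun r hr => (hf r hr).continuousAt.continuousWithinAt) (Or.inl ?_) hB (by positivity) h₁ ?_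
  · intro c hc d hd hcd
    have := hinc c d hc.1 hcd hd.2
    nlinarith
  · intro c d hac hcd hdb h
    have h1 := hinc c d hac hcd hdb
    have h2 := abs_le.1 (h c ⟨le_rfl, hcd⟩)
    have h3 := abs_le.1 (h d ⟨hcd, le_rfl⟩)
    have h4 : ‖∫ r in c..d, g r‖ ≤ 1 * |d - c| := by
      apply intervalIntegral.norm_integral_le_of_norm_le_const
      intro r hr
      rw [Set.uIoc_of_le hcd] at hr
      exact hg1 r ⟨hac.trans hr.1.le, hr.2.trans hdb⟩
    rw [one_mul, abs_of_nonneg (by linarith)] at h4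
    refine h4.trans ?_
    rw [le_div_iff₀ hl]
    linarith

lemma norm_integral_exp_le_of_monotone_phase {Φ f f' : ℝ → ℝ} {a b δ : ℝ} (hab : a ≤ b)
    (hΦ : ∀ r ∈ Set.Icc a b, HasDerivAt Φ (f r) r)
    (hf : ∀ r ∈ Set.Icc a b, HasDerivAt f (f' r) r) (hf' : ContinuousOn f' (Set.Icc a b))
    (hs : (∀ r ∈ Set.Icc a b, 0 ≤ f' r) ∨ (∀ r ∈ Set.Icc a b, f' r ≤ 0))
    (hδ : 0 < δ) (h : ∀ r ∈ Set.Icc a b, δ ≤ |f r|) :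
    ‖∫ r in a..b, Complex.exp (Complex.I * Φ r)‖ ≤ 4 / δ := by
  have hne : ∀ r ∈ Set.Icc a b, f r ≠ 0 := fun r hr h0 => by
    have := h r hr
    rw [h0, abs_zero] at this
    linarith
  have hfc : ContinuousOn f (Set.Icc a b) :=
    fun r hr => (hf r hr).continuousAt.continuousWithinAt
  have hu : ∀ r ∈ Set.uIcc a b, HasDerivAt (fun r => ((f r)⁻¹ : ℝ) * (-Complex.I))
      (((-(f' r) / (f r) ^ 2 : ℝ) : ℂ) * (-Complex.I)) r := by
    intro r hr
    rw [Set.uIcc_of_le hab] at hr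
    exact (((hf r hr).inv (hne r hr)).ofReal_comp).mul_const _
  have hv : ∀ r ∈ Set.uIcc a b, HasDerivAt (fun r => Complex.exp (Complex.I * Φ r))
      (Complex.exp (Complex.I * Φ r) * (Complex.I * f r)) r := by
    intro r hr
    rw [Set.uIcc_of_le hab] at hr
    exact (((hΦ r hr).ofReal_comp).const_mul Complex.I).cexp
  have hEc : ContinuousOn (fun r => Complex.exp (Complex.I * Φ r)) (Set.Icc a b) := fun r hr =>
    (hv r (by rwa [Set.uIcc_of_le hab])).continuousAt.continuousWithinAt
  have hq : ContinuousOn (fun r => f' r / (f r) ^ 2) (Set.Icc a b) :=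
    hf'.div (hfc.pow 2) fun r hr => pow_ne_zero 2 (hne r hr)
  have hu'c : ContinuousOn (fun r => ((-(f' r) / (f r) ^ 2 : ℝ) : ℂ) * (-Complex.I))
      (Set.Icc a b) := by
    refine ContinuousOn.mul ?_ continuousOn_const
    refine Complex.continuous_ofReal.comp_continuousOn ?_
    exact hq.neg.congr fun r _ => neg_div _ _
  have hv'c : ContinuousOn (fun r => Complex.exp (Complex.I * Φ r) * (Complex.I * f r))
      (Set.Icc a b) :=
    hEc.mul (continuousOn_const.mul (Complex.continuous_ofReal.comp_continuousOn hfc))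
  have key := intervalIntegral.integral_mul_deriv_eq_deriv_mul hu hv
    (intervalIntegrable_of_continuousOn_Icc hu'c le_rfl hab le_rfl)
    (intervalIntegrable_of_continuousOn_Icc hv'c le_rfl hab le_rfl)
  have e1 : ∫ r in a..b, Complex.exp (Complex.I * Φ r) = ∫ r in a..b,
      (((f r)⁻¹ : ℝ) * (-Complex.I)) * (Complex.exp (Complex.I * Φ r) * (Complex.I * f r)) := by
    apply intervalIntegral.integral_congr
    intro r hr
    rw [Set.uIcc_of_le hab] at hr
    have : (f r : ℂ) ≠ 0 := by exact_mod_cast hne r hr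
    push_cast
    field_simp
    linear_combination Complex.I_sq
  rw [e1, key]
  have hinv : ∀ r ∈ Set.Icc a b, |(f r)⁻¹| ≤ 1 / δ := by
    intro r hr
    rw [abs_inv, ← one_div]
    exact one_div_le_one_div_of_le hδ (h r hr)
  have hbd : ∀ r ∈ Set.Icc a b, ‖(((f r)⁻¹ : ℝ) : ℂ) * (-Complex.I) *
      Complex.exp (Complex.I * Φ r)‖ ≤ 1 / δ := by
    intro r hr
    rw [norm_mul, norm_mul, norm_exp_I_mul_ofReal', norm_neg, Complex.norm_I, mul_one, mul_one,
      Complex.norm_real]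
    exact hinv r hr
  have hint : ‖∫ r in a..b, ((-(f' r) / (f r) ^ 2 : ℝ) : ℂ) * (-Complex.I) *
      Complex.exp (Complex.I * Φ r)‖ ≤ 2 / δ := by
    have hq' : IntervalIntegrable (fun r => -(f' r) / (f r) ^ 2) volume a b :=
      intervalIntegrable_of_continuousOn_Icc (hq.neg.congr fun r _ => neg_div _ _) le_rfl hab le_rfl
    have hftc : ∫ r in a..b, -(f' r) / (f r) ^ 2 = (f b)⁻¹ - (f a)⁻¹ := by
      refine intervalIntegral.integral_eq_sub_of_hasDerivAt (f := fun r => (f r)⁻¹) ?_ hq'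
      intro r hr
      rw [Set.uIcc_of_le hab] at hr
      exact (hf r hr).inv (hne r hr)
    have h1 : ‖∫ r in a..b, ((-(f' r) / (f r) ^ 2 : ℝ) : ℂ) * (-Complex.I) *
        Complex.exp (Complex.I * Φ r)‖ ≤ ∫ r in a..b, |(-(f' r) / (f r) ^ 2)| := by
      refine (intervalIntegral.norm_integral_le_integral_norm hab).trans (le_of_eq ?_)
      congr 1
      ext r
      rw [norm_mul, norm_mul, norm_exp_I_mul_ofReal', norm_neg, Complex.norm_I, mul_one, mul_one,
        Complex.norm_real, Real.norm_eq_abs]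
    refine h1.trans ?_
    have h2 : ∫ r in a..b, |(-(f' r) / (f r) ^ 2)| = |∫ r in a..b, -(f' r) / (f r) ^ 2| := by
      rcases hs with hs | hs
      · have : Set.EqOn (fun r => |(-(f' r) / (f r) ^ 2)|) (fun r => -(-(f' r) / (f r) ^ 2))
            (Set.uIcc a b) := by
          intro r hr
          rw [Set.uIcc_of_le hab] at hr
          exact abs_of_nonpos (div_nonpos_of_nonpos_of_nonneg (by linarith [hs r hr])
            (sq_nonneg _))
        rw [intervalIntegral.integral_congr this, intervalIntegral.integral_neg,
          abs_of_nonpos]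
        rw [← neg_nonneg, ← intervalIntegral.integral_neg]
        exact intervalIntegral.integral_nonneg hab fun r hr => by
          rw [neg_div, neg_neg]
          exact div_nonneg (hs r hr) (sq_nonneg _)
      · have : Set.EqOn (fun r => |(-(f' r) / (f r) ^ 2)|) (fun r => (-(f' r) / (f r) ^ 2))
            (Set.uIcc a b) := by
          intro r hr
          rw [Set.uIcc_of_le hab] at hr
          exact abs_of_nonneg (div_nonneg (by linarith [hs r hr]) (sq_nonneg _))
        rw [intervalIntegral.integral_congr this, abs_of_nonneg]
        exact intervalIntegral.integral_nonneg hab fun r hr =>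
          div_nonneg (by linarith [hs r hr]) (sq_nonneg _)
    rw [h2, hftc]
    calc |(f b)⁻¹ - (f a)⁻¹| ≤ |(f b)⁻¹| + |(f a)⁻¹| := abs_sub _ _
      _ ≤ 1 / δ + 1 / δ := add_le_add (hinv b ⟨hab, le_rfl⟩) (hinv a ⟨le_rfl, hab⟩)
      _ = 2 / δ := by ring
  have hb := hbd b ⟨hab, le_rfl⟩
  have ha := hbd a ⟨le_rfl, hab⟩
  refine (norm_sub_le _ _).trans ?_
  refine (add_le_add ((norm_sub_le _ _).trans (add_le_add hb ha)) hint).trans (le_of_eq ?_)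
  ring

lemma le_or_le_neg_of_le_abs {f : ℝ → ℝ} {a b L : ℝ} (hL : 0 < L)
    (hc : ContinuousOn f (Set.Icc a b)) (h : ∀ r ∈ Set.Icc a b, L ≤ |f r|) :
    (∀ r ∈ Set.Icc a b, L ≤ f r) ∨ (∀ r ∈ Set.Icc a b, f r ≤ -L) := by
  by_contra! hcon
  obtain ⟨⟨r, hr, hr'⟩, s, hs, hs'⟩ := hcon
  have h1 : f r ≤ -L := by
    rcases le_abs.1 (h r hr) with h | h <;> linarith
  have h2 : L ≤ f s := by
    rcases le_abs.1 (h s hs) with h | h <;> linarith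
  obtain ⟨u, hu, hu0⟩ := isPreconnected_Icc.intermediate_value hr hs hc
    (show (0 : ℝ) ∈ Set.Icc (f r) (f s) from ⟨by linarith, by linarith⟩)
  have := h u hu
  rw [hu0, abs_zero] at this
  linarith

/-- Data for the weighted van der Corput lemma: `Φ' = f 0` and `(f i)' = f (i + 1) * m` for
`i < k`, with a weight `m ≥ m0 > 0`. -/
structure PhaseOn (Φ : ℝ → ℝ) (f : ℕ → ℝ → ℝ) (m : ℝ → ℝ) (m0 : ℝ) (k : ℕ) (a b : ℝ) : Prop where
  deriv_phase : ∀ r ∈ Set.Icc a b, HasDerivAt Φ (f 0 r) r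
  deriv : ∀ i < k, ∀ r ∈ Set.Icc a b, HasDerivAt (f i) (f (i + 1) r * m r) r
  cont_last : ContinuousOn (f k) (Set.Icc a b)
  cont_weight : ContinuousOn m (Set.Icc a b)
  weight_pos : 0 < m0
  le_weight : ∀ r ∈ Set.Icc a b, m0 ≤ m r

namespace PhaseOn
variable {Φ : ℝ → ℝ} {f : ℕ → ℝ → ℝ} {m : ℝ → ℝ} {m0 : ℝ} {k : ℕ} {a b : ℝ}

lemma mono {c d : ℝ} (h : PhaseOn Φ f m m0 k a b) (hac : a ≤ c) (hdb : d ≤ b) :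
    PhaseOn Φ f m m0 k c d :=
  have hs := Set.Icc_subset_Icc hac hdb
  ⟨fun r hr => h.1 r (hs hr), fun i hi r hr => h.2 i hi r (hs hr), h.3.mono hs, h.4.mono hs, h.5,
    fun r hr => h.6 r (hs hr)⟩

lemma contOn (h : PhaseOn Φ f m m0 k a b) {i : ℕ} (hi : i ≤ k) :
    ContinuousOn (f i) (Set.Icc a b) := by
  rcases hi.lt_or_eq with hi | rfl
  · exact fun r hr => (h.deriv i hi r hr).continuousAt.continuousWithinAt
  · exact h.cont_last

lemma of_le {j : ℕ} (h : PhaseOn Φ f m m0 k a b) (hj : j ≤ k) : PhaseOn Φ f m m0 j a b :=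
  ⟨h.1, fun i hi => h.2 i (hi.trans_le hj), h.contOn hj, h.4, h.5, h.6⟩

lemma continuousOn_exp (h : PhaseOn Φ f m m0 k a b) :
    ContinuousOn (fun r => Complex.exp (Complex.I * Φ r)) (Set.Icc a b) := fun r hr =>
  ((((h.deriv_phase r hr).ofReal_comp).const_mul Complex.I).cexp).continuousAt.continuousWithinAt

lemma norm_integral_exp_le (h : PhaseOn Φ f m m0 (k + 1) a b) (hab : a ≤ b) {L x : ℝ} (hx : 0 < x)
    (hL : 0 < L) (hfL : ∀ r ∈ Set.Icc a b, L ≤ |f (k + 1) r|)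
    (hLx : 1 ≤ L * m0 ^ (k + 1) * x ^ (k + 2)) :
    ‖∫ r in a..b, Complex.exp (Complex.I * Φ r)‖ ≤ (12 * 2 ^ k - 2) * x := by
  induction k generalizing a b L with
  | zero =>
    have hm0 := h.weight_pos
    have hsgn := le_or_le_neg_of_le_abs hL (h.contOn le_rfl) hfL
    have hd := h.deriv 0 (by norm_num)
    simp only [zero_add] at hd hsgn hLx h
    have key := norm_integral_le_of_deriv_ge (B := 4 * x) (δ := x⁻¹) (l := L * m0) hab
      h.continuousOn_exp (fun r _ => (norm_exp_I_mul_ofReal' _).le) hd (by positivity)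
      (by positivity) ?_ (by positivity) ?_
    · refine key.trans ?_
      have : 2 * x⁻¹ / (L * m0) ≤ 2 * x := by
        rw [div_le_iff₀ (by positivity), inv_eq_one_div, mul_one_div, div_le_iff₀ hx]
        nlinarith
      linarith
    · rcases hsgn with hs | hs
      · left
        intro r hr
        exact mul_le_mul (hs r hr) (h.le_weight r hr) hm0.le (hL.le.trans (hs r hr))
      · right
        intro r hr
        have := mul_le_mul (le_neg.1 (hs r hr)) (h.le_weight r hr) hm0.le
          (hL.le.trans (le_neg.1 (hs r hr)))
        linarith
    · intro c d hac hcd hdb hP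
      have h' := h.mono hac hdb
      have hsub := Set.Icc_subset_Icc hac hdb
      have := norm_integral_exp_le_of_monotone_phase (δ := x⁻¹) hcd h'.deriv_phase
        (h'.deriv 0 (by norm_num)) (h'.cont_last.mul h'.cont_weight) ?_ (by positivity) hP
      · simpa using this
      · rcases hsgn with hs | hs
        · left
          intro r hr
          exact mul_nonneg (hL.le.trans (hs r (hsub hr))) (hm0.le.trans (h'.le_weight r hr))
        · right
          intro r hr
          exact mul_nonpos_of_nonpos_of_nonneg (by simp only [zero_add]; linarith [hs r (hsub hr)])
            (hm0.le.trans (h'.le_weight r hr))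
  | succ k ih =>
    have hm0 := h.weight_pos
    have hsgn := le_or_le_neg_of_le_abs hL (h.contOn le_rfl) hfL
    have hpow : (1 : ℝ) ≤ 2 ^ k := one_le_pow₀ (by norm_num)
    have key := norm_integral_le_of_deriv_ge (B := (12 * 2 ^ k - 2) * x) (δ := L * m0 * x)
      (l := L * m0) hab h.continuousOn_exp (fun r _ => (norm_exp_I_mul_ofReal' _).le)
      (h.deriv (k + 1) (by omega)) (by positivity) (by positivity) ?_
      (mul_nonneg (by linarith) hx.le) ?_
    · refine key.trans (le_of_eq ?_)
      field_simp
      ring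
    · rcases hsgn with hs | hs
      · left
        intro r hr
        exact mul_le_mul (hs r hr) (h.le_weight r hr) hm0.le (hL.le.trans (hs r hr))
      · right
        intro r hr
        have := mul_le_mul (le_neg.1 (hs r hr)) (h.le_weight r hr) hm0.le
          (hL.le.trans (le_neg.1 (hs r hr)))
        linarith
    · intro c d hac hcd hdb hP
      refine ih ((h.mono hac hdb).of_le (by omega)) hcd (by positivity) hP (hLx.trans (le_of_eq ?_))
      ring

end PhaseOn

/-- `f` is `C¹` on `[a, b]`, bounded by `M` and of total variation at most `M`. -/
def BVOn (f : ℝ → ℂ) (M a b : ℝ) : Prop :=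
  ∃ f' : ℝ → ℂ, (∀ r ∈ Set.Icc a b, HasDerivAt f (f' r) r) ∧ ContinuousOn f' (Set.Icc a b) ∧
    (∀ r ∈ Set.Icc a b, ‖f r‖ ≤ M) ∧ ∫ r in a..b, ‖f' r‖ ≤ M

namespace BVOn
variable {f g : ℝ → ℂ} {M N a b : ℝ}

lemma contOn (h : BVOn f M a b) : ContinuousOn f (Set.Icc a b) := by
  obtain ⟨f', h1, -⟩ := h
  exact fun r hr => (h1 r hr).continuousAt.continuousWithinAt

lemma weaken (h : BVOn f M a b) (hMN : M ≤ N) : BVOn f N a b := by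
  obtain ⟨f', h1, h2, h3, h4⟩ := h
  exact ⟨f', h1, h2, fun r hr => (h3 r hr).trans hMN, h4.trans hMN⟩

lemma nonneg (h : BVOn f M a b) (hab : a ≤ b) : 0 ≤ M := by
  obtain ⟨f', h1, h2, h3, h4⟩ := h
  exact (norm_nonneg _).trans (h3 a ⟨le_rfl, hab⟩)

lemma mono {c d : ℝ} (h : BVOn f M a b) (hac : a ≤ c) (hcd : c ≤ d) (hdb : d ≤ b) :
    BVOn f M c d := by
  obtain ⟨f', h1, h2, h3, h4⟩ := h
  have hs := Set.Icc_subset_Icc hac hdb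
  refine ⟨f', fun r hr => h1 r (hs hr), h2.mono hs, fun r hr => h3 r (hs hr), le_trans ?_ h4⟩
  refine intervalIntegral.integral_mono_interval hac hcd hdb ?_
    (intervalIntegrable_of_continuousOn_Icc h2.norm le_rfl (hac.trans (hcd.trans hdb)) le_rfl)
  exact Filter.Eventually.of_forall fun r => norm_nonneg _

lemma of_bound (f' : ℝ → ℂ) (g : ℝ → ℝ) (hab : a ≤ b)
    (h1 : ∀ r ∈ Set.Icc a b, HasDerivAt f (f' r) r)
    (h2 : ContinuousOn f' (Set.Icc a b)) (h3 : ∀ r ∈ Set.Icc a b, ‖f r‖ ≤ M)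
    (hg : ContinuousOn g (Set.Icc a b)) (h4 : ∀ r ∈ Set.Icc a b, ‖f' r‖ ≤ g r)
    (h5 : ∫ r in a..b, g r ≤ M) : BVOn f M a b :=
  ⟨f', h1, h2, h3, (intervalIntegral.integral_mono_on hab
    (intervalIntegrable_of_continuousOn_Icc h2.norm le_rfl hab le_rfl)
    (intervalIntegrable_of_continuousOn_Icc hg le_rfl hab le_rfl) h4).trans h5⟩

lemma mul (hf : BVOn f M a b) (hg : BVOn g N a b) (hab : a ≤ b) :
    BVOn (fun r => f r * g r) (2 * M * N) a b := by
  have hM := hf.nonneg hab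
  have hN := hg.nonneg hab
  have hfc := hf.contOn
  have hgc := hg.contOn
  obtain ⟨f', h1, h2, h3, h4⟩ := hf
  obtain ⟨g', k1, k2, k3, k4⟩ := hg
  have hMN : 0 ≤ M * N := by positivity
  have i1 := intervalIntegrable_of_continuousOn_Icc h2.norm le_rfl hab le_rfl
  have i2 := intervalIntegrable_of_continuousOn_Icc k2.norm le_rfl hab le_rfl
  refine of_bound (fun r => f' r * g r + f r * g' r) (fun r => N * ‖f' r‖ + M * ‖g' r‖) hab
    (fun r hr => (h1 r hr).mul (k1 r hr)) ((h2.mul hgc).add (hfc.mul k2)) ?_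
    ((continuousOn_const.mul h2.norm).add (continuousOn_const.mul k2.norm)) ?_ ?_
  · intro r hr
    rw [norm_mul]
    have := mul_le_mul (h3 r hr) (k3 r hr) (norm_nonneg _) hM
    linarith
  · intro r hr
    refine (norm_add_le _ _).trans ?_
    rw [norm_mul, norm_mul, mul_comm N]
    gcongr
    · exact k3 r hr
    · exact h3 r hr
  · rw [intervalIntegral.integral_add (i1.const_mul _) (i2.const_mul _),
      intervalIntegral.integral_const_mul, intervalIntegral.integral_const_mul]
    nlinarith

/-- Integration by parts: an oscillating factor against an amplitude of bounded variation. -/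
lemma norm_integral_mul_le (hf : BVOn f M a b) (hab : a ≤ b) {B : ℝ}
    (hg : ContinuousOn g (Set.Icc a b)) (hB : ∀ c, a ≤ c → c ≤ b → ‖∫ r in a..c, g r‖ ≤ B) :
    ‖∫ r in a..b, f r * g r‖ ≤ 2 * M * B := by
  have hM := hf.nonneg hab
  have hB0 : 0 ≤ B := (norm_nonneg _).trans (hB b hab le_rfl)
  have hfc := hf.contOn
  obtain ⟨f', h1, h2, h3, h4⟩ := hf
  have ig : IntervalIntegrable g volume a b :=
    intervalIntegrable_of_continuousOn_Icc hg le_rfl hab le_rfl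
  have if' : IntervalIntegrable f' volume a b :=
    intervalIntegrable_of_continuousOn_Icc h2 le_rfl hab le_rfl
  have hGc : ContinuousOn (fun c => ∫ r in a..c, g r) (Set.uIcc a b) :=
    intervalIntegral.continuousOn_primitive_interval' ig Set.left_mem_uIcc
  have key := intervalIntegral.integral_mul_deriv_eq_deriv_mul_of_hasDeriv_right
    (u := f) (v := fun c => ∫ r in a..c, g r) (u' := f') (v' := g) (a := a) (b := b)
    (by rwa [Set.uIcc_of_le hab]) hGc ?_ ?_ if' ig
  · rw [key]
    simp only [intervalIntegral.integral_same, mul_zero, sub_zero]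
    have e1 : ‖f b * ∫ r in a..b, g r‖ ≤ M * B := by
      rw [norm_mul]
      exact mul_le_mul (h3 b ⟨hab, le_rfl⟩) (hB b hab le_rfl) (norm_nonneg _) hM
    have e2 : ‖∫ x in a..b, f' x * ∫ r in a..x, g r‖ ≤ M * B := by
      refine (intervalIntegral.norm_integral_le_of_norm_le (g := fun r => ‖f' r‖ * B) hab ?_
        (if'.norm.mul_const _)).trans ?_
      · refine Filter.Eventually.of_forall fun r hr => ?_
        rw [norm_mul]
        gcongr
        exact hB r hr.1.le hr.2
      · rw [intervalIntegral.integral_mul_const]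
        gcongr
    calc _ ≤ _ := norm_sub_le _ _
      _ ≤ M * B + M * B := add_le_add e1 e2
      _ = _ := by ring
  · intro x hx
    rw [min_eq_left hab, max_eq_right hab] at hx
    exact (h1 x ⟨hx.1.le, hx.2.le⟩).hasDerivWithinAt
  · intro x hx
    rw [min_eq_left hab, max_eq_right hab] at hx
    have hcx : ContinuousAt g x := hg.continuousAt (Icc_mem_nhds hx.1 hx.2)
    refine (intervalIntegral.integral_hasDerivAt_right
      (intervalIntegrable_of_continuousOn_Icc hg le_rfl hx.1.le hx.2.le) ?_ hcx).hasDerivWithinAt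
    exact (hg.mono Set.Ioo_subset_Icc_self).stronglyMeasurableAtFilter isOpen_Ioo x hx

end BVOn

/-- The integral `∫ (-i cos ξ)^k e^{i(nξ - r cos ξ)} dξ` over a period: the `k`-th derivative in `r`
of a Bessel function of the first kind, up to a unimodular factor and `2π`. -/
def besselMom (k : ℕ) (n : ℤ) (r : ℝ) : ℂ :=
  ∫ ξ in (0 : ℝ)..(2 * π), (-Complex.I * (Real.cos ξ : ℝ)) ^ k *
    Complex.exp (Complex.I * ((n * ξ - r * Real.cos ξ : ℝ) : ℂ))

lemma norm_neg_I_mul_cos_le (ξ : ℝ) : ‖-Complex.I * (Real.cos ξ : ℝ)‖ ≤ 1 := by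
  rw [norm_mul, norm_neg, Complex.norm_I, one_mul, Complex.norm_real]
  exact Real.abs_cos_le_one ξ

lemma hasDerivAt_besselMom (k : ℕ) (n : ℤ) (r : ℝ) :
    HasDerivAt (besselMom k n) (besselMom (k + 1) n r) r := by
  have hc : ∀ (j : ℕ) (r : ℝ), Continuous fun ξ : ℝ => (-Complex.I * (Real.cos ξ : ℝ)) ^ j *
    Complex.exp (Complex.I * ((n * ξ - r * Real.cos ξ : ℝ) : ℂ)) := fun j r => by fun_prop
  refine (intervalIntegral.hasDerivAt_integral_of_dominated_loc_of_deriv_le (𝕜 := ℝ)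
    (bound := fun _ => 1) (s := Set.univ)
    (F := fun r ξ => (-Complex.I * (Real.cos ξ : ℝ)) ^ k *
      Complex.exp (Complex.I * ((n * ξ - r * Real.cos ξ : ℝ) : ℂ)))
    (F' := fun r ξ => (-Complex.I * (Real.cos ξ : ℝ)) ^ (k + 1) *
      Complex.exp (Complex.I * ((n * ξ - r * Real.cos ξ : ℝ) : ℂ)))
    Filter.univ_mem ?_ ?_ ?_ ?_ ?_ ?_).2
  · exact Filter.Eventually.of_forall fun r => (hc k r).aestronglyMeasurable
  · exact (hc k r).intervalIntegrable _ _
  · exact (hc _ r).aestronglyMeasurable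
  · refine Filter.Eventually.of_forall fun ξ _ r _ => ?_
    rw [norm_mul, norm_exp_I_mul_ofReal', mul_one, norm_pow]
    exact pow_le_one₀ (norm_nonneg _) (norm_neg_I_mul_cos_le ξ)
  · exact intervalIntegrable_const
  · refine Filter.Eventually.of_forall fun ξ _ r _ => ?_
    have h1 : HasDerivAt (fun r : ℝ => (n * ξ - r * Real.cos ξ : ℝ)) (-Real.cos ξ) r := by
      simpa using (((hasDerivAt_id r).mul_const (Real.cos ξ)).const_sub (n * ξ))
    have h2 := ((h1.ofReal_comp.const_mul Complex.I).cexp).const_mul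
      ((-Complex.I * (Real.cos ξ : ℝ)) ^ k)
    refine h2.congr_deriv ?_
    push_cast
    ring

lemma norm_besselMom_le (k : ℕ) (n : ℤ) (r : ℝ) : ‖besselMom k n r‖ ≤ 2 * π := by
  have := intervalIntegral.norm_integral_le_of_norm_le_const (a := 0) (b := 2 * π) (C := 1)
    (f := fun ξ : ℝ => (-Complex.I * (Real.cos ξ : ℝ)) ^ k *
    Complex.exp (Complex.I * ((n * ξ - r * Real.cos ξ : ℝ) : ℂ))) ?_
  · rw [one_mul, sub_zero, abs_of_pos (by positivity)] at this
    exact this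
  · intro ξ _
    rw [norm_mul, norm_exp_I_mul_ofReal', mul_one, norm_pow]
    exact pow_le_one₀ (norm_nonneg _) (norm_neg_I_mul_cos_le ξ)

lemma bessel_ode (n : ℤ) (r : ℝ) : (r : ℂ) ^ 2 * besselMom 2 n r + r * besselMom 1 n r +
    ((r : ℂ) ^ 2 - n ^ 2) * besselMom 0 n r = 0 := by
  have hc : ∀ (j : ℕ), IntervalIntegrable (fun ξ : ℝ => (-Complex.I * (Real.cos ξ : ℝ)) ^ j *
    Complex.exp (Complex.I * ((n * ξ - r * Real.cos ξ : ℝ) : ℂ))) volume 0 (2 * π) := fun j =>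
      Continuous.intervalIntegrable (by fun_prop) _ _
  unfold besselMom
  rw [← intervalIntegral.integral_const_mul, ← intervalIntegral.integral_const_mul,
    ← intervalIntegral.integral_const_mul,
    ← intervalIntegral.integral_add ((hc 2).const_mul _) ((hc 1).const_mul _),
    ← intervalIntegral.integral_add (((hc 2).const_mul _).add ((hc 1).const_mul _))
      ((hc 0).const_mul _)]
  have hd : ∀ ξ ∈ Set.uIcc (0:ℝ) (2 * π), HasDerivAt (fun ξ : ℝ => -Complex.I *
      ((r * Real.sin ξ - n : ℝ) *
        Complex.exp (Complex.I * ((n * ξ - r * Real.cos ξ : ℝ) : ℂ))))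
      ((r : ℂ) ^ 2 * ((-Complex.I * (Real.cos ξ : ℝ)) ^ 2 *
        Complex.exp (Complex.I * ((n * ξ - r * Real.cos ξ : ℝ) : ℂ))) +
        r * ((-Complex.I * (Real.cos ξ : ℝ)) ^ 1 *
          Complex.exp (Complex.I * ((n * ξ - r * Real.cos ξ : ℝ) : ℂ))) +
        ((r : ℂ) ^ 2 - n ^ 2) * ((-Complex.I * (Real.cos ξ : ℝ)) ^ 0 *
          Complex.exp (Complex.I * ((n * ξ - r * Real.cos ξ : ℝ) : ℂ)))) ξ := by
    intro ξ _
    have h1 : HasDerivAt (fun ξ : ℝ => (n * ξ - r * Real.cos ξ : ℝ)) (n + r * Real.sin ξ) ξ := by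
      refine (((hasDerivAt_id ξ).const_mul (n : ℝ)).sub
        ((Real.hasDerivAt_cos ξ).const_mul r)).congr_deriv ?_
      ring
    have h2 : HasDerivAt (fun ξ : ℝ => (r * Real.sin ξ - n : ℝ)) (r * Real.cos ξ) ξ :=
      ((Real.hasDerivAt_sin ξ).const_mul r).sub_const _
    have h3 := (h2.ofReal_comp.mul (h1.ofReal_comp.const_mul Complex.I).cexp).const_mul (-Complex.I)
    refine h3.congr_deriv ?_
    have hI := Complex.I_sq
    have hs : (Complex.sin ξ) ^ 2 + (Complex.cos ξ) ^ 2 = 1 := Complex.sin_sq_add_cos_sq _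
    push_cast
    generalize Complex.exp (Complex.I * (n * ξ - r * Complex.cos ξ)) = e
    linear_combination ((r : ℂ) ^ 2 * e) * hs - (r ^ 2 * (Complex.cos ξ) ^ 2 * e + e *
      (r ^ 2 * (Complex.sin ξ) ^ 2 - n ^ 2)) * hI
  rw [intervalIntegral.integral_eq_sub_of_hasDerivAt hd (Continuous.intervalIntegrable
    (by fun_prop) _ _)]
  have e1 : Complex.exp (Complex.I * ((n * (2 * π) - r * Real.cos (2 * π) : ℝ) : ℂ)) =
      Complex.exp (Complex.I * ((n * 0 - r * Real.cos 0 : ℝ) : ℂ)) := by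
    rw [Real.cos_two_pi, Real.cos_zero]
    have : Complex.I * ((n * (2 * π) - r * 1 : ℝ) : ℂ) =
        Complex.I * ((n * 0 - r * 1 : ℝ) : ℂ) + n * (2 * π * Complex.I) := by
      push_cast
      ring
    rw [this, Complex.exp_periodic.int_mul n]
  rw [e1, Real.sin_two_pi, Real.sin_zero, sub_self]

lemma trig_octant {j : ℕ} (hj : j < 8) :
    ((∀ ξ ∈ Set.Icc (j * (π / 4)) ((j + 1 : ℕ) * (π / 4)), 0 ≤ Real.cos ξ) ∨
      (∀ ξ ∈ Set.Icc (j * (π / 4)) ((j + 1 : ℕ) * (π / 4)), Real.cos ξ ≤ 0)) ∧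
    ((∀ ξ ∈ Set.Icc (j * (π / 4)) ((j + 1 : ℕ) * (π / 4)), 1 / 2 ≤ Real.cos ξ ^ 2) ∨
      (∀ ξ ∈ Set.Icc (j * (π / 4)) ((j + 1 : ℕ) * (π / 4)), 1 / 2 ≤ Real.sin ξ ^ 2)) := by
  have hπ := Real.pi_pos
  have A0 : ∀ ξ : ℝ, 0 ≤ ξ → ξ ≤ π / 2 → 0 ≤ Real.cos ξ := fun ξ h1 h2 =>
    Real.cos_nonneg_of_mem_Icc ⟨by linarith, h2⟩
  have A1 : ∀ ξ : ℝ, π / 2 ≤ ξ → ξ ≤ 3 * π / 2 → Real.cos ξ ≤ 0 := fun ξ h1 h2 =>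
    Real.cos_nonpos_of_pi_div_two_le_of_le h1 (by linarith)
  have A2 : ∀ ξ : ℝ, 3 * π / 2 ≤ ξ → ξ ≤ 5 * π / 2 → 0 ≤ Real.cos ξ := fun ξ h1 h2 => by
    rw [← Real.cos_sub_two_pi]
    exact Real.cos_nonneg_of_mem_Icc ⟨by linarith, by linarith⟩
  have A3 : ∀ ξ : ℝ, 5 * π / 2 ≤ ξ → ξ ≤ 7 * π / 2 → Real.cos ξ ≤ 0 := fun ξ h1 h2 => by
    rw [← Real.cos_sub_two_pi]
    exact A1 _ (by linarith) (by linarith)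
  have A4 : ∀ ξ : ℝ, 7 * π / 2 ≤ ξ → ξ ≤ 4 * π → 0 ≤ Real.cos ξ := fun ξ h1 h2 => by
    rw [← Real.cos_sub_two_pi]
    exact A2 _ (by linarith) (by linarith)
  have hcs : ∀ ξ : ℝ, 0 ≤ Real.cos (2 * ξ) → 1 / 2 ≤ Real.cos ξ ^ 2 := fun ξ h => by
    rw [Real.cos_two_mul] at h
    linarith
  have hsn : ∀ ξ : ℝ, Real.cos (2 * ξ) ≤ 0 → 1 / 2 ≤ Real.sin ξ ^ 2 := fun ξ h => by
    rw [Real.cos_two_mul] at h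
    nlinarith [Real.sin_sq_add_cos_sq ξ]
  interval_cases j <;> norm_num only [Nat.cast_ofNat, Nat.cast_zero, Nat.cast_one]
  · exact ⟨Or.inl fun ξ h => A0 _ (by linarith [h.1]) (by linarith [h.2]),
      Or.inl fun ξ h => hcs ξ (A0 _ (by linarith [h.1]) (by linarith [h.2]))⟩
  · exact ⟨Or.inl fun ξ h => A0 _ (by linarith [h.1]) (by linarith [h.2]),
      Or.inr fun ξ h => hsn ξ (A1 _ (by linarith [h.1]) (by linarith [h.2]))⟩
  · exact ⟨Or.inr fun ξ h => A1 _ (by linarith [h.1]) (by linarith [h.2]),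
      Or.inr fun ξ h => hsn ξ (A1 _ (by linarith [h.1]) (by linarith [h.2]))⟩
  · exact ⟨Or.inr fun ξ h => A1 _ (by linarith [h.1]) (by linarith [h.2]),
      Or.inl fun ξ h => hcs ξ (A2 _ (by linarith [h.1]) (by linarith [h.2]))⟩
  · exact ⟨Or.inr fun ξ h => A1 _ (by linarith [h.1]) (by linarith [h.2]),
      Or.inl fun ξ h => hcs ξ (A2 _ (by linarith [h.1]) (by linarith [h.2]))⟩
  · exact ⟨Or.inr fun ξ h => A1 _ (by linarith [h.1]) (by linarith [h.2]),
      Or.inr fun ξ h => hsn ξ (A3 _ (by linarith [h.1]) (by linarith [h.2]))⟩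
  · exact ⟨Or.inl fun ξ h => A2 _ (by linarith [h.1]) (by linarith [h.2]),
      Or.inr fun ξ h => hsn ξ (A3 _ (by linarith [h.1]) (by linarith [h.2]))⟩
  · exact ⟨Or.inl fun ξ h => A2 _ (by linarith [h.1]) (by linarith [h.2]),
      Or.inl fun ξ h => hcs ξ (A4 _ (by linarith [h.1]) (by linarith [h.2]))⟩

lemma bvOn_neg_I_mul_cos_pow {k : ℕ} (hk : k ≤ 1) {a b : ℝ} (hab : a ≤ b) (hba : b - a ≤ 1) :
    BVOn (fun ξ => (-Complex.I * (Real.cos ξ : ℝ)) ^ k) 1 a b := by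
  have hI : ∫ _ in a..b, (1 : ℝ) ≤ 1 := by simpa using hba
  refine BVOn.of_bound (fun ξ => if k = 0 then 0 else Complex.I * (Real.sin ξ : ℝ)) (fun _ => 1)
    hab ?_ ?_ ?_ continuousOn_const ?_ hI
  · intro r _
    interval_cases k
    · simpa using hasDerivAt_const r (1 : ℂ)
    · have := ((Real.hasDerivAt_cos r).ofReal_comp).const_mul (-Complex.I)
      simpa using this
  · interval_cases k <;> simp <;> fun_prop
  · intro r _
    rw [norm_pow]
    exact pow_le_one₀ (norm_nonneg _) (norm_neg_I_mul_cos_le r)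
  · intro r _
    interval_cases k
    · simp
    · have := Real.abs_sin_le_one r
      simp only [one_ne_zero, if_false, norm_mul, Complex.norm_I, one_mul, Complex.norm_real]
      exact this

lemma norm_besselMom_le_of_octants {k : ℕ} (hk : k ≤ 1) {n : ℤ} {r P : ℝ}
    (h : ∀ j : ℕ, j < 8 → ∀ c d : ℝ, j * (π / 4) ≤ c → c ≤ d → d ≤ ((j + 1 : ℕ) : ℝ) * (π / 4) →
      ‖∫ ξ in c..d, Complex.exp (Complex.I * ((n * ξ - r * Real.cos ξ : ℝ) : ℂ))‖ ≤ P) :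
    ‖besselMom k n r‖ ≤ 16 * P := by
  have hπ := Real.pi_pos
  have hπ4 := Real.pi_lt_four
  have hsum := intervalIntegral.sum_integral_adjacent_intervals (μ := volume) (n := 8)
    (a := fun j : ℕ => j * (π / 4))
    (f := fun ξ : ℝ => (-Complex.I * (Real.cos ξ : ℝ)) ^ k *
      Complex.exp (Complex.I * ((n * ξ - r * Real.cos ξ : ℝ) : ℂ)))
    (fun _ _ => Continuous.intervalIntegrable (by fun_prop) _ _)
  have e0 : ((0 : ℕ) : ℝ) * (π / 4) = 0 := by simp
  have e8 : ((8 : ℕ) : ℝ) * (π / 4) = 2 * π := by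
    push_cast
    ring
  rw [e0, e8] at hsum
  rw [besselMom, ← hsum]
  refine (norm_sum_le _ _).trans ?_
  have : ∀ j ∈ Finset.range 8, ‖∫ ξ in (j * (π / 4))..((j + 1 : ℕ) * (π / 4)),
      (-Complex.I * (Real.cos ξ : ℝ)) ^ k *
      Complex.exp (Complex.I * ((n * ξ - r * Real.cos ξ : ℝ) : ℂ))‖ ≤ 2 * P := by
    intro j hj
    have hle : (j : ℝ) * (π / 4) ≤ (j + 1 : ℕ) * (π / 4) := by
      push_cast
      nlinarith
    have := (bvOn_neg_I_mul_cos_pow hk hle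
      (by push_cast; linarith)).norm_integral_mul_le hle
      (g := fun ξ : ℝ => Complex.exp (Complex.I * ((n * ξ - r * Real.cos ξ : ℝ) : ℂ)))
      (Continuous.continuousOn (by fun_prop))
      (fun c hc hcb => h j (Finset.mem_range.1 hj) _ c le_rfl hc hcb)
    linarith
  refine (Finset.sum_le_sum this).trans ?_
  rw [Finset.sum_const, Finset.card_range]
  norm_num
  linarith

lemma phaseOn_bessel (n : ℤ) (r a b : ℝ) :
    PhaseOn (fun ξ => n * ξ - r * Real.cos ξ)
      (fun i ξ => if i = 0 then n + r * Real.sin ξ else if i = 1 then r * Real.cos ξ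
        else -(r * Real.sin ξ)) (fun _ => 1) 1 2 a b where
  deriv_phase ξ _ := by
    refine (((hasDerivAt_id ξ).const_mul (n : ℝ)).sub
      ((Real.hasDerivAt_cos ξ).const_mul r)).congr_deriv ?_
    simp
  deriv i hi ξ _ := by
    interval_cases i
    · refine (((Real.hasDerivAt_sin ξ).const_mul r).const_add (n : ℝ)).congr_deriv ?_
      simp
    · refine ((Real.hasDerivAt_cos ξ).const_mul r).congr_deriv ?_
      simp
  cont_last := by
    norm_num
    fun_prop
  cont_weight := continuousOn_const
  weight_pos := one_pos
  le_weight _ _ := le_rfl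

lemma bessel_piece_first {n : ℤ} {r c d x : ℝ} (hr : 0 < r) (hcd : c ≤ d) (hx : 0 < x)
    (hcos : ∀ ξ ∈ Set.Icc c d, 1 / 2 ≤ Real.cos ξ ^ 2) (hrx : 1 ≤ r / 2 * x ^ 2) :
    ‖∫ ξ in c..d, Complex.exp (Complex.I * ((n * ξ - r * Real.cos ξ : ℝ) : ℂ))‖ ≤ 10 * x := by
  have := ((phaseOn_bessel n r c d).of_le (j := 0 + 1) (by norm_num)).norm_integral_exp_le hcd hx
    (L := r / 2) (by positivity) ?_ (by simpa using hrx)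
  · norm_num at this ⊢
    exact this
  · intro ξ hξ
    have h1 := hcos ξ hξ
    have h2 : 1 / 2 ≤ |Real.cos ξ| := by
      rw [← sq_abs] at h1
      nlinarith [abs_nonneg (Real.cos ξ)]
    simp only [zero_add, one_ne_zero, if_false, if_true, abs_mul, abs_of_pos hr]
    nlinarith

lemma bessel_piece_second {n : ℤ} {r c d x : ℝ} (hr : 0 < r) (hcd : c ≤ d) (hx : 0 < x)
    (hsin : ∀ ξ ∈ Set.Icc c d, 1 / 2 ≤ Real.sin ξ ^ 2) (hrx : 1 ≤ r / 2 * x ^ 3) :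
    ‖∫ ξ in c..d, Complex.exp (Complex.I * ((n * ξ - r * Real.cos ξ : ℝ) : ℂ))‖ ≤ 22 * x := by
  have := ((phaseOn_bessel n r c d).of_le (j := 1 + 1) (by norm_num)).norm_integral_exp_le hcd hx
    (L := r / 2) (by positivity) ?_ (by simpa using hrx)
  · norm_num at this ⊢
    exact this
  · intro ξ hξ
    have h1 := hsin ξ hξ
    have h2 : 1 / 2 ≤ |Real.sin ξ| := by
      rw [← sq_abs] at h1
      nlinarith [abs_nonneg (Real.sin ξ)]
    norm_num [abs_mul, abs_of_pos hr]
    nlinarith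

lemma norm_bessel_cube_mul_le : ∃ C > (0:ℝ), ∀ (n : ℤ) (r : ℝ), 0 ≤ r →
    ‖besselMom 0 n r‖ ^ 3 * r ≤ C := by
  refine ⟨352 ^ 3 * 8, by norm_num, fun n r hr => ?_⟩
  have hB := norm_besselMom_le 0 n r
  have hπ := Real.pi_lt_four
  have hB0 := norm_nonneg (besselMom 0 n r)
  rcases le_total r 1 with h1 | h1
  · have : ‖besselMom 0 n r‖ ^ 3 ≤ 8 ^ 3 := by
      gcongr
      linarith
    nlinarith
  have hr0 : 0 < r := by linarith
  obtain ⟨x, hx, hrx⟩ : ∃ x : ℝ, 0 < x ∧ r * x ^ 3 = 8 := by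
    refine ⟨2 * r ^ (-(1 / 3 : ℝ)), by positivity, ?_⟩
    rw [mul_pow, ← Real.rpow_natCast (r ^ _), ← Real.rpow_mul hr]
    norm_num
    rw [Real.rpow_neg_one]
    field_simp
  have hx2 : x ≤ 2 := by
    by_contra! hcon
    have : 2 ^ 3 < x ^ 3 := by gcongr
    nlinarith
  have key := norm_besselMom_le_of_octants (k := 0) (n := n) (r := r) (P := 22 * x) (by norm_num) ?_
  · calc ‖besselMom 0 n r‖ ^ 3 * r ≤ (16 * (22 * x)) ^ 3 * r := by gcongr
      _ = 352 ^ 3 * (r * x ^ 3) := by ring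
      _ = _ := by rw [hrx]
  · intro j hj c d hc hcd hd
    have hsub := Set.Icc_subset_Icc hc hd
    rcases (trig_octant hj).2 with h | h
    · refine (bessel_piece_first hr0 hcd hx (fun ξ hξ => h ξ (hsub hξ)) ?_).trans (by linarith)
      nlinarith [sq_nonneg x]
    · exact bessel_piece_second hr0 hcd hx (fun ξ hξ => h ξ (hsub hξ)) (by linarith)

lemma bessel_piece_nonstationary {n : ℤ} {r δ : ℝ} (hr : 0 ≤ r) {j : ℕ} (hj : j < 8) {c d : ℝ}
    (hc : j * (π / 4) ≤ c) (hcd : c ≤ d) (hd : d ≤ ((j + 1 : ℕ) : ℝ) * (π / 4)) (hδ : 0 < δ)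
    (h : ∀ ξ ∈ Set.Icc c d, δ ≤ |n + r * Real.sin ξ|) :
    ‖∫ ξ in c..d, Complex.exp (Complex.I * ((n * ξ - r * Real.cos ξ : ℝ) : ℂ))‖ ≤ 4 / δ := by
  have hsub := Set.Icc_subset_Icc hc hd
  have hph := phaseOn_bessel n r c d
  refine norm_integral_exp_le_of_monotone_phase (Φ := fun ξ => n * ξ - r * Real.cos ξ)
    (f := fun ξ => n + r * Real.sin ξ) (f' := fun ξ => r * Real.cos ξ) hcd
    (fun ξ hξ => by simpa using hph.deriv_phase ξ hξ)
    (fun ξ hξ => by simpa using hph.deriv 0 (by norm_num) ξ hξ)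
    (Continuous.continuousOn (by fun_prop)) ?_ hδ h
  rcases (trig_octant hj).1 with h | h
  · exact Or.inl fun ξ hξ => mul_nonneg hr (h ξ (hsub hξ))
  · exact Or.inr fun ξ hξ => mul_nonpos_of_nonneg_of_nonpos hr (h ξ (hsub hξ))

lemma norm_bessel_mul_sub_le {n : ℤ} {r : ℝ} (hr : 0 ≤ r) (hrn : r < |(n : ℝ)|) :
    ‖besselMom 0 n r‖ * (|(n : ℝ)| - r) ≤ 64 := by
  have hδ : 0 < |(n : ℝ)| - r := by linarith
  have key := norm_besselMom_le_of_octants (k := 0) (n := n) (r := r) (P := 4 / (|(n : ℝ)| - r))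
    (by norm_num) ?_
  · rw [← le_div_iff₀ hδ]
    refine key.trans (le_of_eq ?_)
    ring
  · intro j hj c d hc hcd hd
    refine bessel_piece_nonstationary hr hj hc hcd hd hδ fun ξ _ => ?_
    have h1 := abs_sub_abs_le_abs_sub (n : ℝ) (-(r * Real.sin ξ))
    rw [sub_neg_eq_add, abs_neg, abs_mul, abs_of_nonneg hr] at h1
    have h2 := Real.abs_sin_le_one ξ
    nlinarith

lemma norm_besselMom_sq_mul_le {k : ℕ} (hk : k ≤ 1) {n : ℤ} {r : ℝ} (hr : 1 ≤ r)
    (hrn : 2 * |(n : ℝ)| ≤ r) : ‖besselMom k n r‖ ^ 2 * r ≤ 320 ^ 2 := by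
  have hr0 : 0 < r := by linarith
  have hs : 0 < √r := Real.sqrt_pos.2 hr0
  have hsq : √r ^ 2 = r := Real.sq_sqrt hr0.le
  have key := norm_besselMom_le_of_octants hk (n := n) (r := r) (P := 20 / √r) ?_
  · calc ‖besselMom k n r‖ ^ 2 * r ≤ (16 * (20 / √r)) ^ 2 * √r ^ 2 := by
          rw [hsq]
          gcongr
      _ = _ := by
        field_simp
        norm_num
  · intro j hj c d hc hcd hd
    have hsub := Set.Icc_subset_Icc hc hd
    rcases (trig_octant hj).2 with h | h
    · refine (bessel_piece_first (x := 2 / √r) hr0 hcd (by positivity)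
        (fun ξ hξ => h ξ (hsub hξ)) ?_).trans (le_of_eq (by ring))
      rw [div_pow, hsq]
      field_simp
      norm_num
    · refine (bessel_piece_nonstationary (δ := r / 5) hr0.le hj hc hcd hd (by positivity)
        fun ξ hξ => ?_).trans ?_
      · have h1 := abs_sub_abs_le_abs_sub (r * Real.sin ξ) (-(n : ℝ))
        rw [sub_neg_eq_add, abs_neg, abs_mul, abs_of_pos hr0, add_comm (r * Real.sin ξ)] at h1
        have h2 := h ξ (hsub hξ)
        have h3 : 7 / 10 ≤ |Real.sin ξ| := by
          rw [← sq_abs] at h2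
          nlinarith [abs_nonneg (Real.sin ξ)]
        nlinarith
      · have h1 : √r ≤ r := by
          rw [Real.sqrt_le_left hr0.le]
          nlinarith
        rw [div_le_div_iff₀ (by positivity) hs]
        linarith

/-- The quartic root `(r² - n²)^{1/4}`. -/
def wkbRoot (n : ℤ) (r : ℝ) : ℝ := √√(r ^ 2 - (n : ℝ) ^ 2)

/-- The Liouville--Green transform of the Bessel function. -/
def wkbU (n : ℤ) (r : ℝ) : ℂ := (wkbRoot n r : ℂ) * besselMom 0 n r

/-- The derivative conjugate to `wkbU`. -/
def wkbV (n : ℤ) (r : ℝ) : ℂ := ((r / wkbRoot n r : ℝ) : ℂ) * besselMom 1 n r +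
  ((r ^ 2 / (2 * wkbRoot n r ^ 5) : ℝ) : ℂ) * besselMom 0 n r

/-- The error term of the Liouville--Green transform, divided by `r`. -/
def wkbErr (n : ℤ) (r : ℝ) : ℝ := 5 / 4 * r ^ 3 / wkbRoot n r ^ 10 - r / wkbRoot n r ^ 6

section
variable {n : ℤ} {r : ℝ}

lemma sq_sub_sq_pos (hr : |(n : ℝ)| < r) : 0 < r ^ 2 - (n : ℝ) ^ 2 := by
  have h0 := abs_nonneg (n : ℝ)
  rw [← sq_abs (n : ℝ)]
  nlinarith

lemma wkbRoot_pos (hr : |(n : ℝ)| < r) : 0 < wkbRoot n r :=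
  Real.sqrt_pos.2 (Real.sqrt_pos.2 (sq_sub_sq_pos hr))

lemma wkbRoot_sq (n : ℤ) (r : ℝ) : wkbRoot n r ^ 2 = √(r ^ 2 - (n : ℝ) ^ 2) :=
  Real.sq_sqrt (Real.sqrt_nonneg _)

lemma wkbRoot_pow_four (hr : |(n : ℝ)| < r) : wkbRoot n r ^ 4 = r ^ 2 - (n : ℝ) ^ 2 := by
  rw [show wkbRoot n r ^ 4 = (wkbRoot n r ^ 2) ^ 2 by ring, wkbRoot_sq,
    Real.sq_sqrt (sq_sub_sq_pos hr).le]

lemma wkbRoot_sq_le (hr : |(n : ℝ)| < r) : wkbRoot n r ^ 2 ≤ r := by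
  have h4 := wkbRoot_pow_four hr
  have hr0 : 0 < r := (abs_nonneg _).trans_lt hr
  refine le_of_sq_le_sq ?_ hr0.le
  rw [← pow_mul, h4]
  nlinarith [sq_nonneg (n : ℝ)]

lemma hasDerivAt_wkbRoot (hr : |(n : ℝ)| < r) :
    HasDerivAt (wkbRoot n) (r / (2 * wkbRoot n r ^ 3)) r := by
  have hQ := sq_sub_sq_pos hr
  have hs := wkbRoot_pos hr
  have h1 : HasDerivAt (fun r : ℝ => r ^ 2 - (n : ℝ) ^ 2) (2 * r) r := by
    simpa using ((hasDerivAt_id r).pow 2).sub_const ((n : ℝ) ^ 2)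
  refine ((h1.sqrt hQ.ne').sqrt (Real.sqrt_pos.2 hQ).ne').congr_deriv ?_
  rw [← wkbRoot_sq, Real.sqrt_sq hs.le]
  field_simp

lemma hasDerivAt_wkbU (hr : |(n : ℝ)| < r) :
    HasDerivAt (wkbU n) ((wkbRoot n r ^ 2 / r) • wkbV n r) r := by
  have hs := wkbRoot_pos hr
  have hr0 : 0 < r := (abs_nonneg _).trans_lt hr
  refine ((hasDerivAt_wkbRoot hr).ofReal_comp.mul (hasDerivAt_besselMom 0 n r)).congr_deriv ?_
  have hs' : (wkbRoot n r : ℂ) ≠ 0 := by exact_mod_cast hs.ne'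
  have hr' : (r : ℂ) ≠ 0 := by exact_mod_cast hr0.ne'
  rw [Complex.real_smul, wkbV]
  push_cast
  field_simp
  ring

lemma hasDerivAt_wkbV (hr : |(n : ℝ)| < r) :
    HasDerivAt (wkbV n) ((-(wkbRoot n r ^ 2 / r + wkbErr n r)) • wkbU n r) r := by
  have hs := wkbRoot_pos hr
  have hr0 : 0 < r := (abs_nonneg _).trans_lt hr
  have hs' : (wkbRoot n r : ℂ) ≠ 0 := by exact_mod_cast hs.ne'
  have hr' : (r : ℂ) ≠ 0 := by exact_mod_cast hr0.ne'
  have hd := hasDerivAt_wkbRoot hr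
  have h1 := (((hasDerivAt_id' r).fun_div hd hs.ne').ofReal_comp).mul (hasDerivAt_besselMom 1 n r)
  have h2 := ((((hasDerivAt_id' r).fun_pow 2).fun_div ((hd.fun_pow 5).const_mul 2)
    (by positivity)).ofReal_comp).mul (hasDerivAt_besselMom 0 n r)
  refine (h1.add h2).congr_deriv ?_
  have h4 : (wkbRoot n r : ℂ) ^ 4 = (r : ℂ) ^ 2 - (n : ℂ) ^ 2 := by
    exact_mod_cast congrArg (fun x : ℝ => (x : ℂ)) (wkbRoot_pow_four hr)
  have hode := bessel_ode n r
  rw [← h4] at hode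
  have hB2 : besselMom 2 n r = -(r * besselMom 1 n r + (wkbRoot n r : ℂ) ^ 4 * besselMom 0 n r) /
      (r : ℂ) ^ 2 := by
    rw [eq_div_iff (pow_ne_zero 2 hr')]
    linear_combination hode
  rw [Complex.real_smul, wkbU, wkbErr]
  simp only [Nat.reduceAdd, hB2]
  push_cast
  field_simp
  ring

lemma abs_wkbErr_le (hr : |(n : ℝ)| < r) : |wkbErr n r| ≤ 9 / 4 * (r ^ 3 / wkbRoot n r ^ 10) := by
  have hs := wkbRoot_pos hr
  have hr0 : 0 < r := (abs_nonneg _).trans_lt hr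
  have h1 : r / wkbRoot n r ^ 6 ≤ r ^ 3 / wkbRoot n r ^ 10 := by
    rw [div_le_div_iff₀ (by positivity) (by positivity)]
    have := pow_le_pow_left₀ (by positivity) (wkbRoot_sq_le hr) 2
    calc r * wkbRoot n r ^ 10 = (r * wkbRoot n r ^ 6) * (wkbRoot n r ^ 2) ^ 2 := by ring
      _ ≤ (r * wkbRoot n r ^ 6) * r ^ 2 := by gcongr
      _ = _ := by ring
  have h2 : 0 < r / wkbRoot n r ^ 6 := by positivity
  have h3 : 0 < r ^ 3 / wkbRoot n r ^ 10 := by positivity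
  unfold wkbErr
  rw [abs_le, mul_div_assoc]
  constructor <;> linarith

/-- The energy of the Liouville--Green system. -/
def wkbE (n : ℤ) (r : ℝ) : ℝ := ‖wkbU n r‖ ^ 2 + ‖wkbV n r‖ ^ 2

/-- A primitive of the bound for the error term, vanishing at infinity. -/
def wkbTail (n : ℤ) (r : ℝ) : ℝ := 1 / wkbRoot n r ^ 2 + (n : ℝ) ^ 2 / (3 * wkbRoot n r ^ 6)

lemma wkbTail_nonneg (hr : |(n : ℝ)| < r) : 0 ≤ wkbTail n r := by
  have hs := wkbRoot_pos hr
  unfold wkbTail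
  positivity

lemma hasDerivAt_wkbTail (hr : |(n : ℝ)| < r) :
    HasDerivAt (wkbTail n) (-(r ^ 3 / wkbRoot n r ^ 10)) r := by
  have hs := wkbRoot_pos hr
  have hd := hasDerivAt_wkbRoot hr
  refine (((hasDerivAt_const r (1 : ℝ)).fun_div (hd.fun_pow 2) (by positivity)).add
    ((hasDerivAt_const r ((n : ℝ) ^ 2)).fun_div ((hd.fun_pow 6).const_mul 3)
      (by positivity))).congr_deriv ?_
  have h4 := wkbRoot_pow_four hr
  have hn : (n : ℝ) ^ 2 = r ^ 2 - wkbRoot n r ^ 4 := by linarith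
  rw [hn]
  field_simp
  ring

lemma hasDerivAt_wkbE (hr : |(n : ℝ)| < r) :
    HasDerivAt (wkbE n) (-2 * wkbErr n r * inner ℝ (wkbU n r) (wkbV n r)) r := by
  refine ((hasDerivAt_wkbU hr).norm_sq.add (hasDerivAt_wkbV hr).norm_sq).congr_deriv ?_
  rw [inner_smul_right, inner_smul_right, real_inner_comm (wkbU n r) (wkbV n r)]
  ring

lemma neg_le_deriv_wkbE (hr : |(n : ℝ)| < r) : -(9 / 4 * (r ^ 3 / wkbRoot n r ^ 10) * wkbE n r) ≤
    -2 * wkbErr n r * inner ℝ (wkbU n r) (wkbV n r) := by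
  have h1 := abs_wkbErr_le hr
  have h2 : 2 * |inner ℝ (wkbU n r) (wkbV n r)| ≤ wkbE n r := by
    have := abs_real_inner_le_norm (wkbU n r) (wkbV n r)
    unfold wkbE
    nlinarith [sq_nonneg (‖wkbU n r‖ - ‖wkbV n r‖)]
  have h3 : |wkbErr n r| * (2 * |inner ℝ (wkbU n r) (wkbV n r)|) ≤
      9 / 4 * (r ^ 3 / wkbRoot n r ^ 10) * wkbE n r :=
    mul_le_mul h1 h2 (by positivity) ((abs_nonneg _).trans h1)
  have h4 := le_abs_self (2 * wkbErr n r * inner ℝ (wkbU n r) (wkbV n r))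
  rw [abs_mul, abs_mul, abs_two] at h4
  linarith

end

lemma wkbE_mul_exp_le {n : ℤ} {r R : ℝ} (hr : |(n : ℝ)| < r) (hrR : r ≤ R) :
    wkbE n r * Real.exp (-(9 / 4) * wkbTail n r) ≤
      wkbE n R * Real.exp (-(9 / 4) * wkbTail n R) := by
  have hd : ∀ x ∈ Set.Icc r R, HasDerivAt (fun x => wkbE n x * Real.exp (-(9 / 4) * wkbTail n x))
      ((-2 * wkbErr n x * inner ℝ (wkbU n x) (wkbV n x) +
        9 / 4 * (x ^ 3 / wkbRoot n x ^ 10) * wkbE n x) * Real.exp (-(9 / 4) * wkbTail n x)) x := by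
    intro x hx
    have hx' := hr.trans_le hx.1
    refine ((hasDerivAt_wkbE hx').mul
      ((hasDerivAt_wkbTail hx').const_mul (-(9 / 4 : ℝ))).exp).congr_deriv ?_
    ring
  refine monotoneOn_of_deriv_nonneg (convex_Icc r R)
    (fun x hx => (hd x hx).continuousAt.continuousWithinAt)
    (fun x hx => (hd x (interior_subset hx)).differentiableAt.differentiableWithinAt) ?_
    ⟨le_rfl, hrR⟩ ⟨hrR, le_rfl⟩ hrR
  intro x hx
  have hx := interior_subset hx
  rw [(hd x hx).deriv]
  have := neg_le_deriv_wkbE (hr.trans_le hx.1)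
  exact mul_nonneg (by linarith) (Real.exp_pos _).le

lemma wkbE_le_of_two_mul_le {n : ℤ} {r : ℝ} (hr : 1 ≤ r) (hrn : 2 * |(n : ℝ)| ≤ r) :
    wkbE n r ≤ 100 * 320 ^ 2 := by
  have hr0 : 0 < r := by linarith
  have hn0 := abs_nonneg (n : ℝ)
  have hnr : |(n : ℝ)| < r := by linarith
  have hs := wkbRoot_pos hnr
  have hs2 := wkbRoot_sq_le hnr
  have h4 := wkbRoot_pow_four hnr
  have hs2' : r / 2 ≤ wkbRoot n r ^ 2 := by
    refine le_of_sq_le_sq ?_ (by positivity)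
    rw [← pow_mul, h4, ← sq_abs (n : ℝ)]
    nlinarith
  have hB := norm_besselMom_sq_mul_le (k := 0) (by norm_num) hr hrn
  have hB' := norm_besselMom_sq_mul_le (k := 1) (by norm_num) hr hrn
  have hU : ‖wkbU n r‖ ^ 2 ≤ 320 ^ 2 := by
    rw [wkbU, norm_mul, mul_pow, Complex.norm_real, Real.norm_eq_abs, sq_abs]
    refine le_trans ?_ hB
    rw [mul_comm]
    gcongr
  have hV : ‖wkbV n r‖ ^ 2 ≤ 20 * 320 ^ 2 := by
    have h1 : ‖wkbV n r‖ ≤ r / wkbRoot n r * ‖besselMom 1 n r‖ +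
        r ^ 2 / (2 * wkbRoot n r ^ 5) * ‖besselMom 0 n r‖ := by
      refine (norm_add_le _ _).trans (le_of_eq ?_)
      rw [norm_mul, norm_mul, Complex.norm_real, Complex.norm_real,
        Real.norm_of_nonneg (by positivity), Real.norm_of_nonneg (by positivity)]
    have h2 : (r / wkbRoot n r) ^ 2 ≤ 2 * r := by
      rw [div_pow, div_le_iff₀ (by positivity)]
      nlinarith
    have h3 : (r ^ 2 / (2 * wkbRoot n r ^ 5)) ^ 2 ≤ 8 * r := by
      rw [div_pow, div_le_iff₀ (by positivity)]
      have := pow_le_pow_left₀ (by positivity) hs2' 5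
      calc (r ^ 2) ^ 2 ≤ 8 * r * (4 * (r / 2) ^ 5) := by
            have : r ^ 4 ≤ r ^ 6 := pow_le_pow_right₀ hr (by norm_num)
            nlinarith
        _ ≤ 8 * r * (4 * (wkbRoot n r ^ 2) ^ 5) := by gcongr
        _ = _ := by ring
    calc ‖wkbV n r‖ ^ 2 ≤ (r / wkbRoot n r * ‖besselMom 1 n r‖ +
        r ^ 2 / (2 * wkbRoot n r ^ 5) * ‖besselMom 0 n r‖) ^ 2 := by gcongr
      _ ≤ 2 * ((r / wkbRoot n r) ^ 2 * ‖besselMom 1 n r‖ ^ 2 +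
        (r ^ 2 / (2 * wkbRoot n r ^ 5)) ^ 2 * ‖besselMom 0 n r‖ ^ 2) := by
          rw [← mul_pow, ← mul_pow]
          exact add_sq_le
      _ ≤ 2 * (2 * r * ‖besselMom 1 n r‖ ^ 2 + 8 * r * ‖besselMom 0 n r‖ ^ 2) := by gcongr
      _ ≤ _ := by nlinarith
  unfold wkbE
  linarith

lemma wkbTail_le {n : ℤ} {r κ : ℝ} (hκ : 0 < κ) (hr : |(n : ℝ)| < r)
    (h : κ * r ^ 2 ≤ wkbRoot n r ^ 6) : wkbTail n r ≤ 4 / (3 * κ) := by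
  have hs := wkbRoot_pos hr
  have hr0 : 0 < r := (abs_nonneg _).trans_lt hr
  have h2 := wkbRoot_sq_le hr
  have h4 := wkbRoot_pow_four hr
  have hκs : κ ≤ wkbRoot n r ^ 2 := by
    have : κ * r ^ 2 ≤ wkbRoot n r ^ 2 * r ^ 2 := by
      refine h.trans ?_
      calc wkbRoot n r ^ 6 = wkbRoot n r ^ 2 * (wkbRoot n r ^ 2) ^ 2 := by ring
        _ ≤ _ := by gcongr
    exact le_of_mul_le_mul_right this (by positivity)
  have h5 : 1 / wkbRoot n r ^ 2 ≤ 1 / κ := one_div_le_one_div_of_le hκ hκs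
  have h6 : (n : ℝ) ^ 2 / (3 * wkbRoot n r ^ 6) ≤ 1 / (3 * κ) := by
    rw [div_le_div_iff₀ (by positivity) (by positivity)]
    have : (n : ℝ) ^ 2 ≤ r ^ 2 := by nlinarith [pow_pos hs 4]
    nlinarith
  have : 4 / (3 * κ) = 1 / κ + 1 / (3 * κ) := by
    field_simp
    norm_num
  unfold wkbTail
  linarith

lemma wkbE_le {n : ℤ} {r κ : ℝ} (hκ : 0 < κ) (hr : |(n : ℝ)| < r)
    (h : κ * r ^ 2 ≤ wkbRoot n r ^ 6) :
    wkbE n r ≤ Real.exp (3 / κ) * (100 * 320 ^ 2) := by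
  have hs := wkbRoot_pos hr
  have hr0 : 0 < r := (abs_nonneg _).trans_lt hr
  have hT := wkbTail_le hκ hr h
  set R := max r (max 1 (2 * |(n : ℝ)|)) with hR
  have hrR : r ≤ R := le_max_left _ _
  have hE := wkbE_le_of_two_mul_le (n := n) (r := R)
    ((le_max_left _ _).trans (le_max_right _ _)) ((le_max_right _ _).trans (le_max_right _ _))
  have hTR := wkbTail_nonneg (hr.trans_le hrR)
  have key := wkbE_mul_exp_le hr hrR
  have hER : 0 ≤ wkbE n R := by unfold wkbE; positivity
  have h7 : wkbE n R * Real.exp (-(9 / 4) * wkbTail n R) ≤ 100 * 320 ^ 2 := by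
    have : Real.exp (-(9 / 4) * wkbTail n R) ≤ 1 := Real.exp_le_one_iff.2 (by linarith)
    nlinarith [Real.exp_pos (-(9 / 4) * wkbTail n R)]
  have h8 : Real.exp (-(3 / κ)) ≤ Real.exp (-(9 / 4) * wkbTail n r) := by
    apply Real.exp_le_exp.2
    have : 9 / 4 * (4 / (3 * κ)) = 3 / κ := by
      field_simp
      norm_num
    linarith
  have hE0 : 0 ≤ wkbE n r := by unfold wkbE; positivity
  have h9 : wkbE n r * Real.exp (-(3 / κ)) ≤ 100 * 320 ^ 2 :=
    (mul_le_mul_of_nonneg_left h8 hE0).trans (key.trans h7)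
  rw [Real.exp_neg, ← div_eq_mul_inv, div_le_iff₀ (Real.exp_pos _)] at h9
  linarith

lemma norm_bessel_pow_four_mul_le : ∃ C > (0:ℝ), ∀ (n : ℤ) (r : ℝ), 1 ≤ r →
    ‖besselMom 0 n r‖ ^ 4 * (r * max (abs (r - |(n : ℝ)|)) 1) ≤ C := by
  obtain ⟨C, hC, hC3⟩ := norm_bessel_cube_mul_le
  set K := Real.exp (3 / 1) * (100 * 320 ^ 2) with hK
  have hK0 : 0 < K := by positivity
  refine ⟨(C + 1) ^ 2 + 64 ^ 4 + K ^ 2, by positivity, fun n r hr => ?_⟩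
  have hB0 := norm_nonneg (besselMom 0 n r)
  have hr0 : 0 < r := by linarith
  set x := abs (r - |(n : ℝ)|) with hx
  have hx0 : 0 ≤ x := abs_nonneg _
  rcases le_or_gt (max x 1 ^ 3) r with h | h
  · have h1 := hC3 n r hr0.le
    have h2 : (‖besselMom 0 n r‖ ^ 4 * (r * max x 1)) ^ 3 ≤ ((C + 1) ^ 2) ^ 3 := by
      calc (‖besselMom 0 n r‖ ^ 4 * (r * max x 1)) ^ 3
          = ‖besselMom 0 n r‖ ^ 12 * r ^ 3 * max x 1 ^ 3 := by ring
        _ ≤ ‖besselMom 0 n r‖ ^ 12 * r ^ 3 * r := by gcongr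
        _ = (‖besselMom 0 n r‖ ^ 3 * r) ^ 4 := by ring
        _ ≤ C ^ 4 := by gcongr
        _ ≤ (C + 1) ^ 4 := by gcongr; linarith
        _ ≤ (C + 1) ^ 6 := pow_le_pow_right₀ (by linarith) (by norm_num)
        _ = _ := by ring
    have h3 := le_of_pow_le_pow_left₀ (by norm_num) (by positivity) h2
    nlinarith [sq_nonneg K]
  · have hx1 : 1 < x := by
      by_contra! hcon
      rw [max_eq_right hcon] at h
      linarith
    rw [max_eq_left hx1.le] at h ⊢
    rcases le_total r |(n : ℝ)| with hrn | hrn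
    · have hxe : x = |(n : ℝ)| - r := by rw [hx, abs_of_nonpos (by linarith)]; ring
      have h1 := norm_bessel_mul_sub_le (n := n) hr0.le (by linarith)
      rw [← hxe] at h1
      have h2 : ‖besselMom 0 n r‖ ^ 4 * (r * x) ≤ 64 ^ 4 := by
        calc ‖besselMom 0 n r‖ ^ 4 * (r * x) ≤ ‖besselMom 0 n r‖ ^ 4 * (x ^ 3 * x) := by gcongr
          _ = (‖besselMom 0 n r‖ * x) ^ 4 := by ring
          _ ≤ _ := by gcongr
      nlinarith [sq_nonneg K, sq_nonneg (C + 1)]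
    · have hxe : x = r - |(n : ℝ)| := by rw [hx, abs_of_nonneg (by linarith)]
      have hrn' : |(n : ℝ)| < r := by linarith
      have hs := wkbRoot_pos hrn'
      have h4 := wkbRoot_pow_four hrn'
      have hn0 := abs_nonneg (n : ℝ)
      have hs4 : r * x ≤ wkbRoot n r ^ 4 := by
        rw [h4, hxe, ← sq_abs (n : ℝ)]
        nlinarith
      have hs6 : 1 * r ^ 2 ≤ wkbRoot n r ^ 6 := by
        refine le_of_sq_le_sq ?_ (by positivity)
        calc (1 * r ^ 2) ^ 2 = r ^ 3 * r := by ring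
          _ ≤ r ^ 3 * x ^ 3 := by gcongr
          _ = (r * x) ^ 3 := by ring
          _ ≤ (wkbRoot n r ^ 4) ^ 3 := by gcongr
          _ = _ := by ring
      have hE := wkbE_le one_pos hrn' hs6
      have hU : ‖besselMom 0 n r‖ ^ 2 * wkbRoot n r ^ 2 ≤ K := by
        have : ‖wkbU n r‖ ^ 2 = ‖besselMom 0 n r‖ ^ 2 * wkbRoot n r ^ 2 := by
          rw [wkbU, norm_mul, mul_pow, Complex.norm_real, Real.norm_eq_abs, sq_abs]
          ring
        rw [← this]
        refine le_trans ?_ hE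
        unfold wkbE
        nlinarith [sq_nonneg ‖wkbV n r‖]
      have : ‖besselMom 0 n r‖ ^ 4 * (r * x) ≤ K ^ 2 := by
        calc ‖besselMom 0 n r‖ ^ 4 * (r * x) ≤ ‖besselMom 0 n r‖ ^ 4 * wkbRoot n r ^ 4 := by gcongr
          _ = (‖besselMom 0 n r‖ ^ 2 * wkbRoot n r ^ 2) ^ 2 := by ring
          _ ≤ _ := by gcongr
      nlinarith [sq_nonneg (C + 1)]

/-- The phase of the Liouville--Green approximation of the Bessel function. -/
def besselPhase (n : ℤ) (r : ℝ) : ℝ := ∫ ρ in (1 : ℝ)..r, wkbRoot n ρ ^ 2 / ρ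

lemma hasDerivAt_besselPhase (n : ℤ) {r : ℝ} (hr : 0 < r) :
    HasDerivAt (besselPhase n) (wkbRoot n r ^ 2 / r) r := by
  have hc : ContinuousOn (fun ρ : ℝ => wkbRoot n ρ ^ 2 / ρ) (Set.Ioi 0) := by
    simp_rw [wkbRoot_sq]
    exact ContinuousOn.div (by fun_prop) continuousOn_id fun x hx => ne_of_gt hx
  refine intervalIntegral.integral_hasDerivAt_right ?_
    (hc.stronglyMeasurableAtFilter isOpen_Ioi r hr) (hc.continuousAt (Ioi_mem_nhds hr))
  refine (hc.mono fun x hx => ?_).intervalIntegrable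
  exact (lt_min one_pos hr).trans_le hx.1

/-- The slowly varying amplitude of the Bessel function along `e^{iε ψ}`, `ε = ±1`. -/
def wkbAmp (ε : ℝ) (n : ℤ) (r : ℝ) : ℂ := ((1 / (2 * wkbRoot n r) : ℝ) : ℂ) *
  (Complex.exp (Complex.I * ((-ε * besselPhase n r : ℝ) : ℂ)) *
    (wkbU n r - (ε * Complex.I) * wkbV n r))

lemma besselMom_eq_wkbAmp {n : ℤ} {r : ℝ} (hr : |(n : ℝ)| < r) : besselMom 0 n r =
    wkbAmp 1 n r * Complex.exp (Complex.I * ((1 * besselPhase n r : ℝ) : ℂ)) +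
    wkbAmp (-1) n r * Complex.exp (Complex.I * ((-1 * besselPhase n r : ℝ) : ℂ)) := by
  have hs' : (wkbRoot n r : ℂ) ≠ 0 := by exact_mod_cast (wkbRoot_pos hr).ne'
  have h1 : Complex.exp (Complex.I * ((-1 * besselPhase n r : ℝ) : ℂ)) *
      Complex.exp (Complex.I * ((1 * besselPhase n r : ℝ) : ℂ)) = 1 := by
    rw [← Complex.exp_add, ← mul_add, ← Complex.ofReal_add]
    simp
  have h2 : besselMom 0 n r = ((1 / (2 * wkbRoot n r) : ℝ) : ℂ) * (2 * wkbU n r) := by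
    rw [wkbU]
    push_cast
    field_simp
  have h3 : (- -1 : ℝ) = 1 := by norm_num
  rw [h2, wkbAmp, wkbAmp, h3]
  generalize ((1 / (2 * wkbRoot n r) : ℝ) : ℂ) = c
  push_cast at h1 ⊢
  linear_combination (-2 * c * wkbU n r) * h1

lemma mul_sq_le_wkbRoot_pow {n : ℤ} {a r κ : ℝ} (ha : |(n : ℝ)| < a)
    (har : a ≤ r) (h : κ * a ^ 2 ≤ wkbRoot n a ^ 6) : κ * r ^ 2 ≤ wkbRoot n r ^ 6 := by
  have hr := ha.trans_le har
  have ha0 : 0 < a := (abs_nonneg _).trans_lt ha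
  have h4 := wkbRoot_pow_four hr
  have h4' := wkbRoot_pow_four ha
  have hs := wkbRoot_pos hr
  have hs' := wkbRoot_pos ha
  have h2 : wkbRoot n a ^ 2 ≤ wkbRoot n r ^ 2 := by
    rw [wkbRoot_sq, wkbRoot_sq]
    exact Real.sqrt_le_sqrt (by nlinarith)
  have h5 : wkbRoot n a ^ 4 * r ^ 2 ≤ wkbRoot n r ^ 4 * a ^ 2 := by
    rw [h4, h4']
    have : a ^ 2 ≤ r ^ 2 := by gcongr
    nlinarith [sq_nonneg (n : ℝ)]
  refine le_of_mul_le_mul_right ?_ (pow_pos ha0 2)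
  calc κ * r ^ 2 * a ^ 2 = κ * a ^ 2 * r ^ 2 := by ring
    _ ≤ wkbRoot n a ^ 6 * r ^ 2 := by gcongr
    _ = wkbRoot n a ^ 2 * (wkbRoot n a ^ 4 * r ^ 2) := by ring
    _ ≤ wkbRoot n r ^ 2 * (wkbRoot n r ^ 4 * a ^ 2) := by gcongr
    _ = _ := by ring

lemma continuousOn_wkbRoot (n : ℤ) (s : Set ℝ) : ContinuousOn (wkbRoot n) s := by
  unfold wkbRoot
  fun_prop

lemma bvOn_inv_wkbRoot {n : ℤ} {a b : ℝ} (hab : a ≤ b) (ha : |(n : ℝ)| < a) :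
    BVOn (fun r => ((1 / (2 * wkbRoot n r) : ℝ) : ℂ)) (1 / wkbRoot n a) a b := by
  have hsa := wkbRoot_pos ha
  have hd : ∀ r ∈ Set.Icc a b, HasDerivAt (fun r => 1 / (2 * wkbRoot n r))
      (-(r / (4 * wkbRoot n r ^ 5))) r := by
    intro r hr
    have hr' := ha.trans_le hr.1
    have hs := wkbRoot_pos hr'
    refine ((hasDerivAt_const r (1 : ℝ)).fun_div ((hasDerivAt_wkbRoot hr').const_mul 2)
      (by positivity)).congr_deriv ?_
    field_simp
    ring
  have hcont : ContinuousOn (fun r => r / (4 * wkbRoot n r ^ 5)) (Set.Icc a b) := by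
    refine continuousOn_id.div (continuousOn_const.mul ((continuousOn_wkbRoot n _).pow 5)) ?_
    intro r hr
    have hs := wkbRoot_pos (ha.trans_le hr.1)
    positivity
  refine BVOn.of_bound (fun r => ((-(r / (4 * wkbRoot n r ^ 5)) : ℝ) : ℂ))
    (fun r => r / (4 * wkbRoot n r ^ 5)) hab (fun r hr => (hd r hr).ofReal_comp)
    (Complex.continuous_ofReal.comp_continuousOn hcont.neg) ?_ hcont ?_ ?_
  · intro r hr
    have hs := wkbRoot_pos (ha.trans_le hr.1)
    have h2 : wkbRoot n a ≤ wkbRoot n r := by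
      have ha0 : 0 < a := (abs_nonneg _).trans_lt ha
      exact Real.sqrt_le_sqrt (Real.sqrt_le_sqrt (by nlinarith [hr.1]))
    rw [Complex.norm_real, Real.norm_of_nonneg (by positivity)]
    exact one_div_le_one_div_of_le hsa (by linarith)
  · intro r hr
    have hs := wkbRoot_pos (ha.trans_le hr.1)
    have hr0 : 0 < r := ((abs_nonneg _).trans_lt ha).trans_le hr.1
    rw [Complex.norm_real, norm_neg, Real.norm_of_nonneg (by positivity)]
  · have := intervalIntegral.integral_eq_sub_of_hasDerivAt
      (f := fun r => 1 / (2 * wkbRoot n r)) (f' := fun r => -(r / (4 * wkbRoot n r ^ 5)))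
        (by rwa [Set.uIcc_of_le hab])
      (intervalIntegrable_of_continuousOn_Icc hcont.neg le_rfl hab le_rfl)
    rw [intervalIntegral.integral_neg] at this
    have hsb := wkbRoot_pos (ha.trans_le hab)
    have h1 : 0 < 1 / (2 * wkbRoot n b) := by positivity
    have h2 : 1 / (2 * wkbRoot n a) ≤ 1 / wkbRoot n a :=
      one_div_le_one_div_of_le hsa (by linarith)
    linarith

lemma bvOn_wkbAmp {κ : ℝ} (hκ : 0 < κ) : ∃ C > (0:ℝ), ∀ (n : ℤ) (a b ε : ℝ), ε ^ 2 = 1 → a ≤ b →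
    |(n : ℝ)| < a → κ * a ^ 2 ≤ wkbRoot n a ^ 6 → BVOn (wkbAmp ε n) (C / wkbRoot n a) a b := by
  set K := Real.exp (3 / κ) * (100 * 320 ^ 2) with hK
  have hK0 : 0 < K := by positivity
  refine ⟨2 * ((1 + K) * (1 + 3 / κ)), by positivity, fun n a b ε hε hab ha h => ?_⟩
  have hsa := wkbRoot_pos ha
  have hEr : ∀ r ∈ Set.Icc a b, wkbE n r ≤ K := fun r hr =>
    wkbE_le hκ (ha.trans_le hr.1) (mul_sq_le_wkbRoot_pow ha hr.1 h)
  have hε1 : |ε| = 1 := by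
    rw [← sq_abs] at hε
    nlinarith [abs_nonneg ε]
  have hU : ∀ r ∈ Set.Icc a b, ‖wkbU n r‖ ≤ 1 + K := by
    intro r hr
    have := hEr r hr
    unfold wkbE at this
    nlinarith [sq_nonneg (‖wkbU n r‖ - 1), sq_nonneg ‖wkbV n r‖]
  have hUV : ∀ r ∈ Set.Icc a b, ‖wkbU n r‖ + ‖wkbV n r‖ ≤ 1 + K := by
    intro r hr
    have := hEr r hr
    unfold wkbE at this
    nlinarith [sq_nonneg (‖wkbU n r‖ - 1), sq_nonneg (‖wkbV n r‖ - 1)]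
  have hr0 : ∀ r ∈ Set.Icc a b, 0 < r := fun r hr => ((abs_nonneg _).trans_lt ha).trans_le hr.1
  have hsr : ∀ r ∈ Set.Icc a b, 0 < wkbRoot n r := fun r hr => wkbRoot_pos (ha.trans_le hr.1)
  have hZ : BVOn (fun r => Complex.exp (Complex.I * ((-ε * besselPhase n r : ℝ) : ℂ)) *
    (wkbU n r - (ε * Complex.I) * wkbV n r)) ((1 + K) * (1 + 3 / κ)) a b := by
    have hψ : ContinuousOn (besselPhase n) (Set.Icc a b) := fun r hr =>
      (hasDerivAt_besselPhase n (hr0 r hr)).continuousAt.continuousWithinAt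
    have hUc : ContinuousOn (wkbU n) (Set.Icc a b) := fun r hr =>
      (hasDerivAt_wkbU (ha.trans_le hr.1)).continuousAt.continuousWithinAt
    have hroot := continuousOn_wkbRoot n (Set.Icc a b)
    have hg : ContinuousOn (fun r => r ^ 3 / wkbRoot n r ^ 10) (Set.Icc a b) :=
      (continuousOn_id.pow 3).div (hroot.pow 10) fun r hr => (pow_pos (hsr r hr) 10).ne'
    have herr : ContinuousOn (wkbErr n) (Set.Icc a b) :=
      ((continuousOn_const.mul (continuousOn_id.pow 3)).div (hroot.pow 10)
        fun r hr => (pow_pos (hsr r hr) 10).ne').sub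
        (continuousOn_id.div (hroot.pow 6) fun r hr => (pow_pos (hsr r hr) 6).ne')
    refine BVOn.of_bound (fun r => Complex.exp (Complex.I * ((-ε * besselPhase n r : ℝ) : ℂ)) *
      (ε * Complex.I * wkbErr n r * wkbU n r))
      (fun r => (1 + K) * (9 / 4) * (r ^ 3 / wkbRoot n r ^ 10)) hab ?_ ?_ ?_
      (continuousOn_const.mul hg) ?_ ?_
    · intro r hr
      have hr' := ha.trans_le hr.1
      refine (((((hasDerivAt_besselPhase n (hr0 r hr)).const_mul (-ε)).ofReal_comp.const_mul
        Complex.I).cexp).mul ((hasDerivAt_wkbU hr').fun_sub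
        ((hasDerivAt_wkbV hr').const_mul (ε * Complex.I)))).congr_deriv ?_
      rw [Complex.real_smul, Complex.real_smul]
      generalize Complex.exp _ = e
      have hε' : (ε : ℂ) ^ 2 = 1 := by exact_mod_cast congrArg (fun x : ℝ => (x : ℂ)) hε
      push_cast
      linear_combination (-e * (wkbRoot n r : ℂ) ^ 2 / r * wkbV n r) * hε' +
        (e * (wkbRoot n r : ℂ) ^ 2 / r * wkbV n r * ε ^ 2) * Complex.I_sq
    · refine ContinuousOn.mul ?_ (ContinuousOn.mul (continuousOn_const.mul
        (Complex.continuous_ofReal.comp_continuousOn herr)) hUc)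
      refine Complex.continuous_exp.comp_continuousOn (continuousOn_const.mul ?_)
      exact Complex.continuous_ofReal.comp_continuousOn (continuousOn_const.mul hψ)
    · intro r hr
      rw [norm_mul, norm_exp_I_mul_ofReal', one_mul]
      refine (norm_sub_le _ _).trans ?_
      rw [norm_mul, norm_mul, Complex.norm_real, Complex.norm_I, Real.norm_eq_abs, hε1, one_mul,
        one_mul]
      have := hUV r hr
      have h3 : 0 < 3 / κ := by positivity
      nlinarith
    · intro r hr
      rw [norm_mul, norm_exp_I_mul_ofReal', one_mul, norm_mul, norm_mul, norm_mul,
        Complex.norm_real, Complex.norm_I, Complex.norm_real, Real.norm_eq_abs, Real.norm_eq_abs,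
        hε1, one_mul, one_mul]
      have h1 := mul_le_mul (abs_wkbErr_le (ha.trans_le hr.1)) (hU r hr) (norm_nonneg _)
        ((abs_nonneg _).trans (abs_wkbErr_le (ha.trans_le hr.1)))
      linarith
    · rw [intervalIntegral.integral_const_mul]
      have := intervalIntegral.integral_eq_sub_of_hasDerivAt (a := a) (b := b)
        (f := wkbTail n) (f' := fun r => -(r ^ 3 / wkbRoot n r ^ 10))
        (fun r hr => hasDerivAt_wkbTail (ha.trans_le (by
          rw [Set.uIcc_of_le hab] at hr
          exact hr.1)))
        (intervalIntegrable_of_continuousOn_Icc hg.neg le_rfl hab le_rfl)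
      rw [intervalIntegral.integral_neg] at this
      have h1 := wkbTail_nonneg (ha.trans_le hab)
      have h2 := wkbTail_le hκ ha h
      have h3 : ∫ r in a..b, r ^ 3 / wkbRoot n r ^ 10 ≤ 4 / (3 * κ) := by linarith
      have h4 : (9 / 4 : ℝ) * (4 / (3 * κ)) = 3 / κ := by
        field_simp
        norm_num
      calc (1 + K) * (9 / 4) * ∫ r in a..b, r ^ 3 / wkbRoot n r ^ 10
          ≤ (1 + K) * (9 / 4) * (4 / (3 * κ)) := by gcongr
        _ = (1 + K) * (3 / κ) := by rw [mul_assoc, h4]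
        _ ≤ _ := by nlinarith
  refine ((bvOn_inv_wkbRoot hab ha).mul hZ hab).weaken (le_of_eq ?_)
  ring

lemma smooth_support_deriv {β : ℝ → ℂ} (hβ : ContDiff ℝ (⊤ : ℕ∞) β)
    (hs : tsupport β ⊆ Set.Ioo (1 / 2) 5) :
    ContDiff ℝ (⊤ : ℕ∞) (deriv β) ∧ tsupport (deriv β) ⊆ Set.Ioo (1 / 2) 5 := by
  refine ⟨?_, (closure_minimal (support_deriv_subset) (isClosed_tsupport β)).trans hs⟩
  exact (contDiff_infty_iff_deriv.1 hβ).2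

lemma eq_zero_of_tsupport_subset {β : ℝ → ℂ} (hs : tsupport β ⊆ Set.Ioo (1 / 2) 5) :
    β (1 / 2) = 0 ∧ β 5 = 0 := by
  constructor
  · exact image_eq_zero_of_notMem_tsupport fun h => lt_irrefl _ (hs h).1
  · exact image_eq_zero_of_notMem_tsupport fun h => lt_irrefl _ (hs h).2

lemma norm_integral_nonstationary_le (k : ℕ) : ∀ (β : ℝ → ℂ), ContDiff ℝ (⊤ : ℕ∞) β →
    tsupport β ⊆ Set.Ioo (1 / 2) 5 → ∀ j : ℕ, ∃ C > (0:ℝ), ∀ t s Λ : ℝ, 0 < Λ → |2 * s| ≤ 8 * Λ →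
    (∀ κ ∈ Set.Icc (1 / 2 : ℝ) 5, Λ ≤ |t - 2 * s * κ|) →
    ‖∫ κ in (1 / 2 : ℝ)..5, β κ * (((t - 2 * s * κ) ^ j)⁻¹ : ℝ) *
      Complex.exp (Complex.I * ((t * κ - s * κ ^ 2 : ℝ) : ℂ))‖ ≤ C / Λ ^ (j + k) := by
  induction k with
  | zero =>
    intro β hβ hs j
    obtain ⟨C, hC⟩ := (isCompact_Icc (a := (1 / 2 : ℝ)) (b := 5)).exists_bound_of_continuousOn
      hβ.continuous.continuousOn
    refine ⟨(|C| + 1) * 5, by positivity, fun t s Λ hΛ _ hl => ?_⟩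
    refine (intervalIntegral.norm_integral_le_of_norm_le_const (C := (|C| + 1) / Λ ^ j) ?_).trans ?_
    · intro κ hκ
      rw [Set.uIoc_of_le (by norm_num)] at hκ
      have hκ' : κ ∈ Set.Icc (1 / 2 : ℝ) 5 := ⟨hκ.1.le, hκ.2⟩
      rw [norm_mul, norm_mul, norm_exp_I_mul_ofReal', mul_one, Complex.norm_real, norm_inv,
        norm_pow, Real.norm_eq_abs, ← div_eq_mul_inv]
      have := hC κ hκ'
      have h2 := le_abs_self C
      exact div_le_div₀ (by positivity) (by linarith) (by positivity)
        (pow_le_pow_left₀ hΛ.le (hl κ hκ') j)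
    · rw [abs_of_pos (show (0:ℝ) < 5 - 1 / 2 by norm_num), add_zero, div_mul_eq_mul_div]
      exact div_le_div_of_nonneg_right (by nlinarith [abs_nonneg C]) (by positivity)
  | succ k ih =>
    intro β hβ hs j
    obtain ⟨hβ', hs'⟩ := smooth_support_deriv hβ hs
    obtain ⟨C₁, hC₁, h₁⟩ := ih (deriv β) hβ' hs' (j + 1)
    obtain ⟨C₂, hC₂, h₂⟩ := ih β hβ hs (j + 2)
    refine ⟨C₁ + (j + 1) * 8 * C₂, by positivity, fun t s Λ hΛ hsΛ hl => ?_⟩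
    have h₁ := h₁ t s Λ hΛ hsΛ hl
    have h₂ := h₂ t s Λ hΛ hsΛ hl
    have huI : Set.uIcc (1 / 2 : ℝ) 5 = Set.Icc (1 / 2) 5 := Set.uIcc_of_le (by norm_num)
    have hl0 : ∀ κ ∈ Set.Icc (1 / 2 : ℝ) 5, t - 2 * s * κ ≠ 0 := fun κ hκ h => by
      have := hl κ hκ
      rw [h, abs_zero] at this
      linarith
    have hℓ : ∀ κ, HasDerivAt (fun κ : ℝ => t - 2 * s * κ) (-(2 * s)) κ := fun κ => by
      simpa using ((hasDerivAt_id κ).const_mul (2 * s)).const_sub t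
    have hφ : ∀ κ, HasDerivAt (fun κ : ℝ => t * κ - s * κ ^ 2) (t - 2 * s * κ) κ := fun κ => by
      refine (((hasDerivAt_id' κ).const_mul t).sub
        (((hasDerivAt_id' κ).fun_pow 2).const_mul s)).congr_deriv ?_
      norm_num
      ring
    set e : ℝ → ℂ := fun κ => Complex.exp (Complex.I * ((t * κ - s * κ ^ 2 : ℝ) : ℂ)) with he
    have hv : ∀ κ ∈ Set.uIcc (1 / 2 : ℝ) 5, HasDerivAt e
        (e κ * (Complex.I * ((t - 2 * s * κ : ℝ) : ℂ))) κ := fun κ _ =>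
      ((hφ κ).ofReal_comp.const_mul Complex.I).cexp
    have hu : ∀ κ ∈ Set.uIcc (1 / 2 : ℝ) 5, HasDerivAt
        (fun κ => β κ * (((t - 2 * s * κ) ^ (j + 1))⁻¹ : ℝ))
        (deriv β κ * (((t - 2 * s * κ) ^ (j + 1))⁻¹ : ℝ) +
          ((j + 1) * (2 * s) : ℝ) * (β κ * (((t - 2 * s * κ) ^ (j + 2))⁻¹ : ℝ))) κ := by
      intro κ hκ
      rw [huI] at hκ
      have hne := hl0 κ hκ
      have hi := ((hℓ κ).fun_pow (j + 1)).fun_inv (pow_ne_zero _ hne)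
      refine (((hβ.differentiable (by simp)) κ).hasDerivAt.mul hi.ofReal_comp).congr_deriv ?_
      have hne' : ((t - 2 * s * κ : ℝ) : ℂ) ≠ 0 := by exact_mod_cast hne
      congr 1
      rw [mul_left_comm, ← Complex.ofReal_mul]
      congr 2
      simp only [Nat.add_sub_cancel]
      field_simp
      push_cast
      ring
    have hinv : ∀ i : ℕ, ContinuousOn (fun κ : ℝ => ((((t - 2 * s * κ) ^ i)⁻¹ : ℝ) : ℂ))
        (Set.Icc (1 / 2) 5) := fun i => Complex.continuous_ofReal.comp_continuousOn
      (ContinuousOn.inv₀ (by fun_prop) fun κ hκ => pow_ne_zero _ (hl0 κ hκ))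
    have hec : ContinuousOn e (Set.Icc (1 / 2) 5) := by
      rw [he]
      fun_prop
    have hf1 : ContinuousOn (fun κ => deriv β κ * (((t - 2 * s * κ) ^ (j + 1))⁻¹ : ℝ))
        (Set.Icc (1 / 2) 5) := hβ'.continuous.continuousOn.mul (hinv _)
    have hf2 : ContinuousOn (fun κ => β κ * (((t - 2 * s * κ) ^ (j + 2))⁻¹ : ℝ))
        (Set.Icc (1 / 2) 5) := hβ.continuous.continuousOn.mul (hinv _)
    have key := intervalIntegral.integral_mul_deriv_eq_deriv_mul hu hv
      (intervalIntegrable_of_continuousOn_Icc (hf1.add (continuousOn_const.mul hf2)) le_rfl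
        (by norm_num) le_rfl)
      (intervalIntegrable_of_continuousOn_Icc (hec.mul (by fun_prop)) le_rfl
        (by norm_num) le_rfl)
    have i1 : IntervalIntegrable (fun κ => deriv β κ * (((t - 2 * s * κ) ^ (j + 1))⁻¹ : ℝ) * e κ)
      volume (1 / 2) 5 := intervalIntegrable_of_continuousOn_Icc (hf1.mul hec) le_rfl
        (by norm_num) le_rfl
    have i2 : IntervalIntegrable (fun κ => ((j + 1) * (2 * s) : ℝ) *
        (β κ * (((t - 2 * s * κ) ^ (j + 2))⁻¹ : ℝ) * e κ))
      volume (1 / 2) 5 := intervalIntegrable_of_continuousOn_Icc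
        (continuousOn_const.mul (hf2.mul hec)) le_rfl (by norm_num) le_rfl
    rw [(eq_zero_of_tsupport_subset hs).1, (eq_zero_of_tsupport_subset hs).2] at key
    simp only [zero_mul, sub_self, zero_sub] at key
    have e1 : ∫ κ in (1 / 2 : ℝ)..5, β κ * (((t - 2 * s * κ) ^ j)⁻¹ : ℝ) * e κ =
        -Complex.I * ∫ κ in (1 / 2 : ℝ)..5, β κ * (((t - 2 * s * κ) ^ (j + 1))⁻¹ : ℝ) *
          (e κ * (Complex.I * ((t - 2 * s * κ : ℝ) : ℂ))) := by
      rw [← intervalIntegral.integral_const_mul]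
      refine intervalIntegral.integral_congr fun κ hκ => ?_
      rw [huI] at hκ
      have hne' : ((t - 2 * s * κ : ℝ) : ℂ) ≠ 0 := by exact_mod_cast hl0 κ hκ
      generalize (t - 2 * s * κ) = ℓ at hne'
      push_cast
      field_simp
      linear_combination (β κ * e κ * ℓ * ℓ ^ j) * Complex.I_sq
    have e2 : ∫ κ in (1 / 2 : ℝ)..5, (deriv β κ * (((t - 2 * s * κ) ^ (j + 1))⁻¹ : ℝ) +
          ((j + 1) * (2 * s) : ℝ) * (β κ * (((t - 2 * s * κ) ^ (j + 2))⁻¹ : ℝ))) * e κ =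
        (∫ κ in (1 / 2 : ℝ)..5, deriv β κ * (((t - 2 * s * κ) ^ (j + 1))⁻¹ : ℝ) * e κ) +
        ((j + 1) * (2 * s) : ℝ) *
          ∫ κ in (1 / 2 : ℝ)..5, β κ * (((t - 2 * s * κ) ^ (j + 2))⁻¹ : ℝ) * e κ := by
      rw [← intervalIntegral.integral_const_mul, ← intervalIntegral.integral_add i1 i2]
      congr 1
      ext κ
      ring
    rw [e1, key, e2, norm_mul, norm_neg, norm_neg, Complex.norm_I, one_mul]
    refine (norm_add_le _ _).trans ?_
    rw [norm_mul, Complex.norm_real, Real.norm_eq_abs, abs_mul,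
      abs_of_nonneg (by positivity : (0:ℝ) ≤ j + 1)]
    calc _ ≤ C₁ / Λ ^ (j + 1 + k) + (j + 1) * (8 * Λ) * (C₂ / Λ ^ (j + 2 + k)) := by gcongr
      _ = _ := by
        field_simp
        ring

/-- The oscillatory integral `∫ γ(κ) e^{i(tκ - sκ²)} dκ` over `[1/2, 5]`. -/
def quadOsc (γ : ℝ → ℂ) (t s : ℝ) : ℂ :=
  ∫ κ in (1 / 2 : ℝ)..5, γ κ * Complex.exp (Complex.I * ((t * κ - s * κ ^ 2 : ℝ) : ℂ))

lemma norm_quadOsc_le {γ : ℝ → ℂ} {M : ℝ} (hM : ∀ κ ∈ Set.Icc (1 / 2 : ℝ) 5, ‖γ κ‖ ≤ M)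
    (t s : ℝ) : ‖quadOsc γ t s‖ ≤ 5 * M := by
  have hM0 : 0 ≤ M := (norm_nonneg _).trans (hM 1 ⟨by norm_num, by norm_num⟩)
  refine (intervalIntegral.norm_integral_le_of_norm_le_const (C := M) fun κ hκ => ?_).trans ?_
  · rw [Set.uIoc_of_le (by norm_num)] at hκ
    rw [norm_mul, norm_exp_I_mul_ofReal', mul_one]
    exact hM κ ⟨hκ.1.le, hκ.2⟩
  · rw [abs_of_pos (by norm_num)]
    linarith

lemma hasDerivAt_quadOsc {γ : ℝ → ℂ} (hγ : Continuous γ) (t s : ℝ) :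
    HasDerivAt (quadOsc γ t) (quadOsc (fun κ => -Complex.I * (κ ^ 2 : ℝ) * γ κ) t s) s := by
  have hc : ∀ s : ℝ, Continuous fun κ : ℝ => γ κ *
    Complex.exp (Complex.I * ((t * κ - s * κ ^ 2 : ℝ) : ℂ)) := fun s => by fun_prop
  have hc' : ∀ s : ℝ, Continuous fun κ : ℝ => (-Complex.I * (κ ^ 2 : ℝ) * γ κ) *
    Complex.exp (Complex.I * ((t * κ - s * κ ^ 2 : ℝ) : ℂ)) := fun s => by fun_prop
  refine (intervalIntegral.hasDerivAt_integral_of_dominated_loc_of_deriv_le (𝕜 := ℝ)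
    (bound := fun κ => κ ^ 2 * ‖γ κ‖) (s := Set.univ)
    (F := fun s κ => γ κ * Complex.exp (Complex.I * ((t * κ - s * κ ^ 2 : ℝ) : ℂ)))
    (F' := fun s κ => (-Complex.I * (κ ^ 2 : ℝ) * γ κ) *
      Complex.exp (Complex.I * ((t * κ - s * κ ^ 2 : ℝ) : ℂ)))
    Filter.univ_mem ?_ ?_ ?_ ?_ ?_ ?_).2
  · exact Filter.Eventually.of_forall fun s => (hc s).aestronglyMeasurable
  · exact (hc s).intervalIntegrable _ _
  · exact (hc' s).aestronglyMeasurable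
  · refine Filter.Eventually.of_forall fun κ _ s _ => ?_
    rw [norm_mul, norm_exp_I_mul_ofReal', mul_one, norm_mul, norm_mul, norm_neg, Complex.norm_I,
      one_mul, Complex.norm_real, Real.norm_of_nonneg (sq_nonneg κ)]
  · exact Continuous.intervalIntegrable (by fun_prop) _ _
  · refine Filter.Eventually.of_forall fun κ _ s _ => ?_
    have h1 : HasDerivAt (fun s : ℝ => (t * κ - s * κ ^ 2 : ℝ)) (-κ ^ 2) s := by
      simpa using (((hasDerivAt_id s).mul_const (κ ^ 2)).const_sub (t * κ))
    refine (((h1.ofReal_comp.const_mul Complex.I).cexp).const_mul (γ κ)).congr_deriv ?_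
    push_cast
    ring

lemma continuous_quadOsc {γ : ℝ → ℂ} (hγ : Continuous γ) (t : ℝ) : Continuous (quadOsc γ t) :=
  continuous_iff_continuousAt.2 fun s => (hasDerivAt_quadOsc hγ t s).continuousAt

lemma quadOsc_by_parts {γ : ℝ → ℂ} (hγ : ContDiff ℝ (⊤ : ℕ∞) γ)
    (hs : tsupport γ ⊆ Set.Ioo (1 / 2) 5) (t s : ℝ) :
    quadOsc (fun κ => Complex.I * (t - 2 * s * κ : ℝ) * γ κ) t s = -quadOsc (deriv γ) t s := by
  have hγ' := (smooth_support_deriv hγ hs).1.continuous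
  have hv : ∀ κ : ℝ, HasDerivAt (fun κ : ℝ =>
      Complex.exp (Complex.I * ((t * κ - s * κ ^ 2 : ℝ) : ℂ)))
      (Complex.exp (Complex.I * ((t * κ - s * κ ^ 2 : ℝ) : ℂ)) *
        (Complex.I * ((t - 2 * s * κ : ℝ) : ℂ))) κ := fun κ => by
    have h1 : HasDerivAt (fun κ : ℝ => t * κ - s * κ ^ 2) (t - 2 * s * κ) κ := by
      refine (((hasDerivAt_id' κ).const_mul t).sub
        (((hasDerivAt_id' κ).fun_pow 2).const_mul s)).congr_deriv ?_
      norm_num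
      ring
    exact (h1.ofReal_comp.const_mul Complex.I).cexp
  have key := intervalIntegral.integral_mul_deriv_eq_deriv_mul (a := 1 / 2) (b := 5)
    (fun κ _ => ((hγ.differentiable (by simp)) κ).hasDerivAt) (fun κ _ => hv κ)
    (hγ'.intervalIntegrable _ _) (Continuous.intervalIntegrable (by fun_prop) _ _)
  rw [(eq_zero_of_tsupport_subset hs).1, (eq_zero_of_tsupport_subset hs).2] at key
  simp only [zero_mul, sub_self, zero_sub] at key
  rw [quadOsc, quadOsc, ← key]
  congr 1
  ext κ
  ring

/-- Van der Corput bound for the quadratic phase. -/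
lemma norm_quadOsc_mul_sqrt_le {γ : ℝ → ℂ} (hγ : ContDiff ℝ (⊤ : ℕ∞) γ) :
    ∃ C > (0:ℝ), ∀ t s : ℝ, 0 < s → ‖quadOsc γ t s‖ * √s ≤ C := by
  have hγ' : Continuous (deriv γ) := (contDiff_infty_iff_deriv.1 hγ).2.continuous
  obtain ⟨C₁, hC₁⟩ := (isCompact_Icc (a := (1 / 2 : ℝ)) (b := 5)).exists_bound_of_continuousOn
    hγ.continuous.continuousOn
  have hBV : BVOn γ (max C₁ (∫ κ in (1 / 2 : ℝ)..5, ‖deriv γ κ‖)) (1 / 2) 5 :=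
    ⟨deriv γ, fun κ _ => ((hγ.differentiable (by simp)) κ).hasDerivAt, hγ'.continuousOn,
      fun κ hκ => (hC₁ κ hκ).trans (le_max_left _ _), le_max_right _ _⟩
  set M := max C₁ (∫ κ in (1 / 2 : ℝ)..5, ‖deriv γ κ‖)
  have hM := hBV.nonneg (by norm_num)
  refine ⟨2 * M * 10 + 1, by positivity, fun t s hs => ?_⟩
  have hs' := Real.sqrt_pos.2 hs
  have hP : PhaseOn (fun κ => t * κ - s * κ ^ 2) (fun i κ => if i = 0 then t - 2 * s * κ else -1)
      (fun _ => 2 * s) s (0 + 1) (1 / 2) 5 := by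
    refine ⟨fun κ _ => ?_, fun i hi κ _ => ?_, ?_, continuousOn_const, hs, fun _ _ => by linarith⟩
    · simp only [if_true]
      refine (((hasDerivAt_id' κ).const_mul t).sub
        (((hasDerivAt_id' κ).fun_pow 2).const_mul s)).congr_deriv ?_
      norm_num
      ring
    · obtain rfl : i = 0 := by omega
      simp only [if_true, zero_add, one_ne_zero, if_false]
      simpa using ((hasDerivAt_id' κ).const_mul (2 * s)).const_sub t
    · simp only [zero_add, one_ne_zero, if_false]
      exact continuousOn_const
  have key := hBV.norm_integral_mul_le (by norm_num) (B := 10 * (√s)⁻¹)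
    (g := fun κ => Complex.exp (Complex.I * ((t * κ - s * κ ^ 2 : ℝ) : ℂ)))
    (Continuous.continuousOn (by fun_prop)) fun c hc hc5 => by
      have := (hP.mono le_rfl hc5).norm_integral_exp_le hc (L := 1) (x := (√s)⁻¹) (by positivity)
        one_pos (fun κ _ => by norm_num) ?_
      · norm_num at this ⊢
        exact this
      · rw [zero_add, zero_add, pow_one, inv_pow, Real.sq_sqrt hs.le, one_mul,
          mul_inv_cancel₀ hs.ne']
  rw [quadOsc]
  calc _ ≤ 2 * M * (10 * (√s)⁻¹) * √s := by gcongr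
    _ = 2 * M * 10 := by field_simp
    _ ≤ _ := by linarith

lemma abs_phase_ge {t s κ : ℝ} (ht : 0 < t) (hs : s ∉ Set.Icc (t / 20) (2 * t))
    (hκ : κ ∈ Set.Icc (1 / 2 : ℝ) 5) : (t + |s|) / 4 ≤ |t - 2 * s * κ| := by
  obtain ⟨h1, h2⟩ := hκ
  rw [Set.mem_Icc, not_and_or, not_le, not_le] at hs
  rcases le_or_gt 0 s with h0 | h0
  · rw [abs_of_nonneg h0]
    rcases hs with h | h
    · rw [abs_of_nonneg (by nlinarith)]
      nlinarith
    · rw [abs_of_nonpos (by nlinarith)]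
      nlinarith
  · rw [abs_of_neg h0, abs_of_nonneg (by nlinarith)]
    nlinarith

lemma norm_quadOsc_tail_le {γ : ℝ → ℂ} (hγ : ContDiff ℝ (⊤ : ℕ∞) γ)
    (hs : tsupport γ ⊆ Set.Ioo (1 / 2) 5) : ∃ C > (0:ℝ), ∀ t s : ℝ, 0 < t →
    s ∉ Set.Icc (t / 20) (2 * t) → ‖quadOsc γ t s‖ ≤ C / t ^ 3 * (1 + (s / t) ^ 2)⁻¹ := by
  obtain ⟨C, hC, h⟩ := norm_integral_nonstationary_le 3 γ hγ hs 0
  refine ⟨64 * C, by positivity, fun t s ht hst => ?_⟩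
  have := h t s ((t + |s|) / 4) (by positivity) ?_ fun κ hκ => abs_phase_ge ht hst hκ
  · simp only [pow_zero, inv_one, Complex.ofReal_one, mul_one, zero_add] at this
    refine this.trans ?_
    have e : 64 * C / t ^ 3 * (1 + (s / t) ^ 2)⁻¹ = 64 * C / (t * (t ^ 2 + s ^ 2)) := by
      field_simp
    rw [e, div_pow, div_div_eq_mul_div, mul_comm C]
    norm_num
    have h0 := abs_nonneg s
    have h1 := sq_abs s
    refine div_le_div_of_nonneg_left (by positivity) (by positivity) ?_
    nlinarith [mul_nonneg ht.le h0, mul_nonneg h0 (sq_nonneg t), mul_nonneg h0 (sq_nonneg |s|)]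
  · rw [abs_mul, abs_two]
    linarith [abs_nonneg s]

/-- `quadOsc` with the stationary phase factor removed. -/
def quadAmp (γ : ℝ → ℂ) (t r : ℝ) : ℂ :=
  Complex.exp (Complex.I * ((-(t ^ 2 / (2 * r)) : ℝ) : ℂ)) * quadOsc γ t (r / 2)

lemma quadOsc_eq_quadAmp (γ : ℝ → ℂ) (t r : ℝ) :
    quadOsc γ t (r / 2) =
      quadAmp γ t r * Complex.exp (Complex.I * ((t ^ 2 / (2 * r) : ℝ) : ℂ)) := by
  rw [quadAmp, mul_right_comm, ← Complex.exp_add]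
  push_cast
  rw [mul_neg, neg_add_cancel, Complex.exp_zero, one_mul]

lemma smooth_support_id_mul {γ : ℝ → ℂ} (hγ : ContDiff ℝ (⊤ : ℕ∞) γ)
    (hs : tsupport γ ⊆ Set.Ioo (1 / 2) 5) :
    ContDiff ℝ (⊤ : ℕ∞) (fun κ : ℝ => (κ : ℂ) * γ κ) ∧
      tsupport (fun κ : ℝ => (κ : ℂ) * γ κ) ⊆ Set.Ioo (1 / 2) 5 :=
  ⟨(Complex.ofRealCLM.contDiff).mul hγ,
    (closure_mono (Function.support_mul_subset_right _ _)).trans hs⟩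

lemma hasDerivAt_quadAmp {γ : ℝ → ℂ} (hγ : ContDiff ℝ (⊤ : ℕ∞) γ)
    (hs : tsupport γ ⊆ Set.Ioo (1 / 2) 5) (t : ℝ) {r : ℝ} (hr : 0 < r) :
    HasDerivAt (quadAmp γ t) (-Complex.exp (Complex.I * ((-(t ^ 2 / (2 * r)) : ℝ) : ℂ)) *
      ((1 / (2 * r ^ 2) : ℝ) : ℂ) * (t * quadOsc (deriv γ) t (r / 2) +
        r * quadOsc (deriv fun κ : ℝ => (κ : ℂ) * γ κ) t (r / 2))) r := by
  have hr0 := hr.ne'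
  have hrc : (r : ℂ) ≠ 0 := by exact_mod_cast hr0
  obtain ⟨h1, h2⟩ := smooth_support_id_mul hγ hs
  have b1 := quadOsc_by_parts hγ hs t (r / 2)
  have b2 := quadOsc_by_parts h1 h2 t (r / 2)
  have hN : HasDerivAt (fun r => quadOsc γ t (r / 2))
      ((1 / 2 : ℝ) • quadOsc (fun κ => -Complex.I * (κ ^ 2 : ℝ) * γ κ) t (r / 2)) r :=
    HasDerivAt.scomp (h := fun r : ℝ => r / 2) r (hasDerivAt_quadOsc hγ.continuous t (r / 2))
      ((hasDerivAt_id' r).div_const 2)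
  have hp : HasDerivAt (fun r : ℝ => -(t ^ 2 / (2 * r))) (t ^ 2 / (2 * r ^ 2)) r := by
    refine (((hasDerivAt_const r (t ^ 2)).fun_div ((hasDerivAt_id' r).const_mul 2)
      (by positivity)).fun_neg).congr_deriv ?_
    field_simp
    ring
  refine (((hp.ofReal_comp.const_mul Complex.I).cexp).mul hN).congr_deriv ?_
  have key : Complex.I * ((t ^ 2 / (2 * r ^ 2) : ℝ) : ℂ) * quadOsc γ t (r / 2) +
      (1 / 2 : ℝ) • quadOsc (fun κ => -Complex.I * (κ ^ 2 : ℝ) * γ κ) t (r / 2) =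
      ((t / (2 * r ^ 2) : ℝ) : ℂ) *
        quadOsc (fun κ => Complex.I * (t - 2 * (r / 2) * κ : ℝ) * γ κ) t (r / 2) +
      ((1 / (2 * r) : ℝ) : ℂ) *
        quadOsc (fun κ => Complex.I * (t - 2 * (r / 2) * κ : ℝ) * (κ * γ κ)) t (r / 2) := by
    have hcγ := hγ.continuous
    simp only [quadOsc, Complex.real_smul]
    rw [← intervalIntegral.integral_const_mul, ← intervalIntegral.integral_const_mul,
      ← intervalIntegral.integral_const_mul, ← intervalIntegral.integral_const_mul,
      ← intervalIntegral.integral_add, ← intervalIntegral.integral_add]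
    · congr 1
      ext κ
      push_cast
      field_simp
      ring
    all_goals exact Continuous.intervalIntegrable (by fun_prop) _ _
  rw [b1, b2] at key
  have e1 : ((1 / (2 * r) : ℝ) : ℂ) = ((1 / (2 * r ^ 2) : ℝ) : ℂ) * r := by
    push_cast
    field_simp
  have e2 : ((t / (2 * r ^ 2) : ℝ) : ℂ) = ((1 / (2 * r ^ 2) : ℝ) : ℂ) * t := by
    push_cast
    field_simp
  rw [e1, e2] at key
  linear_combination Complex.exp (Complex.I * ((-(t ^ 2 / (2 * r)) : ℝ) : ℂ)) * key

lemma bvOn_quadAmp {γ : ℝ → ℂ} (hγ : ContDiff ℝ (⊤ : ℕ∞) γ)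
    (hs : tsupport γ ⊆ Set.Ioo (1 / 2) 5) :
    ∃ C > (0:ℝ), ∀ t : ℝ, 0 < t → BVOn (quadAmp γ t) (C / √t) (t / 10) (4 * t) := by
  obtain ⟨h1, h2⟩ := smooth_support_id_mul hγ hs
  obtain ⟨C₀, hC₀, k₀⟩ := norm_quadOsc_mul_sqrt_le hγ
  obtain ⟨C₁, hC₁, k₁⟩ := norm_quadOsc_mul_sqrt_le (smooth_support_deriv hγ hs).1
  obtain ⟨C₂, hC₂, k₂⟩ := norm_quadOsc_mul_sqrt_le (smooth_support_deriv h1 h2).1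
  have aux : ∀ (N : ℝ → ℝ → ℂ) (C : ℝ), (∀ t s : ℝ, 0 < s → ‖N t s‖ * √s ≤ C) → ∀ t r : ℝ, 0 < t →
      t / 10 ≤ r → ‖N t (r / 2)‖ ≤ 5 * C / √t := by
    intro N C hN t r ht hr
    have hN := hN t (r / 2) (by linarith)
    have h5 : √t ≤ 5 * √(r / 2) := by
      rw [Real.sqrt_le_left (by positivity), mul_pow, Real.sq_sqrt (by linarith)]
      linarith
    rw [le_div_iff₀ (Real.sqrt_pos.2 ht)]
    nlinarith [norm_nonneg (N t (r / 2))]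
  refine ⟨5 * C₀ + 200 * (5 * C₁) + 800 * (5 * C₂), by positivity, fun t ht => ?_⟩
  have hst := Real.sqrt_pos.2 ht
  refine ⟨_, fun r hr => hasDerivAt_quadAmp hγ hs t (by linarith [hr.1]), ?_, ?_, ?_⟩
  · have c1 := (continuous_quadOsc (smooth_support_deriv hγ hs).1.continuous t)
    have c2 := (continuous_quadOsc (smooth_support_deriv h1 h2).1.continuous t)
    have hr0 : ∀ r ∈ Set.Icc (t / 10) (4 * t), 2 * r ≠ 0 := fun r hr => by
      have : 0 < r := by linarith [hr.1]
      positivity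
    have hr2 : ∀ r ∈ Set.Icc (t / 10) (4 * t), 2 * r ^ 2 ≠ 0 := fun r hr => by
      have : 0 < r := by linarith [hr.1]
      positivity
    refine ContinuousOn.mul (ContinuousOn.mul ?_ ?_) (by fun_prop)
    · refine ContinuousOn.neg (ContinuousOn.cexp (continuousOn_const.mul
        (Complex.continuous_ofReal.comp_continuousOn (ContinuousOn.neg
          (continuousOn_const.div (by fun_prop) hr0)))))
    · exact Complex.continuous_ofReal.comp_continuousOn
          (continuousOn_const.div (by fun_prop) hr2)
  · intro r hr
    rw [quadAmp, norm_mul, norm_exp_I_mul_ofReal', one_mul]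
    refine (aux _ _ k₀ t r ht hr.1).trans ?_
    gcongr
    linarith
  · refine (le_abs_self _).trans ?_
    rw [← Real.norm_eq_abs]
    refine (intervalIntegral.norm_integral_le_of_norm_le_const
      (C := 50 * (5 * C₁ + 4 * (5 * C₂)) / √t / t) fun r hr => ?_).trans ?_
    · rw [Set.uIoc_of_le (by linarith)] at hr
      have hr0 : 0 < r := by linarith [hr.1]
      rw [norm_norm, norm_mul, norm_mul, norm_neg, norm_exp_I_mul_ofReal', one_mul,
        Complex.norm_real, Real.norm_of_nonneg (by positivity)]
      have e1 := aux _ _ k₁ t r ht hr.1.le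
      have e2 := aux _ _ k₂ t r ht hr.1.le
      calc _ ≤ 1 / (2 * r ^ 2) * (t * (5 * C₁ / √t) + 4 * t * (5 * C₂ / √t)) := by
            gcongr
            refine (norm_add_le _ _).trans ?_
            rw [norm_mul, norm_mul, Complex.norm_real, Complex.norm_real,
              Real.norm_of_nonneg ht.le, Real.norm_of_nonneg hr0.le]
            have := hr.2
            gcongr
        _ ≤ 1 / (2 * (t / 10) ^ 2) * (t * (5 * C₁ / √t) + 4 * t * (5 * C₂ / √t)) := by
            have := hr.1.le
            gcongr
        _ = _ := by
            field_simp
            ring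
    · rw [abs_of_pos (by linarith), div_mul_eq_mul_div, div_le_iff₀ ht,
        div_mul_eq_mul_div, div_mul_eq_mul_div]
      refine div_le_div_of_nonneg_right ?_ hst.le
      nlinarith [mul_pos hC₀ ht, mul_pos hC₁ ht, mul_pos hC₂ ht]

lemma integrable_quadOsc {γ : ℝ → ℂ} (hγ : ContDiff ℝ (⊤ : ℕ∞) γ)
    (hs : tsupport γ ⊆ Set.Ioo (1 / 2) 5) {t : ℝ} (ht : 0 < t) : Integrable (quadOsc γ t) := by
  obtain ⟨M, hM⟩ := (isCompact_Icc (a := (1 / 2 : ℝ)) (b := 5)).exists_bound_of_continuousOn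
    hγ.continuous.continuousOn
  have hM0 : 0 ≤ M := (norm_nonneg _).trans (hM 1 ⟨by norm_num, by norm_num⟩)
  obtain ⟨C, hC, h⟩ := norm_quadOsc_tail_le hγ hs
  refine Integrable.mono' ((integrable_inv_one_add_sq.comp_div ht.ne').const_mul
    (C / t ^ 3 + 25 * M)) (continuous_quadOsc hγ.continuous t).aestronglyMeasurable
    (Filter.Eventually.of_forall fun s => ?_)
  by_cases hst : s ∈ Set.Icc (t / 20) (2 * t)
  · refine (norm_quadOsc_le hM t s).trans ?_
    have h1 : s / t ≤ 2 := by
      rw [div_le_iff₀ ht]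
      exact hst.2
    have h2 : 0 ≤ s / t := div_nonneg (by linarith [hst.1]) ht.le
    have h3 : 0 ≤ C / t ^ 3 := by positivity
    rw [← div_eq_mul_inv, le_div_iff₀ (by positivity)]
    nlinarith [mul_nonneg hM0 (show 0 ≤ 4 - (s / t) ^ 2 by nlinarith)]
  · refine (h t s ht hst).trans ?_
    gcongr
    linarith

/-- The function whose Fourier transform is `quadOsc γ t`. -/
def quadProfile (γ : ℝ → ℂ) (t l : ℝ) : ℂ :=
  γ (√l) * Complex.exp (Complex.I * ((t * √l : ℝ) : ℂ)) * (((2 * max (√l) (1 / 2))⁻¹ : ℝ) : ℂ)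

lemma support_quadProfile {γ : ℝ → ℂ} (hs : tsupport γ ⊆ Set.Ioo (1 / 2) 5) (t : ℝ) :
    Function.support (quadProfile γ t) ⊆ Set.Ioc (1 / 4) 25 := by
  intro l hl
  have h : √l ∈ tsupport γ := subset_tsupport γ fun h => hl (by simp [quadProfile, h])
  obtain ⟨h1, h2⟩ := hs h
  have hl0 : 0 < l := Real.sqrt_pos.1 (by linarith)
  have := Real.sq_sqrt hl0.le
  constructor <;> nlinarith

lemma continuous_quadProfile {γ : ℝ → ℂ} (hγ : Continuous γ) (t : ℝ) :
    Continuous (quadProfile γ t) := by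
  have h : Continuous fun l : ℝ => (2 * max (√l) (1 / 2))⁻¹ :=
    Continuous.inv₀ (by fun_prop) fun l => by positivity
  have h2 := Complex.continuous_ofReal.comp h
  exact Continuous.mul (by fun_prop) h2

lemma fourier_quadProfile {γ : ℝ → ℂ} (hγ : Continuous γ)
    (hs : tsupport γ ⊆ Set.Ioo (1 / 2) 5) (t w : ℝ) :
    FourierTransform.fourier (quadProfile γ t) w = quadOsc γ t (w * (2 * π)) := by
  rw [Real.fourier_real_eq_integral_exp_smul]
  set g : ℝ → ℂ := fun v => Complex.exp (↑(-2 * π * v * w) * Complex.I) • quadProfile γ t v with hg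
  have hgc : Continuous g := by
    have := continuous_quadProfile hγ t
    fun_prop
  have hgs : Function.support g ⊆ Set.Ioc ((1 / 2 : ℝ) ^ 2) (5 ^ 2) := by
    have : Function.support g ⊆ Function.support (quadProfile γ t) := fun v hv h =>
      hv (by simp only [hg, h, smul_zero])
    refine this.trans ((support_quadProfile hs t).trans ?_)
    norm_num
  rw [← intervalIntegral.integral_eq_integral_of_support_subset hgs]
  have := intervalIntegral.integral_deriv_smul_comp (a := 1 / 2) (b := 5) (f := fun κ : ℝ => κ ^ 2)
    (f' := fun κ => 2 * κ) (g := g) (fun κ _ => by simpa using hasDerivAt_pow 2 κ) (by fun_prop) hgc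
  rw [← this, quadOsc]
  refine intervalIntegral.integral_congr fun κ hκ => ?_
  rw [Set.uIcc_of_le (by norm_num)] at hκ
  have hκ0 : 0 < κ := by linarith [hκ.1]
  have hκc : (κ : ℂ) ≠ 0 := by exact_mod_cast hκ0.ne'
  simp only [hg, Function.comp, quadProfile, Real.sqrt_sq hκ0.le, max_eq_left hκ.1,
    Complex.real_smul, smul_eq_mul]
  have e : Complex.exp (Complex.I * ((t * κ - w * (2 * π) * κ ^ 2 : ℝ) : ℂ)) =
      Complex.exp (((-2 * π * κ ^ 2 * w : ℝ) : ℂ) * Complex.I) *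
        Complex.exp (Complex.I * ((t * κ : ℝ) : ℂ))
      := by
    rw [← Complex.exp_add]
    congr 1
    push_cast
    ring
  rw [e]
  push_cast
  field_simp

lemma integral_quadOsc_mul_exp {γ : ℝ → ℂ} (hγ : ContDiff ℝ (⊤ : ℕ∞) γ)
    (hs : tsupport γ ⊆ Set.Ioo (1 / 2) 5) {t κ : ℝ} (ht : 0 < t) (hκ : 1 / 2 ≤ κ) :
    ∫ s, quadOsc γ t s * Complex.exp (Complex.I * ((s * κ ^ 2 : ℝ) : ℂ)) =
      ((2 * π : ℝ) : ℂ) * (γ κ * Complex.exp (Complex.I * ((t * κ : ℝ) : ℂ)) *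
        (((2 * κ)⁻¹ : ℝ) : ℂ)) := by
  have hf : FourierTransform.fourier (quadProfile γ t) = fun w => quadOsc γ t (w * (2 * π)) :=
    funext (fourier_quadProfile hγ.continuous hs t)
  have hpc := continuous_quadProfile hγ.continuous t
  have hpi : Integrable (quadProfile γ t) :=
    hpc.integrable_of_hasCompactSupport (HasCompactSupport.of_support_subset_isCompact
      isCompact_Icc ((support_quadProfile hs t).trans Set.Ioc_subset_Icc_self))
  have hfi : Integrable (FourierTransform.fourier (quadProfile γ t)) := by
    rw [hf]
    exact (integrable_quadOsc hγ hs ht).comp_mul_right' (by positivity)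
  have key := congrFun (hpc.fourierInv_fourier_eq hpi hfi) (κ ^ 2)
  have hκ0 : 0 < κ := by linarith
  have e : quadProfile γ t (κ ^ 2) = γ κ * Complex.exp (Complex.I * ((t * κ : ℝ) : ℂ)) *
        (((2 * κ)⁻¹ : ℝ) : ℂ) := by
    rw [quadProfile, Real.sqrt_sq hκ0.le, max_eq_left hκ]
  rw [← e, ← key, hf, Real.fourierInv_eq']
  have := Measure.integral_comp_mul_right (fun s => quadOsc γ t s *
    Complex.exp (Complex.I * ((s * κ ^ 2 : ℝ) : ℂ))) (2 * π)
  rw [abs_of_pos (by positivity)] at this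
  have h2 : ∀ x : ℂ, ((2 * π : ℝ) : ℂ) * ((2 * π)⁻¹ : ℝ) • x = x := fun x => by
    rw [Complex.real_smul]
    have : (π : ℂ) ≠ 0 := by exact_mod_cast Real.pi_ne_zero
    push_cast
    field_simp
  rw [← h2 (∫ s, quadOsc γ t s * Complex.exp (Complex.I * ((s * κ ^ 2 : ℝ) : ℂ))), ← this]
  congr 1
  refine integral_congr_ae (Filter.Eventually.of_forall fun v => ?_)
  simp only [smul_eq_mul, RCLike.inner_apply, conj_trivial]
  rw [mul_comm]
  congr 2
  push_cast
  ring

lemma one_le_omegaKG (d : ℕ) (ξ : Fin d → ℝ) : 1 ≤ omegaKG d ξ := by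
  rw [omegaKG, Real.one_le_sqrt]
  have : 0 ≤ ∑ j : Fin d, 2 * (1 - Real.cos (ξ j)) := Finset.sum_nonneg fun j _ => by
    linarith [Real.cos_le_one (ξ j)]
  linarith

lemma omegaKG_sq (d : ℕ) (ξ : Fin d → ℝ) :
    omegaKG d ξ ^ 2 = 1 + 2 * d - 2 * ∑ j : Fin d, Real.cos (ξ j) := by
  have h : 0 ≤ 1 + ∑ j : Fin d, 2 * (1 - Real.cos (ξ j)) :=
    add_nonneg zero_le_one (Finset.sum_nonneg fun j _ => by linarith [Real.cos_le_one (ξ j)])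
  rw [omegaKG, Real.sq_sqrt h, ← Finset.mul_sum, Finset.sum_sub_distrib]
  simp
  ring

lemma continuous_omegaKG (d : ℕ) : Continuous (omegaKG d) := by
  unfold omegaKG
  fun_prop

lemma integral_cube_prod (d : ℕ) (F : Fin d → ℝ → ℂ) :
    ∫ ξ in cube d, ∏ j, F j (ξ j) = ∏ j, ∫ θ in (0 : ℝ)..(2 * π), F j θ := by
  have h : cube d = Set.univ.pi fun _ : Fin d => Set.Icc (0 : ℝ) (2 * π) := by
    rw [cube, ← Set.pi_univ_Icc]
    rfl
  rw [h, volume_pi, Measure.restrict_pi_pi, integral_fintype_prod_eq_prod]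
  refine Finset.prod_congr rfl fun j _ => ?_
  rw [intervalIntegral.integral_of_le (by positivity), integral_Icc_eq_integral_Ioc]

lemma volume_cube_lt_top (d : ℕ) : volume (cube d) < ⊤ := isCompact_Icc.measure_lt_top

instance isFiniteMeasure_restrict_cube (d : ℕ) :
    IsFiniteMeasure ((volume : Measure (Fin d → ℝ)).restrict (cube d)) :=
  ⟨by rw [Measure.restrict_apply_univ]; exact volume_cube_lt_top d⟩

lemma integral_cube_exp_omegaKG_sq (d : ℕ) (x : Fin d → ℤ) (s : ℝ) :
    ∫ ξ in cube d, Complex.exp (Complex.I * ((∑ j : Fin d, (x j : ℝ) * ξ j : ℝ) : ℂ)) *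
      Complex.exp (Complex.I * ((s * omegaKG d ξ ^ 2 : ℝ) : ℂ)) =
    Complex.exp (Complex.I * ((s * (1 + 2 * d) : ℝ) : ℂ)) * ∏ j, besselMom 0 (x j) (2 * s) := by
  simp only [besselMom, pow_zero, one_mul]
  rw [← integral_cube_prod d fun j θ =>
    Complex.exp (Complex.I * ((x j * θ - 2 * s * Real.cos θ : ℝ) : ℂ)), ← integral_const_mul]
  refine integral_congr_ae (Filter.Eventually.of_forall fun ξ => ?_)
  simp only
  rw [← Complex.exp_sum, ← Complex.exp_add, ← Complex.exp_add, omegaKG_sq, ← Finset.mul_sum,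
    ← Complex.ofReal_sum, Finset.sum_sub_distrib, ← Finset.mul_sum]
  congr 1
  push_cast
  ring

lemma integral_cube_eq_subordination (d : ℕ) {γ : ℝ → ℂ} (hγ : ContDiff ℝ (⊤ : ℕ∞) γ)
    (hs : tsupport γ ⊆ Set.Ioo (1 / 2) 5) {t : ℝ} (ht : 0 < t) (x : Fin d → ℤ) :
    ((2 * π : ℝ) : ℂ) * ∫ ξ in cube d,
      Complex.exp (Complex.I * ((∑ j : Fin d, (x j : ℝ) * ξ j : ℝ) : ℂ)) *
      (γ (omegaKG d ξ) * Complex.exp (Complex.I * ((t * omegaKG d ξ : ℝ) : ℂ)) *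
        (((2 * omegaKG d ξ)⁻¹ : ℝ) : ℂ)) =
    ∫ s, quadOsc γ t s * (Complex.exp (Complex.I * ((s * (1 + 2 * d) : ℝ) : ℂ)) *
      ∏ j, besselMom 0 (x j) (2 * s)) := by
  have hq := integrable_quadOsc hγ hs ht
  have hqc := continuous_quadOsc hγ.continuous t
  have hωc := continuous_omegaKG d
  rw [← integral_const_mul]
  have e1 : ∀ ξ : Fin d → ℝ, ((2 * π : ℝ) : ℂ) *
      (Complex.exp (Complex.I * ((∑ j : Fin d, (x j : ℝ) * ξ j : ℝ) : ℂ)) *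
      (γ (omegaKG d ξ) * Complex.exp (Complex.I * ((t * omegaKG d ξ : ℝ) : ℂ)) *
        (((2 * omegaKG d ξ)⁻¹ : ℝ) : ℂ))) =
      ∫ s, Complex.exp (Complex.I * ((∑ j : Fin d, (x j : ℝ) * ξ j : ℝ) : ℂ)) *
        (quadOsc γ t s * Complex.exp (Complex.I * ((s * omegaKG d ξ ^ 2 : ℝ) : ℂ))) := fun ξ => by
    rw [integral_const_mul, integral_quadOsc_mul_exp hγ hs ht
      (by linarith [one_le_omegaKG d ξ])]
    ring
  simp only [e1]
  rw [integral_integral_swap]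
  · refine integral_congr_ae (Filter.Eventually.of_forall fun s => ?_)
    simp only
    rw [← integral_cube_exp_omegaKG_sq, ← integral_const_mul]
    congr 1
    ext ξ
    ring
  · have := (integrable_const (1 : ℝ) (μ := (volume : Measure (Fin d → ℝ)).restrict
      (cube d))).mul_prod hq.norm
    refine this.mono' ?_ (Filter.Eventually.of_forall fun z => ?_)
    · refine Continuous.aestronglyMeasurable ?_
      simp only [Function.uncurry_def]
      fun_prop
    · simp only [Function.uncurry_def]
      rw [norm_mul, norm_mul, norm_exp_I_mul_ofReal', norm_exp_I_mul_ofReal', one_mul, one_mul,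
        mul_one]

lemma norm_integral_cube_le (d : ℕ) {γ : ℝ → ℂ} (hγ : ContDiff ℝ (⊤ : ℕ∞) γ)
    (hs : tsupport γ ⊆ Set.Ioo (1 / 2) 5) : ∃ C > (0:ℝ), ∀ t : ℝ, 0 < t → ∀ x : Fin d → ℤ,
    ‖∫ ξ in cube d, Complex.exp (Complex.I * ((∑ j : Fin d, (x j : ℝ) * ξ j : ℝ) : ℂ)) *
      (γ (omegaKG d ξ) * Complex.exp (Complex.I * ((t * omegaKG d ξ : ℝ) : ℂ)) *
        (((2 * omegaKG d ξ)⁻¹ : ℝ) : ℂ))‖ ≤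
    C / t ^ 2 + ‖∫ r in (t / 10)..(4 * t), quadAmp γ t r *
      (Complex.exp (Complex.I * ((t ^ 2 / (2 * r) + (1 + 2 * d) * r / 2 : ℝ) : ℂ)) *
        ∏ j, besselMom 0 (x j) r)‖ := by
  obtain ⟨C, hC, h⟩ := norm_quadOsc_tail_le hγ hs
  refine ⟨(2 * π) ^ d * C * π, by positivity, fun t ht x => ?_⟩
  set F : ℝ → ℂ := fun s => quadOsc γ t s * (Complex.exp (Complex.I * ((s * (1 + 2 * d) : ℝ) : ℂ)) *
      ∏ j, besselMom 0 (x j) (2 * s)) with hF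
  have hprod : ∀ r, ‖∏ j, besselMom 0 (x j) r‖ ≤ (2 * π) ^ d := fun r => by
    rw [norm_prod]
    calc _ ≤ ∏ _j : Fin d, (2 * π) := Finset.prod_le_prod (fun _ _ => norm_nonneg _)
          fun j _ => norm_besselMom_le 0 (x j) r
      _ = _ := by simp
  have hFn : ∀ s, ‖F s‖ ≤ ‖quadOsc γ t s‖ * (2 * π) ^ d := fun s => by
    rw [hF, norm_mul, norm_mul, norm_exp_I_mul_ofReal', one_mul]
    exact mul_le_mul_of_nonneg_left (hprod _) (norm_nonneg _)
  have hFc : Continuous F := by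
    have hb : ∀ j, Continuous (besselMom 0 (x j)) := fun j =>
      continuous_iff_continuousAt.2 fun r => (hasDerivAt_besselMom 0 (x j) r).continuousAt
    have := continuous_quadOsc hγ.continuous t
    fun_prop
  have hFi : Integrable F := ((integrable_quadOsc hγ hs ht).norm.mul_const _).mono'
    hFc.aestronglyMeasurable (Filter.Eventually.of_forall hFn)
  have key := integral_cube_eq_subordination d hγ hs ht x
  rw [← integral_add_compl measurableSet_Icc hFi (s := Set.Icc (t / 20) (2 * t))] at key
  have hin : ∫ s in Set.Icc (t / 20) (2 * t), F s = (1 / 2 : ℂ) *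
      ∫ r in (t / 10)..(4 * t), quadAmp γ t r *
      (Complex.exp (Complex.I * ((t ^ 2 / (2 * r) + (1 + 2 * d) * r / 2 : ℝ) : ℂ)) *
        ∏ j, besselMom 0 (x j) r) := by
    have h2 : ∀ r, quadAmp γ t r *
      (Complex.exp (Complex.I * ((t ^ 2 / (2 * r) + (1 + 2 * d) * r / 2 : ℝ) : ℂ)) *
        ∏ j, besselMom 0 (x j) r) = F (r / 2) := fun r => by
      simp only [hF]
      rw [quadOsc_eq_quadAmp, mul_div_cancel₀ r two_ne_zero, mul_assoc (quadAmp γ t r),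
        ← mul_assoc (Complex.exp _), ← Complex.exp_add]
      congr 4
      push_cast
      ring
    simp only [h2]
    rw [intervalIntegral.integral_comp_div F two_ne_zero, Complex.real_smul,
      integral_Icc_eq_integral_Ioc, ← intervalIntegral.integral_of_le (by linarith),
      show t / 10 / 2 = t / 20 by ring, show 4 * t / 2 = 2 * t by ring]
    push_cast
    ring
  have hout : ‖∫ s in (Set.Icc (t / 20) (2 * t))ᶜ, F s‖ ≤ (2 * π) ^ d * C * π / t ^ 2 := by
    have hi : Integrable fun s : ℝ => C / t ^ 3 * (1 + (s / t) ^ 2)⁻¹ * (2 * π) ^ d :=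
      ((integrable_inv_one_add_sq.comp_div ht.ne').const_mul _).mul_const _
    calc _ ≤ ∫ s in (Set.Icc (t / 20) (2 * t))ᶜ, C / t ^ 3 * (1 + (s / t) ^ 2)⁻¹ * (2 * π) ^ d := by
          refine norm_integral_le_of_norm_le hi.integrableOn ?_
          refine (ae_restrict_iff' measurableSet_Icc.compl).2 (Filter.Eventually.of_forall
            fun s hst => (hFn s).trans ?_)
          have := h t s ht hst
          gcongr
      _ ≤ ∫ s, C / t ^ 3 * (1 + (s / t) ^ 2)⁻¹ * (2 * π) ^ d :=
          setIntegral_le_integral hi (Filter.Eventually.of_forall fun s => by positivity)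
      _ = _ := by
          rw [integral_mul_const, integral_const_mul,
            Measure.integral_comp_div (fun s : ℝ => (1 + s ^ 2)⁻¹) t, integral_univ_inv_one_add_sq,
            abs_of_pos ht, smul_eq_mul]
          field_simp
  rw [hin] at key
  set J := ∫ r in (t / 10)..(4 * t), quadAmp γ t r *
      (Complex.exp (Complex.I * ((t ^ 2 / (2 * r) + (1 + 2 * d) * r / 2 : ℝ) : ℂ)) *
        ∏ j, besselMom 0 (x j) r)
  have hk := congrArg norm key
  rw [norm_mul, Complex.norm_real, Real.norm_of_nonneg (by positivity)] at hk
  have h3 := norm_add_le ((1 / 2 : ℂ) * J) (∫ s in (Set.Icc (t / 20) (2 * t))ᶜ, F s)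
  rw [norm_mul] at h3
  norm_num at h3
  refine le_trans (le_mul_of_one_le_left (norm_nonneg _)
    (by linarith [Real.pi_gt_three] : (1:ℝ) ≤ 2 * π)) ?_
  rw [hk]
  norm_num
  linarith [norm_nonneg J]

/-- The radial oscillatory integral produced by subordination. -/
def radialOsc (d : ℕ) (a : ℝ → ℂ) (t : ℝ) (x : Fin d → ℤ) : ℂ :=
  ∫ r in (t / 10)..(4 * t), a r *
    (Complex.exp (Complex.I * ((t ^ 2 / (2 * r) + (1 + 2 * d) * r / 2 : ℝ) : ℂ)) *
      ∏ j, besselMom 0 (x j) r)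

/-- The half-wave kernel with symbol `e^{itω} ω^{-b}`. -/
def halfWave (d b : ℕ) (t : ℝ) (x : Fin d → ℤ) : ℂ :=
  ∫ ξ in cube d, Complex.exp (Complex.I * ((∑ j : Fin d, (x j : ℝ) * ξ j : ℝ) : ℂ)) *
    (Complex.exp (Complex.I * ((t * omegaKG d ξ : ℝ) : ℂ)) * (((omegaKG d ξ ^ b)⁻¹ : ℝ) : ℂ))

lemma omegaKG_le {d : ℕ} (hd : d ≤ 4) (ξ : Fin d → ℝ) : omegaKG d ξ ≤ 9 / 2 := by
  have h := omegaKG_sq d ξ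
  have h1 : -(d : ℝ) ≤ ∑ j : Fin d, Real.cos (ξ j) := by
    calc -(d : ℝ) = ∑ _j : Fin d, (-1 : ℝ) := by simp
      _ ≤ _ := Finset.sum_le_sum fun j _ => Real.neg_one_le_cos _
  have h2 : (d : ℝ) ≤ 4 := by exact_mod_cast hd
  nlinarith [one_le_omegaKG d ξ]

lemma exists_smooth_profile (b : ℕ) (hb : b ≤ 1) : ∃ γ : ℝ → ℂ, ContDiff ℝ (⊤ : ℕ∞) γ ∧
    tsupport γ ⊆ Set.Ioo (1 / 2) 5 ∧
    ∀ κ ∈ Set.Icc (1 : ℝ) (9 / 2), γ κ * (((2 * κ)⁻¹ : ℝ) : ℂ) = (((κ ^ b)⁻¹ : ℝ) : ℂ) := by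
  let χ : ContDiffBump (11 / 4 : ℝ) := ⟨7 / 4, 2, by norm_num, by norm_num⟩
  have hχ : tsupport χ ⊆ Set.Ioo (1 / 2) 5 := by
    rw [χ.tsupport_eq, Real.closedBall_eq_Icc]
    intro y hy
    have h1 : (11 / 4 : ℝ) - 2 ≤ y := hy.1
    have h2 : y ≤ (11 / 4 : ℝ) + 2 := hy.2
    constructor <;> linarith
  refine ⟨fun κ => ((2 * κ ^ (1 - b) * χ κ : ℝ) : ℂ), ?_, ?_, fun κ hκ => ?_⟩
  · exact Complex.ofRealCLM.contDiff.comp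
      (ContDiff.mul (by fun_prop) (ContDiffBump.contDiff χ))
  · refine (closure_mono fun y hy => ?_).trans hχ
    intro h
    exact hy (by simp [h])
  · have : χ κ = 1 := χ.one_of_mem_closedBall (by
      rw [Real.closedBall_eq_Icc]
      have h1 : χ.rIn = 7 / 4 := rfl
      rw [h1]
      constructor <;> linarith [hκ.1, hκ.2])
    have hκ0 : κ ≠ 0 := by linarith [hκ.1]
    simp only [this]
    rw [← Complex.ofReal_mul]
    congr 1
    interval_cases b
    · simp
      field_simp
    · simp
      field_simp

lemma halfWave_le {d b : ℕ} (hd : d ≤ 4) (hb : b ≤ 1) {g : ℝ → ℝ}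
    (H : ∃ C > (0:ℝ), ∀ t M : ℝ, 1 ≤ t → ∀ a, BVOn a M (t / 10) (4 * t) → ∀ x : Fin d → ℤ,
      ‖radialOsc d a t x‖ ≤ C * M * g t)
    (hg : ∀ t, 1 ≤ t → √t / t ^ 2 ≤ g t) :
    ∃ C > (0:ℝ), ∀ t : ℝ, 1 ≤ t → ∀ x : Fin d → ℤ, ‖halfWave d b t x‖ ≤ C * (g t / √t) := by
  obtain ⟨γ, h1, h2, h3⟩ := exists_smooth_profile b hb
  obtain ⟨C₁, hC₁, k₁⟩ := norm_integral_cube_le d h1 h2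
  obtain ⟨C₂, hC₂, k₂⟩ := bvOn_quadAmp h1 h2
  obtain ⟨C₃, hC₃, k₃⟩ := H
  refine ⟨C₁ + C₃ * C₂, by positivity, fun t ht x => ?_⟩
  have ht0 : 0 < t := by linarith
  have hst := Real.sqrt_pos.2 ht0
  have e : halfWave d b t x = ∫ ξ in cube d,
      Complex.exp (Complex.I * ((∑ j : Fin d, (x j : ℝ) * ξ j : ℝ) : ℂ)) *
      (γ (omegaKG d ξ) * Complex.exp (Complex.I * ((t * omegaKG d ξ : ℝ) : ℂ)) *
        (((2 * omegaKG d ξ)⁻¹ : ℝ) : ℂ)) := by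
    refine integral_congr_ae (Filter.Eventually.of_forall fun ξ => ?_)
    simp only
    rw [← h3 _ ⟨one_le_omegaKG d ξ, omegaKG_le hd ξ⟩]
    ring
  rw [e]
  refine (k₁ t ht0 x).trans ?_
  have h4 := k₃ t _ ht _ (k₂ t ht0) x
  rw [radialOsc] at h4
  have h5 : 1 / t ^ 2 ≤ g t / √t := by
    rw [le_div_iff₀ hst]
    refine le_trans (le_of_eq ?_) (hg t ht)
    ring
  calc _ ≤ C₁ * (1 / t ^ 2) + C₃ * (C₂ / √t) * g t := by
        rw [mul_one_div]
        exact add_le_add le_rfl h4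
    _ ≤ C₁ * (g t / √t) + C₃ * (C₂ / √t) * g t := by gcongr
    _ = _ := by ring

lemma continuous_waveIntegrand (d b : ℕ) (t : ℝ) (x : Fin d → ℤ) : Continuous fun ξ : Fin d → ℝ =>
    Complex.exp (Complex.I * ((∑ j : Fin d, (x j : ℝ) * ξ j : ℝ) : ℂ)) *
    (Complex.exp (Complex.I * ((t * omegaKG d ξ : ℝ) : ℂ)) * (((omegaKG d ξ ^ b)⁻¹ : ℝ) : ℂ)) := by
  have hω := continuous_omegaKG d
  have h : Continuous fun ξ : Fin d → ℝ => (omegaKG d ξ ^ b)⁻¹ :=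
    Continuous.inv₀ (by fun_prop) fun ξ => pow_ne_zero _ (by linarith [one_le_omegaKG d ξ])
  have h2 := Complex.continuous_ofReal.comp h
  exact Continuous.mul (by fun_prop) (Continuous.mul (by fun_prop) h2)

lemma integrableOn_waveIntegrand (d b : ℕ) (t : ℝ) (x : Fin d → ℤ) :
    IntegrableOn (fun ξ : Fin d → ℝ =>
      Complex.exp (Complex.I * ((∑ j : Fin d, (x j : ℝ) * ξ j : ℝ) : ℂ)) *
      (Complex.exp (Complex.I * ((t * omegaKG d ξ : ℝ) : ℂ)) *
        (((omegaKG d ξ ^ b)⁻¹ : ℝ) : ℂ))) (cube d) :=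
  (continuous_waveIntegrand d b t x).continuousOn.integrableOn_compact isCompact_Icc

lemma conj_halfWave (d b : ℕ) (t : ℝ) (x : Fin d → ℤ) :
    (starRingEnd ℂ) (halfWave d b t x) = halfWave d b (-t) (-x) := by
  rw [halfWave, halfWave, ← integral_conj]
  refine integral_congr_ae (Filter.Eventually.of_forall fun ξ => ?_)
  simp only [map_mul, ← Complex.exp_conj, Complex.conj_I, Complex.conj_ofReal, Pi.neg_apply,
    Int.cast_neg, neg_mul, Finset.sum_neg_distrib, Complex.ofReal_neg, mul_neg]

lemma integral_waveIntegrand_cos (d b : ℕ) (t : ℝ) (x : Fin d → ℤ) :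
    ∫ ξ in cube d, Complex.exp (Complex.I * ((∑ j : Fin d, (x j : ℝ) * ξ j : ℝ) : ℂ)) *
      ((Real.cos (t * omegaKG d ξ) / omegaKG d ξ ^ b : ℝ) : ℂ) =
    (halfWave d b t x + halfWave d b (-t) x) / 2 := by
  rw [halfWave, halfWave, ← integral_add
    (integrableOn_waveIntegrand d b t x)
    (integrableOn_waveIntegrand d b (-t) x), ← integral_div]
  refine integral_congr_ae (Filter.Eventually.of_forall fun ξ => ?_)
  simp only
  push_cast
  rw [Complex.cos, mul_comm Complex.I (t * omegaKG d ξ : ℂ),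
    show Complex.I * (-t * omegaKG d ξ : ℂ) = -(t * omegaKG d ξ) * Complex.I by ring]
  ring

lemma integral_waveIntegrand_sin (d b : ℕ) (t : ℝ) (x : Fin d → ℤ) :
    ∫ ξ in cube d, Complex.exp (Complex.I * ((∑ j : Fin d, (x j : ℝ) * ξ j : ℝ) : ℂ)) *
      ((Real.sin (t * omegaKG d ξ) / omegaKG d ξ ^ b : ℝ) : ℂ) =
    (halfWave d b (-t) x - halfWave d b t x) * Complex.I / 2 := by
  rw [halfWave, halfWave, ← integral_sub
    (integrableOn_waveIntegrand d b (-t) x)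
    (integrableOn_waveIntegrand d b t x), ← integral_mul_const,
    ← integral_div]
  refine integral_congr_ae (Filter.Eventually.of_forall fun ξ => ?_)
  simp only
  push_cast
  rw [Complex.sin, mul_comm Complex.I (t * omegaKG d ξ : ℂ),
    show Complex.I * (-t * omegaKG d ξ : ℂ) = -(t * omegaKG d ξ) * Complex.I by ring]
  ring

/-- Kernel bounds for both propagators from a bound on the radial oscillatory integrals. -/
lemma norm_multKernel_le_of_radialOsc {d : ℕ} (hd : d ≤ 4) {g : ℝ → ℝ}
    (H : ∃ C > (0:ℝ), ∀ t M : ℝ, 1 ≤ t → ∀ a, BVOn a M (t / 10) (4 * t) → ∀ x : Fin d → ℤ,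
      ‖radialOsc d a t x‖ ≤ C * M * g t)
    (hg : ∀ t, 1 ≤ t → √t / t ^ 2 ≤ g t) :
    ∃ C > (0:ℝ), ∀ t : ℝ, 1 ≤ t → ∀ x : Fin d → ℤ,
      ‖multKernel d (fun ξ => Real.cos (t * omegaKG d ξ)) x‖ ≤ C * (g t / √t) ∧
      ‖multKernel d (fun ξ => Real.sin (t * omegaKG d ξ) / omegaKG d ξ) x‖ ≤ C * (g t / √t) := by
  obtain ⟨C₀, hC₀, k₀⟩ := halfWave_le hd (b := 0) (by norm_num) H hg
  obtain ⟨C₁, hC₁, k₁⟩ := halfWave_le hd (b := 1) (by norm_num) H hg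
  refine ⟨C₀ + C₁, by positivity, fun t ht x => ?_⟩
  have ht0 : 0 < t := by linarith
  have hgp : 0 ≤ g t / √t := div_nonneg (le_trans (by positivity) (hg t ht)) (Real.sqrt_nonneg t)
  have hneg : ∀ b C, (∀ t : ℝ, 1 ≤ t → ∀ x : Fin d → ℤ, ‖halfWave d b t x‖ ≤ C * (g t / √t)) →
      ‖halfWave d b (-t) x‖ ≤ C * (g t / √t) := fun b C h => by
    have := conj_halfWave d b t (-x)
    rw [neg_neg] at this
    rw [← this, RCLike.norm_conj]
    exact h t ht (-x)
  have hpi : ‖((((2 * Real.pi) ^ d)⁻¹ : ℝ) : ℂ)‖ ≤ 1 := by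
    rw [Complex.norm_real, Real.norm_of_nonneg (by positivity)]
    exact inv_le_one_of_one_le₀ (one_le_pow₀ (by linarith [Real.pi_gt_three]))
  constructor
  · have e := integral_waveIntegrand_cos d 0 t x
    simp only [pow_zero, div_one] at e
    rw [multKernel, e, norm_mul, norm_div]
    refine (mul_le_of_le_one_left (by positivity) hpi).trans ?_
    have h1 := norm_add_le (halfWave d 0 t x) (halfWave d 0 (-t) x)
    have h2 := k₀ t ht x
    have h3 := hneg 0 C₀ k₀
    norm_num
    nlinarith [mul_nonneg hC₁.le hgp]
  · have e := integral_waveIntegrand_sin d 1 t x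
    simp only [pow_one] at e
    rw [multKernel, e, norm_mul, norm_div, norm_mul, Complex.norm_I, mul_one]
    refine (mul_le_of_le_one_left (by positivity) hpi).trans ?_
    have h1 := norm_sub_le (halfWave d 1 (-t) x) (halfWave d 1 t x)
    have h2 := k₁ t ht x
    have h3 := hneg 1 C₁ k₁
    norm_num
    nlinarith [mul_nonneg hC₀.le hgp]

/-- First derivative profile of the Bessel phase, in terms of the inverse speed `p`. -/
def phaseG (w p : ℝ) : ℝ := (p - p⁻¹) / w

section
variable {w p q p₁ p₂ p₃ : ℝ}

lemma phaseG_nonneg (hw : 1 / 16 ≤ w) (hp : 1 ≤ p) : 0 ≤ phaseG w p := by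
  have := inv_le_one_of_one_le₀ hp
  exact div_nonneg (by linarith) (by linarith)

lemma phaseG_le (hw : 1 / 16 ≤ w) (hp : 1 ≤ p) : phaseG w p ≤ 16 * p := by
  have := inv_nonneg.2 (zero_le_one.trans hp)
  rw [phaseG, div_le_iff₀ (by linarith)]
  nlinarith

lemma le_phaseG (hw : 1 / 16 ≤ w) (hw' : w ≤ 100) (hp : 1 ≤ p) : (p - 1) / 100 ≤ phaseG w p := by
  have := inv_le_one_of_one_le₀ hp
  rw [phaseG, div_le_div_iff₀ (by norm_num) (by linarith)]
  nlinarith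

lemma phaseG_mono (hw : 1 / 16 ≤ w) (hp : 1 ≤ p) (hpq : p ≤ q) : phaseG w p ≤ phaseG w q := by
  have := inv_anti₀ (by linarith) hpq
  exact div_le_div_of_nonneg_right (by linarith) (by linarith)

lemma le_phaseG_of_le (hw : 1 / 16 ≤ w) (hw' : w ≤ 100) (hp : 1 ≤ p) (hg : 1 / 8 ≤ phaseG w p) :
    p / 25600 ≤ phaseG w p := by
  rcases le_total p 2 with h | h
  · linarith
  · have := le_phaseG hw hw' hp
    linarith

/-- Lower bound for the second derivative profile at near-stationary points, two dimensions. -/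
lemma le_abs_second_two {ε₁ ε₂ : ℝ} (hw : 1 / 16 ≤ w) (hw' : w ≤ 100) (hp₂ : 1 ≤ p₂)
    (h₁₂ : p₂ ≤ p₁) (hε₁ : ε₁ = 1 ∨ ε₁ = -1) (hε₂ : ε₂ = 1 ∨ ε₂ = -1)
    (h : |1 + ε₁ * phaseG w p₁ + ε₂ * phaseG w p₂| ≤ 1 / 2) :
    p₁ ^ 2 / 10 ^ 6 ≤ |ε₁ * (p₁ * phaseG w p₁ ^ 2) + ε₂ * (p₂ * phaseG w p₂ ^ 2)| := by
  have hp₁ := hp₂.trans h₁₂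
  have hg₁ := phaseG_nonneg hw hp₁
  have hg₂ := phaseG_nonneg hw hp₂
  have hg := phaseG_mono hw hp₂ h₁₂
  have key := le_phaseG_of_le hw hw' hp₁
  set a := phaseG w p₁
  set b := phaseG w p₂
  have hm : p₂ * b ≤ p₁ * a := by gcongr
  obtain ⟨h1, h2⟩ := abs_le.1 h
  have hpa : 1 / 8 ≤ a → p₁ ^ 2 / 25600 ≤ p₁ * a := fun h => by nlinarith [key h]
  have hpb : 0 ≤ p₂ * b := by positivity
  have hpp : 0 ≤ p₁ ^ 2 := by positivity
  rcases hε₁ with rfl | rfl <;> rcases hε₂ with rfl | rfl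
  · linarith
  · linarith
  · have ha : 1 / 2 ≤ a - b := by linarith
    have := hpa (by linarith)
    refine le_abs.2 (Or.inr ?_)
    nlinarith
  · have ha : 1 / 4 ≤ a := by linarith
    have := hpa (by linarith)
    refine le_abs.2 (Or.inr ?_)
    nlinarith

/-- Second derivative profile up to sign, three dimensions. -/
def phaseS (w σ₂ σ₃ p₁ p₂ p₃ : ℝ) : ℝ :=
  p₁ * phaseG w p₁ ^ 2 + σ₂ * (p₂ * phaseG w p₂ ^ 2) + σ₃ * (p₃ * phaseG w p₃ ^ 2)

lemma le_phaseS_pos {ε₁ σ₃ : ℝ} (hw : 1 / 16 ≤ w) (hw' : w ≤ 100) (hp₃ : 1 ≤ p₃)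
    (h₂₃ : p₃ ≤ p₂) (h₁₂ : p₂ ≤ p₁) (hε₁ : ε₁ = 1 ∨ ε₁ = -1) (hσ₃ : σ₃ = 1 ∨ σ₃ = -1)
    (h : |1 + ε₁ * (phaseG w p₁ + phaseG w p₂ + σ₃ * phaseG w p₃)| ≤ p₃ / 6400) :
    p₁ ^ 2 * p₃ / 10 ^ 10 ≤ phaseS w 1 σ₃ p₁ p₂ p₃ := by
  have hp₂ := hp₃.trans h₂₃
  have hp₁ := hp₂.trans h₁₂
  have hg₂ := phaseG_nonneg hw hp₂
  have hg₃ := phaseG_nonneg hw hp₃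
  have hg₁₂ := phaseG_mono hw hp₂ h₁₂
  have hg₂₃ := phaseG_mono hw hp₃ h₂₃
  have key := le_phaseG_of_le hw hw' hp₁
  have hlow := le_phaseG hw hw' hp₁
  rw [phaseS]
  set a := phaseG w p₁
  set b := phaseG w p₂
  set c := phaseG w p₃
  have ha : 1 / 8 ≤ a := by
    rcases le_total p₁ 20 with h20 | h20
    · obtain ⟨h1, h2⟩ := abs_le.1 h
      rcases hε₁ with rfl | rfl <;> rcases hσ₃ with rfl | rfl <;> linarith
    · linarith
  have h1 := key ha
  have h2 : p₁ * (p₁ / 25600) ^ 2 ≤ p₁ * a ^ 2 := by gcongr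
  have h3 : p₃ * c ^ 2 ≤ p₂ * b ^ 2 := by gcongr
  have h4 : p₁ ^ 2 * p₃ ≤ p₁ ^ 2 * p₁ := by gcongr; exact h₂₃.trans h₁₂
  have h5 : 0 ≤ p₁ ^ 2 * p₁ := by positivity
  have h6 : 0 ≤ p₃ * c ^ 2 := by positivity
  rcases hσ₃ with rfl | rfl <;> linarith

lemma le_phaseS_neg_pos {ε₁ : ℝ} (hw : 1 / 16 ≤ w) (hw' : w ≤ 100) (hp₃ : 1 ≤ p₃)
    (h₂₃ : p₃ ≤ p₂) (h₁₂ : p₂ ≤ p₁) (hε₁ : ε₁ = 1 ∨ ε₁ = -1)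
    (h : |1 + ε₁ * (phaseG w p₁ - phaseG w p₂ + phaseG w p₃)| ≤ p₃ / 6400) :
    p₃ ≤ 110 ∧ 1 / 5 ≤ phaseS w (-1) 1 p₁ p₂ p₃ := by
  have hp₂ := hp₃.trans h₂₃
  have hp₁ := hp₂.trans h₁₂
  have hg₂ := phaseG_nonneg hw hp₂
  have hg₃ := phaseG_nonneg hw hp₃
  have hg₁₂ := phaseG_mono hw hp₂ h₁₂
  have hlow := le_phaseG hw hw' hp₃
  have hG₁ : phaseG w p₁ ≤ 16 * p₁ := phaseG_le hw hp₁
  rw [phaseS]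
  set a := phaseG w p₁
  set b := phaseG w p₂
  set c := phaseG w p₃
  obtain ⟨h1, h2⟩ := abs_le.1 h
  rcases hε₁ with rfl | rfl
  · exfalso
    linarith
  · have h110 : p₃ ≤ 110 := by linarith
    refine ⟨h110, ?_⟩
    have h3 : p₂ * b ≤ p₁ * a := by gcongr
    have h4 : p₁ * a * (a - b) ≤ p₁ * a ^ 2 - p₂ * b ^ 2 := by nlinarith
    have h5 : 49 / 100 ≤ a - b ∨ 49 / 100 ≤ c := by
      by_contra! hcon
      linarith [hcon.1, hcon.2]
    have ha : 0 ≤ a := hg₂.trans hg₁₂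
    have h6 : a - b ≤ p₁ * a := by nlinarith
    have h7 : (a - b) ^ 2 ≤ p₁ * a * (a - b) := by
      rw [sq]
      exact mul_le_mul_of_nonneg_right h6 (by linarith)
    have h8 : c ^ 2 ≤ p₃ * c ^ 2 := le_mul_of_one_le_left (sq_nonneg c) hp₃
    have h9 := sq_nonneg (a - b)
    have h10 := sq_nonneg c
    rcases h5 with h5 | h5
    · have : (49 / 100 : ℝ) ^ 2 ≤ (a - b) ^ 2 := by gcongr
      linarith
    · have : (49 / 100 : ℝ) ^ 2 ≤ c ^ 2 := by gcongr
      linarith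

lemma mul_sq_phaseG (hw : w ≠ 0) (hp : p ≠ 0) :
    w ^ 2 * (p * phaseG w p ^ 2) = p ^ 3 - 2 * p + p⁻¹ := by
  rw [phaseG]
  field_simp
  ring

lemma le_phaseS_neg_neg {ε₁ : ℝ} (hw : 1 / 16 ≤ w) (hw' : w ≤ 100) (hp₃ : 3200 ≤ p₃)
    (h₂₃ : p₃ ≤ p₂) (h₁₂ : p₂ ≤ p₁) (hε₁ : ε₁ = 1 ∨ ε₁ = -1)
    (h : |1 + ε₁ * (phaseG w p₁ - phaseG w p₂ - phaseG w p₃)| ≤ p₃ / 6400) :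
    p₁ ^ 2 * p₃ / 10 ^ 10 ≤ phaseS w (-1) (-1) p₁ p₂ p₃ := by
  have hw0 : 0 < w := by linarith
  have hp₂ : 3200 ≤ p₂ := hp₃.trans h₂₃
  have hp₁ : 3200 ≤ p₁ := hp₂.trans h₁₂
  have i₁ := inv_nonneg.2 (show 0 ≤ p₁ by linarith)
  have i₂ := inv_le_one_of_one_le₀ (show 1 ≤ p₂ by linarith)
  have i₃ := inv_le_one_of_one_le₀ (show 1 ≤ p₃ by linarith)
  have e : w * (phaseG w p₁ - phaseG w p₂ - phaseG w p₃) =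
      (p₁ - p₁⁻¹) - (p₂ - p₂⁻¹) - (p₃ - p₃⁻¹) := by
    simp only [phaseG]
    field_simp
  have hlow : -(1 + p₃ / 6400) ≤ phaseG w p₁ - phaseG w p₂ - phaseG w p₃ := by
    obtain ⟨h1, h2⟩ := abs_le.1 h
    rcases hε₁ with rfl | rfl <;> linarith
  have h1 : w * (1 + p₃ / 6400) ≤ 100 * (1 + p₃ / 6400) := by gcongr
  have h2 : -(w * (1 + p₃ / 6400)) ≤ w * (phaseG w p₁ - phaseG w p₂ - phaseG w p₃) := by
    rw [← mul_neg]
    gcongr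
  have h3 : p₂ + 95 / 100 * p₃ ≤ p₁ := by linarith
  have hS : w ^ 2 * phaseS w (-1) (-1) p₁ p₂ p₃ =
      (p₁ ^ 3 - 2 * p₁ + p₁⁻¹) - (p₂ ^ 3 - 2 * p₂ + p₂⁻¹) - (p₃ ^ 3 - 2 * p₃ + p₃⁻¹) := by
    rw [phaseS, ← mul_sq_phaseG hw0.ne' (by linarith), ← mul_sq_phaseG hw0.ne' (by linarith),
      ← mul_sq_phaseG hw0.ne' (by linarith)]
    ring
  have h4 : 95 / 100 * p₃ * (p₁ ^ 2 + p₁ * p₂ + p₂ ^ 2) ≤ p₁ ^ 3 - p₂ ^ 3 := by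
    calc _ ≤ (p₁ - p₂) * (p₁ ^ 2 + p₁ * p₂ + p₂ ^ 2) := by
          gcongr
          linarith
      _ = _ := by ring
  have h5 : p₃ ^ 3 ≤ p₃ * p₂ ^ 2 := by
    rw [pow_succ']
    gcongr
  have h6 : p₃ * p₂ ^ 2 ≤ p₃ * p₁ ^ 2 := by gcongr
  have h7 : p₃ * p₂ ^ 2 ≤ p₃ * (p₁ * p₂) := by
    rw [sq]
    gcongr
  have h8 : 3200 * p₁ ≤ p₃ * p₁ ^ 2 := by
    have : p₃ * p₁ * 1 ≤ p₃ * p₁ * p₁ := by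
      gcongr
      linarith
    nlinarith
  have h9 : p₁ ^ 2 * p₃ / 10 ^ 5 ≤ w ^ 2 * phaseS w (-1) (-1) p₁ p₂ p₃ := by
    rw [hS]
    have hA : 0 ≤ p₃ * p₂ ^ 2 := by positivity
    linarith
  have hw2 : w ^ 2 ≤ 100 ^ 2 := by gcongr
  by_contra! hcon
  have : w ^ 2 * phaseS w (-1) (-1) p₁ p₂ p₃ ≤ 100 ^ 2 * (p₁ ^ 2 * p₃ / 10 ^ 10) :=
    (mul_le_mul_of_nonneg_left hcon.le (by positivity)).trans (by gcongr)
  have : 0 < p₁ ^ 2 * p₃ := by positivity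
  linarith

lemma le_third_neg_neg {ε₁ : ℝ} (hw : 1 / 16 ≤ w) (hw' : w ≤ 100) (hp₃ : 1 ≤ p₃)
    (h₂₃ : p₃ ≤ p₂) (h₁₂ : p₂ ≤ p₁) (hε₁ : ε₁ = 1 ∨ ε₁ = -1)
    (h : |1 + ε₁ * (phaseG w p₁ - phaseG w p₂ - phaseG w p₃)| ≤ 1 / 2)
    (hS : |phaseS w (-1) (-1) p₁ p₂ p₃| ≤ 1 / 128) :
    p₁ ^ 2 / 10 ^ 7 ≤ p₁ ^ 2 * phaseG w p₁ ^ 3 - p₂ ^ 2 * phaseG w p₂ ^ 3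
      - p₃ ^ 2 * phaseG w p₃ ^ 3 := by
  have hp₂ := hp₃.trans h₂₃
  have hp₁ := hp₂.trans h₁₂
  have hg₂ := phaseG_nonneg hw hp₂
  have hg₃ := phaseG_nonneg hw hp₃
  have hg₁₂ := phaseG_mono hw hp₂ h₁₂
  have hg₂₃ := phaseG_mono hw hp₃ h₂₃
  have key := le_phaseG_of_le hw hw' hp₁
  rw [phaseS] at hS
  set a := phaseG w p₁
  set b := phaseG w p₂
  set c := phaseG w p₃
  have ha0 : 0 ≤ a := hg₂.trans hg₁₂
  have hα₂ : p₂ * b ≤ p₁ * a := by gcongr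
  have hα₃ : p₃ * c ≤ p₁ * a := mul_le_mul (h₂₃.trans h₁₂) (hg₂₃.trans hg₁₂) hg₃ (by linarith)
  have hbb : b ≤ p₂ * b := le_mul_of_one_le_left hg₂ hp₂
  have hcc : c ≤ p₃ * c := le_mul_of_one_le_left hg₃ hp₃
  have haa : a ≤ p₁ * a := le_mul_of_one_le_left ha0 hp₁
  obtain ⟨hS1, hS2⟩ := abs_le.1 hS
  obtain ⟨h1, h2⟩ := abs_le.1 h
  have hSe : p₁ * a ^ 2 + -1 * (p₂ * b ^ 2) + -1 * (p₃ * c ^ 2) =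
    p₁ * a * (a - b - c) + (p₁ * a - p₂ * b) * b + (p₁ * a - p₃ * c) * c := by ring
  have hx : 0 ≤ (p₁ * a - p₂ * b) * b := mul_nonneg (by linarith) hg₂
  have hy : 0 ≤ (p₁ * a - p₃ * c) * c := mul_nonneg (by linarith) hg₃
  have hd : a - b - c ≤ -(1 / 2) ∧ 1 / 4 ≤ a := by
    rcases hε₁ with rfl | rfl
    · constructor <;> linarith
    · exfalso
      have : 1 / 2 * (1 / 2) ≤ p₁ * a * (a - b - c) :=
        mul_le_mul (by linarith) (by linarith) (by norm_num) (by linarith)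
      linarith
  have hα : 1 / 4 ≤ p₁ * a := hd.2.trans haa
  have hsum : 2 / 5 * (p₁ * a) ≤ (p₁ * a - p₂ * b) * b + (p₁ * a - p₃ * c) * c := by
    have : p₁ * a * (a - b - c) ≤ p₁ * a * (-(1 / 2)) :=
      mul_le_mul_of_nonneg_left hd.1 (by linarith)
    linarith
  have hone : ∀ u v : ℝ, 0 ≤ u → 0 ≤ v → u ≤ p₁ * a → 1 / 5 * (p₁ * a) ≤ u * v →
      1 / 25 * (p₁ * a) ≤ u * v * v := by
    intro u v hu hv hua huv
    have hv5 : 1 / 5 ≤ v := by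
      by_contra! hcon
      have h1 : u * v ≤ p₁ * a * v := mul_le_mul_of_nonneg_right hua hv
      have h2 : p₁ * a * v < p₁ * a * (1 / 5) := mul_lt_mul_of_pos_left hcon (by linarith)
      linarith
    have : u * v * (1 / 5) ≤ u * v * v := mul_le_mul_of_nonneg_left hv5 (mul_nonneg hu hv)
    linarith
  have hxy : 1 / 25 * (p₁ * a) ≤ (p₁ * a - p₂ * b) * b * b + (p₁ * a - p₃ * c) * c * c := by
    have hx' : 0 ≤ (p₁ * a - p₂ * b) * b * b := mul_nonneg hx hg₂
    have hy' : 0 ≤ (p₁ * a - p₃ * c) * c * c := mul_nonneg hy hg₃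
    have hpb : 0 ≤ p₂ * b := hg₂.trans hbb
    have hpc : 0 ≤ p₃ * c := hg₃.trans hcc
    rcases le_total ((p₁ * a - p₂ * b) * b) ((p₁ * a - p₃ * c) * c) with h | h
    · have := hone (p₁ * a - p₃ * c) c (by linarith) hg₃ (by linarith) (by linarith)
      linarith
    · have := hone (p₁ * a - p₂ * b) b (by linarith) hg₂ (by linarith) (by linarith)
      linarith
  have e : p₁ ^ 2 * a ^ 3 - p₂ ^ 2 * b ^ 3 - p₃ ^ 2 * c ^ 3 =
      p₁ * a * (p₁ * a ^ 2 + -1 * (p₂ * b ^ 2) + -1 * (p₃ * c ^ 2)) +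
      (p₁ * a - p₂ * b) * b * (p₂ * b) + (p₁ * a - p₃ * c) * c * (p₃ * c) := by ring
  have e1 : p₁ * a * -(1 / 128) ≤
      p₁ * a * (p₁ * a ^ 2 + -1 * (p₂ * b ^ 2) + -1 * (p₃ * c ^ 2)) :=
    mul_le_mul_of_nonneg_left hS1 (by linarith)
  have e2 : (p₁ * a - p₂ * b) * b * b ≤ (p₁ * a - p₂ * b) * b * (p₂ * b) :=
    mul_le_mul_of_nonneg_left hbb hx
  have e3 : (p₁ * a - p₃ * c) * c * c ≤ (p₁ * a - p₃ * c) * c * (p₃ * c) :=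
    mul_le_mul_of_nonneg_left hcc hy
  have e4 : p₁ * (p₁ / 25600) ≤ p₁ * a :=
    mul_le_mul_of_nonneg_left (key (by linarith)) (by linarith)
  rw [e]
  have e5 : p₁ * (p₁ / 25600) = p₁ ^ 2 / 25600 := by ring
  have e6 : 0 ≤ p₁ ^ 2 := sq_nonneg p₁
  linarith

end

/-- The inverse speed `r / √(r² - n²)`. -/
def slowness (n : ℤ) (r : ℝ) : ℝ := r / wkbRoot n r ^ 2

/-- The square root of the speed. -/
def glance (n : ℤ) (r : ℝ) : ℝ := wkbRoot n r / √r

section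
variable {n n' : ℤ} {r r' : ℝ}

lemma pos_of_abs_int_lt (hr : |(n : ℝ)| < r) : 0 < r := (abs_nonneg _).trans_lt hr

lemma slowness_pos (hr : |(n : ℝ)| < r) : 0 < slowness n r :=
  div_pos (pos_of_abs_int_lt hr) (pow_pos (wkbRoot_pos hr) 2)

lemma one_le_slowness (hr : |(n : ℝ)| < r) : 1 ≤ slowness n r :=
  (one_le_div (pow_pos (wkbRoot_pos hr) 2)).2 (wkbRoot_sq_le hr)

lemma slowness_sq_mul (hr : |(n : ℝ)| < r) : slowness n r ^ 2 * (r ^ 2 - (n : ℝ) ^ 2) = r ^ 2 := by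
  have := wkbRoot_pos hr
  rw [slowness, ← wkbRoot_pow_four hr]
  field_simp

lemma slowness_sq (hr : |(n : ℝ)| < r) : slowness n r ^ 2 = r ^ 2 / (r ^ 2 - (n : ℝ) ^ 2) := by
  rw [eq_div_iff (sq_sub_sq_pos hr).ne', slowness_sq_mul hr]

lemma slowness_anti (hr : |(n : ℝ)| < r) (h : r ≤ r') : slowness n r' ≤ slowness n r := by
  have hr' := hr.trans_le h
  refine le_of_sq_le_sq ?_ (slowness_pos hr).le
  rw [slowness_sq hr, slowness_sq hr', div_le_div_iff₀ (sq_sub_sq_pos hr') (sq_sub_sq_pos hr)]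
  have := pos_of_abs_int_lt hr
  have : r ^ 2 ≤ r' ^ 2 := by gcongr
  nlinarith [sq_nonneg (n : ℝ)]

lemma slowness_mono (hr : |(n : ℝ)| < r) (h : |(n' : ℝ)| ≤ |(n : ℝ)|) :
    slowness n' r ≤ slowness n r := by
  have hr' := h.trans_lt hr
  refine le_of_sq_le_sq ?_ (slowness_pos hr).le
  rw [slowness_sq hr, slowness_sq hr']
  have : (n' : ℝ) ^ 2 ≤ (n : ℝ) ^ 2 := sq_le_sq.2 h
  have := sq_sub_sq_pos hr
  gcongr

lemma slowness_le_four_mul (hr : |(n : ℝ)| < r) (h : |(n' : ℝ)| ≤ |(n : ℝ)|) (hrr : r ≤ r')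
    (h4 : slowness n r ≤ 4 * slowness n r') : slowness n' r ≤ 4 * slowness n' r' := by
  have hn : (n' : ℝ) ^ 2 ≤ (n : ℝ) ^ 2 := sq_le_sq.2 h
  have hr2 := hr.trans_le hrr
  have h0 := pos_of_abs_int_lt hr
  have h0' := pos_of_abs_int_lt hr2
  have e : slowness n r ^ 2 ≤ 16 * slowness n r' ^ 2 := by
    have := slowness_pos hr
    calc _ ≤ (4 * slowness n r') ^ 2 := by gcongr
      _ = _ := by ring
  have hsq : r ^ 2 ≤ r' ^ 2 := by gcongr
  refine le_of_sq_le_sq ?_ (by linarith [slowness_pos (h.trans_lt hr2)])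
  rw [mul_pow, slowness_sq (h.trans_lt hr), slowness_sq (h.trans_lt hr2), mul_div_assoc',
    div_le_div_iff₀ (sq_sub_sq_pos (h.trans_lt hr)) (sq_sub_sq_pos (h.trans_lt hr2))]
  rw [slowness_sq hr, slowness_sq hr2, mul_div_assoc', div_le_div_iff₀ (sq_sub_sq_pos hr)
    (sq_sub_sq_pos hr2)] at e
  nlinarith [mul_nonneg (sub_nonneg.2 hn) (show 0 ≤ 16 * r' ^ 2 - r ^ 2 by nlinarith)]

lemma hasDerivAt_slowness (hr : |(n : ℝ)| < r) :
    HasDerivAt (slowness n) (-((n : ℝ) ^ 2 * slowness n r ^ 3 / r ^ 3)) r := by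
  have hs := wkbRoot_pos hr
  have h0 := pos_of_abs_int_lt hr
  refine ((hasDerivAt_id' r).fun_div ((hasDerivAt_wkbRoot hr).fun_pow 2)
    (pow_pos hs 2).ne').congr_deriv ?_
  have h4 := wkbRoot_pow_four hr
  rw [slowness]
  field_simp
  push_cast
  linear_combination 2 * wkbRoot n r * h4

lemma hasDerivAt_inv_slowness (hr : |(n : ℝ)| < r) :
    HasDerivAt (fun r => wkbRoot n r ^ 2 / r) ((n : ℝ) ^ 2 * slowness n r / r ^ 3) r := by
  have hs := wkbRoot_pos hr
  have h0 := pos_of_abs_int_lt hr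
  refine (((hasDerivAt_wkbRoot hr).fun_pow 2).fun_div (hasDerivAt_id' r) h0.ne').congr_deriv ?_
  have h4 := wkbRoot_pow_four hr
  rw [slowness]
  field_simp
  push_cast
  linear_combination -2 * wkbRoot n r * h4

lemma phaseG_slowness {t : ℝ} (ht : 0 < t) (hr : |(n : ℝ)| < r) :
    phaseG (t ^ 2 / r ^ 2) (slowness n r) = (n : ℝ) ^ 2 * slowness n r / t ^ 2 := by
  have h0 := pos_of_abs_int_lt hr
  have hp := slowness_pos hr
  have h := slowness_sq_mul hr
  rw [phaseG]
  field_simp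
  linear_combination h

lemma glance_pos (hr : |(n : ℝ)| < r) : 0 < glance n r :=
  div_pos (wkbRoot_pos hr) (Real.sqrt_pos.2 (pos_of_abs_int_lt hr))

lemma glance_sq_mul (hr : |(n : ℝ)| < r) : glance n r ^ 2 * slowness n r = 1 := by
  have := wkbRoot_pos hr
  have h0 := pos_of_abs_int_lt hr
  rw [glance, slowness, div_pow, Real.sq_sqrt h0.le]
  field_simp

lemma slowness_eq (hr : |(n : ℝ)| < r) : slowness n r = (glance n r ^ 2)⁻¹ :=
  eq_inv_of_mul_eq_one_right (glance_sq_mul hr)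

lemma glance_mono (hr : |(n : ℝ)| < r) (h : r ≤ r') : glance n r ≤ glance n r' := by
  have h1 := slowness_anti hr h
  rw [slowness_eq hr, slowness_eq (hr.trans_le h)] at h1
  exact le_of_sq_le_sq ((inv_le_inv₀ (pow_pos (glance_pos (hr.trans_le h)) 2)
    (pow_pos (glance_pos hr) 2)).1 h1) (glance_pos (hr.trans_le h)).le

lemma glance_anti (hr : |(n : ℝ)| < r) (h : |(n' : ℝ)| ≤ |(n : ℝ)|) :
    glance n r ≤ glance n' r := by
  have h1 := slowness_mono hr h
  rw [slowness_eq hr, slowness_eq (h.trans_lt hr)] at h1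
  exact le_of_sq_le_sq ((inv_le_inv₀ (pow_pos (glance_pos (h.trans_lt hr)) 2)
    (pow_pos (glance_pos hr) 2)).1 h1) (glance_pos (h.trans_lt hr)).le

lemma glance_pow_four_mul (hr : |(n : ℝ)| < r) :
    glance n r ^ 4 * r ^ 2 = r ^ 2 - (n : ℝ) ^ 2 := by
  have h0 := pos_of_abs_int_lt hr
  rw [← wkbRoot_pow_four hr, glance, div_pow, show √r ^ 4 = (√r ^ 2) ^ 2 by ring,
    Real.sq_sqrt h0.le]
  field_simp

lemma continuousOn_glance {a b : ℝ} (ha : 0 < a) :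
    ContinuousOn (glance n) (Set.Icc a b) :=
  (continuousOn_wkbRoot n _).div (by fun_prop) fun r hr => by
    have : 0 < r := ha.trans_le hr.1
    positivity

/-- Blocks on which `glance` at most doubles are short. -/
lemma sub_le_of_glance_le (hr : |(n : ℝ)| < r) (hrr : r ≤ r') (h : glance n r' ≤ 2 * glance n r) :
    r' - r ≤ 16 * glance n r ^ 4 * r' := by
  have hr' := hr.trans_le hrr
  have h0 := pos_of_abs_int_lt hr
  have h0' := pos_of_abs_int_lt hr'
  have h4 := glance_pow_four_mul hr'
  have e1 : glance n r' ^ 4 ≤ 16 * glance n r ^ 4 := by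
    have := glance_pos hr'
    calc _ ≤ (2 * glance n r) ^ 4 := by gcongr
      _ = _ := by ring
  have e2 : glance n r' ^ 4 * r' ^ 2 ≤ 16 * glance n r ^ 4 * r' ^ 2 := by gcongr
  have hN := abs_nonneg (n : ℝ)
  have e3 : r' * (r' - r) ≤ r' ^ 2 - (n : ℝ) ^ 2 := by
    rw [← sq_abs (n : ℝ)]
    nlinarith
  refine le_of_mul_le_mul_left ?_ h0'
  calc _ ≤ _ := e3
    _ ≤ 16 * glance n r ^ 4 * r' ^ 2 := by linarith
    _ = _ := by ring

end

lemma integral_antitone_abs_sub_le {w : ℝ → ℝ} (hw : Continuous w)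
    (hanti : AntitoneOn w (Set.Ici 0)) (h0 : ∀ u, 0 ≤ u → 0 ≤ w u) {a b : ℝ} (hab : a ≤ b)
    (N : ℝ) : ∫ r in a..b, w |r - N| ≤ 2 * ∫ u in (0 : ℝ)..(b - a), w u := by
  set c := max a (min N b) with hc
  have hac : a ≤ c := le_max_left _ _
  have hcb : c ≤ b := max_le hab (min_le_right _ _)
  have hi : ∀ x y, IntervalIntegrable (fun r => w |r - N|) volume x y := fun x y =>
    Continuous.intervalIntegrable (by fun_prop) _ _
  have hmono : ∀ y, 0 ≤ y → y ≤ b - a → ∫ u in (0 : ℝ)..y, w u ≤ ∫ u in (0 : ℝ)..(b - a), w u := by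
    intro y hy hyb
    refine intervalIntegral.integral_mono_interval le_rfl hy hyb ?_ (hw.intervalIntegrable _ _)
    refine (ae_restrict_iff' measurableSet_Ioc).2 (Filter.Eventually.of_forall fun u hu => ?_)
    exact h0 u hu.1.le
  rw [← intervalIntegral.integral_add_adjacent_intervals (hi a c) (hi c b), two_mul]
  refine add_le_add ?_ ?_
  · refine le_trans ?_ (hmono (c - a) (by linarith) (by linarith))
    have e : ∫ u in (0 : ℝ)..(c - a), w u = ∫ r in a..c, w (c - r) := by
      rw [intervalIntegral.integral_comp_sub_left, sub_self]
    rw [e]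
    refine intervalIntegral.integral_mono_on hac (hi _ _)
      (Continuous.intervalIntegrable (by fun_prop) _ _) fun r hr => ?_
    refine hanti (Set.mem_Ici.2 (sub_nonneg.2 hr.2)) (Set.mem_Ici.2 (abs_nonneg _)) ?_
    rcases le_total a N with h | h
    · have : c ≤ N := max_le h (min_le_left _ _)
      rw [abs_sub_comm]
      exact le_trans (by linarith) (le_abs_self _)
    · have : c = a := max_eq_left ((min_le_left _ _).trans h)
      have h1 := hr.1
      have h2 := hr.2
      have : c - r = 0 := by linarith
      rw [this]
      exact abs_nonneg _
  · refine le_trans ?_ (hmono (b - c) (by linarith) (by linarith))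
    have e : ∫ u in (0 : ℝ)..(b - c), w u = ∫ r in c..b, w (r - c) := by
      rw [intervalIntegral.integral_comp_sub_right, sub_self]
    rw [e]
    refine intervalIntegral.integral_mono_on hcb (hi _ _)
      (Continuous.intervalIntegrable (by fun_prop) _ _) fun r hr => ?_
    refine hanti (Set.mem_Ici.2 (sub_nonneg.2 hr.1)) (Set.mem_Ici.2 (abs_nonneg _)) ?_
    rcases le_total N b with h | h
    · have : N ≤ c := by
        rw [hc, min_eq_left h]
        exact le_max_right _ _
      exact le_trans (by linarith) (le_abs_self _)
    · have h3 : c = b := by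
        rw [hc, min_eq_right h, max_eq_right hab]
      have h1 := hr.1
      have h2 := hr.2
      have : r - c = 0 := by linarith
      rw [this]
      exact abs_nonneg _

/-- Integrals of shifted power weights with exponent below one. -/
lemma integral_shift_rpow_le {s lam a b : ℝ} (hs0 : 0 < s) (hs : s < 1) (hl : 0 < lam)
    (hab : a ≤ b) (N : ℝ) :
    ∫ r in a..b, (|r - N| + lam) ^ (-s) ≤ 2 / (1 - s) * (b - a + lam) ^ (1 - s) := by
  have h := integral_antitone_abs_sub_le (w := fun u => (max u 0 + lam) ^ (-s)) ?_ ?_ ?_ hab N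
  · have e : ∀ r, (max |r - N| 0 + lam) ^ (-s) = (|r - N| + lam) ^ (-s) := fun r => by
      rw [max_eq_left (abs_nonneg _)]
    simp only [e] at h
    refine h.trans ?_
    have e2 : ∫ u in (0 : ℝ)..(b - a), (max u 0 + lam) ^ (-s) =
        ∫ u in (0 : ℝ)..(b - a), (u + lam) ^ (-s) :=
      intervalIntegral.integral_congr fun u hu => by
        rw [Set.uIcc_of_le (by linarith)] at hu
        simp only [max_eq_left hu.1]
    rw [e2, intervalIntegral.integral_comp_add_right (fun u => u ^ (-s)),
      integral_rpow (Or.inl (by linarith)), show -s + 1 = 1 - s by ring, zero_add,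
        div_mul_eq_mul_div,
      mul_div_assoc']
    refine div_le_div_of_nonneg_right ?_ (by linarith)
    have := Real.rpow_nonneg hl.le (1 - s)
    linarith
  · exact Continuous.rpow_const (by fun_prop) fun u => Or.inl (by positivity)
  · intro u _ v _ huv
    exact Real.rpow_le_rpow_of_nonpos (by positivity) (by gcongr) (by linarith)
  · intro u hu
    positivity

/-- Integrals of shifted power weights with exponent above one. -/
lemma integral_shift_rpow_le' {s lam a b : ℝ} (hs : 1 < s) (hl : 0 < lam)
    (hab : a ≤ b) (N : ℝ) :
    ∫ r in a..b, (|r - N| + lam) ^ (-s) ≤ 2 / (s - 1) * lam ^ (1 - s) := by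
  have h := integral_antitone_abs_sub_le (w := fun u => (max u 0 + lam) ^ (-s)) ?_ ?_ ?_ hab N
  · have e : ∀ r, (max |r - N| 0 + lam) ^ (-s) = (|r - N| + lam) ^ (-s) := fun r => by
      rw [max_eq_left (abs_nonneg _)]
    simp only [e] at h
    refine h.trans ?_
    have e2 : ∫ u in (0 : ℝ)..(b - a), (max u 0 + lam) ^ (-s) =
        ∫ u in (0 : ℝ)..(b - a), (u + lam) ^ (-s) :=
      intervalIntegral.integral_congr fun u hu => by
        rw [Set.uIcc_of_le (by linarith)] at hu
        simp only [max_eq_left hu.1]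
    rw [e2, intervalIntegral.integral_comp_add_right (fun u => u ^ (-s)),
      integral_rpow (Or.inr ⟨by linarith, fun h => ?_⟩), show -s + 1 = 1 - s by ring, zero_add]
    · have := Real.rpow_nonneg (show 0 ≤ b - a + lam by linarith) (1 - s)
      rw [← neg_div_neg_eq, neg_sub, neg_sub, div_mul_eq_mul_div, mul_div_assoc']
      refine div_le_div_of_nonneg_right ?_ (by linarith)
      linarith
    · rw [Set.uIcc_of_le (by linarith)] at h
      linarith [h.1]
  · exact Continuous.rpow_const (by fun_prop) fun u => Or.inl (by positivity)
  · intro u _ v _ huv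
    exact Real.rpow_le_rpow_of_nonpos (by positivity) (by gcongr) (by linarith)
  · intro u hu
    positivity

lemma continuous_besselMom (k : ℕ) (n : ℤ) : Continuous (besselMom k n) :=
  continuous_iff_continuousAt.2 fun r => (hasDerivAt_besselMom k n r).continuousAt

/-- The phase factor times Bessel product inside `radialOsc`. -/
def radialKer (d : ℕ) (t : ℝ) (x : Fin d → ℤ) (r : ℝ) : ℂ :=
  Complex.exp (Complex.I * ((t ^ 2 / (2 * r) + (1 + 2 * d) * r / 2 : ℝ) : ℂ)) *
    ∏ j, besselMom 0 (x j) r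

lemma radialOsc_eq (d : ℕ) (a : ℝ → ℂ) (t : ℝ) (x : Fin d → ℤ) :
    radialOsc d a t x = ∫ r in (t / 10)..(4 * t), a r * radialKer d t x r := rfl

lemma norm_radialKer (d : ℕ) (t : ℝ) (x : Fin d → ℤ) (r : ℝ) :
    ‖radialKer d t x r‖ = ∏ j, ‖besselMom 0 (x j) r‖ := by
  rw [radialKer, norm_mul, norm_exp_I_mul_ofReal', one_mul, norm_prod]

lemma continuousOn_radialKer (d : ℕ) {t : ℝ} (ht : 0 < t) (x : Fin d → ℤ) :
    ContinuousOn (radialKer d t x) (Set.Icc (t / 10) (4 * t)) := by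
  refine ContinuousOn.mul (ContinuousOn.cexp (continuousOn_const.mul
    (Complex.continuous_ofReal.comp_continuousOn (ContinuousOn.add ?_ (by fun_prop))))) ?_
  · exact continuousOn_const.div (by fun_prop) fun r hr => by
      have : 0 < r := by linarith [hr.1]
      positivity
  · exact (continuous_finsetProd _ fun j _ => continuous_besselMom 0 (x j)).continuousOn

/-- Absolute bound on a piece of the radial integral. -/
lemma BVOn.norm_integral_mul_le_of_norm_le {f g : ℝ → ℂ} {M a b : ℝ} (hf : BVOn f M a b)
    (hab : a ≤ b) {w : ℝ → ℝ} (hw : Continuous w) (h : ∀ r ∈ Set.Icc a b, ‖g r‖ ≤ w r) :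
    ‖∫ r in a..b, f r * g r‖ ≤ M * ∫ r in a..b, w r := by
  have hM := hf.nonneg hab
  obtain ⟨f', -, -, h3, -⟩ := hf
  rw [← intervalIntegral.integral_const_mul]
  refine intervalIntegral.norm_integral_le_of_norm_le hab (Filter.Eventually.of_forall
    fun r hr => ?_) (Continuous.intervalIntegrable (by fun_prop) _ _)
  rw [norm_mul]
  exact mul_le_mul (h3 r ⟨hr.1.le, hr.2⟩) (h r ⟨hr.1.le, hr.2⟩) (norm_nonneg _) hM

lemma norm_radialOsc_le_trivial (d : ℕ) {t M : ℝ} (ht : 0 < t) {a : ℝ → ℂ}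
    (ha : BVOn a M (t / 10) (4 * t)) (x : Fin d → ℤ) :
    ‖radialOsc d a t x‖ ≤ 4 * (2 * π) ^ d * M * t := by
  have hM := ha.nonneg (by linarith)
  have := ha.norm_integral_mul_le_of_norm_le (by linarith) (w := fun _ => (2 * π) ^ d)
    (g := radialKer d t x) continuous_const fun r _ => by
      rw [norm_radialKer]
      calc _ ≤ ∏ _j : Fin d, (2 * π) := Finset.prod_le_prod (fun _ _ => norm_nonneg _)
            fun j _ => norm_besselMom_le 0 (x j) r
        _ = _ := by simp
  rw [radialOsc_eq]
  refine this.trans ?_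
  rw [intervalIntegral.integral_const, smul_eq_mul]
  have h1 : 0 ≤ M * (2 * π) ^ d := by positivity
  nlinarith [mul_nonneg h1 ht.le]

/-- It suffices to bound the radial integrals for large times. -/
lemma radialOsc_bound_of_large {d : ℕ} {g : ℝ → ℝ} {T c : ℝ} (hT : 1 ≤ T) (hc : 0 < c)
    (hg : ∀ t, 1 ≤ t → t ≤ T → c ≤ g t) (hg0 : ∀ t, 1 ≤ t → 0 ≤ g t)
    (H : ∃ C > (0:ℝ), ∀ t M : ℝ, T ≤ t → ∀ a, BVOn a M (t / 10) (4 * t) → ∀ x : Fin d → ℤ,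
      ‖radialOsc d a t x‖ ≤ C * M * g t) :
    ∃ C > (0:ℝ), ∀ t M : ℝ, 1 ≤ t → ∀ a, BVOn a M (t / 10) (4 * t) → ∀ x : Fin d → ℤ,
      ‖radialOsc d a t x‖ ≤ C * M * g t := by
  obtain ⟨C, hC, h⟩ := H
  refine ⟨C + 4 * (2 * π) ^ d * T / c, by positivity, fun t M ht a ha x => ?_⟩
  have hM := ha.nonneg (by linarith)
  have hgt := hg0 t ht
  rcases le_total T t with h1 | h1
  · refine (h t M h1 a ha x).trans ?_
    have : 0 ≤ 4 * (2 * π) ^ d * T / c := by positivity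
    gcongr
    linarith
  · refine (norm_radialOsc_le_trivial d (by linarith) ha x).trans ?_
    have hcg := hg t ht h1
    calc 4 * (2 * π) ^ d * M * t ≤ 4 * (2 * π) ^ d * M * T := by gcongr
      _ = 4 * (2 * π) ^ d * T / c * M * c := by field_simp
      _ ≤ (C + 4 * (2 * π) ^ d * T / c) * M * g t := by
        gcongr
        linarith

lemma norm_bessel_le_rpow : ∃ C > (0:ℝ), ∀ (n : ℤ) (t r : ℝ), 10 ≤ t → t / 10 ≤ r →
    ‖besselMom 0 n r‖ ^ 4 ≤ C / t * (abs (r - |(n : ℝ)|) + 1)⁻¹ := by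
  obtain ⟨C, hC, h⟩ := norm_bessel_pow_four_mul_le
  refine ⟨20 * C, by positivity, fun n t r ht hr => ?_⟩
  have h1 := h n r (by linarith)
  have h2 : (abs (r - |(n : ℝ)|) + 1) / 2 ≤ max (abs (r - |(n : ℝ)|)) 1 := by
    rcases max_cases (abs (r - |(n : ℝ)|)) 1 with h | h <;> linarith
  have h0 := abs_nonneg (r - |(n : ℝ)|)
  have hr0 : 0 ≤ r := by linarith
  rw [← div_eq_mul_inv, div_div, le_div_iff₀ (by positivity)]
  have h3 : t * (abs (r - |(n : ℝ)|) + 1) ≤ 20 * (r * max (abs (r - |(n : ℝ)|)) 1) := by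
    have : t / 10 * ((abs (r - |(n : ℝ)|) + 1) / 2) ≤ r * max (abs (r - |(n : ℝ)|)) 1 := by gcongr
    linarith
  calc _ ≤ ‖besselMom 0 n r‖ ^ 4 * (20 * (r * max (abs (r - |(n : ℝ)|)) 1)) := by gcongr
    _ ≤ _ := by linarith

lemma mul_four_le (a b c d : ℝ) : a * b * c * d ≤ a ^ 4 + b ^ 4 + c ^ 4 + d ^ 4 := by
  nlinarith [sq_nonneg (a * b - c * d), sq_nonneg (a ^ 2 - b ^ 2), sq_nonneg (c ^ 2 - d ^ 2),
    sq_nonneg (a * b + c * d), sq_nonneg (a ^ 2), sq_nonneg (b ^ 2), sq_nonneg (c ^ 2),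
    sq_nonneg (d ^ 2), sq_nonneg (a ^ 2 + b ^ 2), sq_nonneg (c ^ 2 + d ^ 2)]

lemma radialOsc_bound_four {ε : ℝ} (hε : 0 < ε) (hε1 : ε < 1) :
    ∃ C > (0:ℝ), ∀ t M : ℝ, 1 ≤ t → ∀ a, BVOn a M (t / 10) (4 * t) → ∀ x : Fin 4 → ℤ,
      ‖radialOsc 4 a t x‖ ≤ C * M * (t ^ ε / t) := by
  refine radialOsc_bound_of_large (T := 10) (c := 1 / 10) (by norm_num) (by norm_num) ?_
    (fun t ht => by positivity) ?_
  · intro t ht ht10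
    have := Real.one_le_rpow ht hε.le
    exact div_le_div₀ (by positivity) this (by linarith) ht10
  obtain ⟨C, hC, h⟩ := norm_bessel_le_rpow
  refine ⟨40 * C / ε, by positivity, fun t M ht a ha x => ?_⟩
  have ht0 : 0 < t := by linarith
  have hM := ha.nonneg (by linarith)
  have hb : ∀ r ∈ Set.Icc (t / 10) (4 * t), ‖radialKer 4 t x r‖ ≤
      ∑ j : Fin 4, C / t * (abs (r - |(x j : ℝ)|) + 1) ^ (-(1 - ε)) := by
    intro r hr
    rw [norm_radialKer, Fin.prod_univ_four]
    refine (mul_four_le _ _ _ _).trans ?_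
    rw [← Fin.sum_univ_four fun j => ‖besselMom 0 (x j) r‖ ^ 4]
    refine Finset.sum_le_sum fun j _ => (h (x j) t r ht hr.1).trans ?_
    have h0 := abs_nonneg (r - |(x j : ℝ)|)
    rw [← Real.rpow_neg_one]
    gcongr
    · linarith
    · linarith
  have hi : ∀ j, Continuous fun r => C / t * (abs (r - |(x j : ℝ)|) + 1) ^ (-(1 - ε)) := fun j =>
    continuous_const.mul (Continuous.rpow_const (by fun_prop) fun u => Or.inl (by positivity))
  have := ha.norm_integral_mul_le_of_norm_le (by linarith)
    (continuous_finsetSum _ fun j _ => hi j) hb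
  rw [radialOsc_eq]
  refine this.trans ?_
  rw [intervalIntegral.integral_finsetSum fun j _ => (hi j).intervalIntegrable _ _]
  have hj : ∀ j, ∫ r in (t / 10)..(4 * t), C / t * (abs (r - |(x j : ℝ)|) + 1) ^ (-(1 - ε)) ≤
      C / t * (10 / ε * t ^ ε) := by
    intro j
    rw [intervalIntegral.integral_const_mul]
    refine mul_le_mul_of_nonneg_left ((integral_shift_rpow_le (by linarith) (by linarith) one_pos
      (by linarith) _).trans ?_) (by positivity)
    rw [sub_sub_cancel]
    have : (4 * t - t / 10 + 1) ^ ε ≤ 5 * t ^ ε := by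
      calc _ ≤ (5 * t) ^ ε := by
            refine Real.rpow_le_rpow ?_ ?_ hε.le <;> linarith
        _ = 5 ^ ε * t ^ ε := Real.mul_rpow (by norm_num) ht0.le
        _ ≤ 5 * t ^ ε := by
            gcongr
            calc (5:ℝ) ^ ε ≤ 5 ^ (1:ℝ) := Real.rpow_le_rpow_of_exponent_le (by norm_num) hε1.le
              _ = 5 := Real.rpow_one 5
    calc _ ≤ 2 / ε * (5 * t ^ ε) := by gcongr
      _ = _ := by ring
  calc _ ≤ M * ∑ _j : Fin 4, C / t * (10 / ε * t ^ ε) := by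
        gcongr with j
        exact hj j
    _ = _ := by
        simp
        ring

/-- The total phase of the radial integral after the Liouville--Green expansion. -/
def radialPhase (d : ℕ) (t : ℝ) (ε : Fin d → ℝ) (x : Fin d → ℤ) (r : ℝ) : ℝ :=
  t ^ 2 / (2 * r) + (1 + 2 * d) * r / 2 + ∑ j, ε j * besselPhase (x j) r

/-- The first derivative of `radialPhase`, and its iterated derivatives with respect to the weight
`2 t² / r³`. -/
def radialPhaseDer (d : ℕ) (t : ℝ) (ε : Fin d → ℝ) (x : Fin d → ℤ) : ℕ → ℝ → ℝ
  | 0, r => -(t ^ 2 / (2 * r ^ 2)) + (1 + 2 * d) / 2 + ∑ j, ε j * (wkbRoot (x j) r ^ 2 / r)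
  | 1, r => (1 + ∑ j, ε j * ((x j : ℝ) ^ 2 * slowness (x j) r / t ^ 2)) / 2
  | 2, r => -(∑ j, ε j * ((x j : ℝ) ^ 4 * slowness (x j) r ^ 3 / t ^ 4)) / 4
  | _, r => 3 / 8 * ∑ j, ε j * ((x j : ℝ) ^ 6 * slowness (x j) r ^ 5 / t ^ 6)

section
variable {d : ℕ} {t : ℝ} {ε : Fin d → ℝ} {x : Fin d → ℤ} {a b : ℝ}

lemma continuousOn_slowness {n : ℤ} (ha : |(n : ℝ)| < a) :
    ContinuousOn (slowness n) (Set.Icc a b) := fun _ hr =>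
  (hasDerivAt_slowness (ha.trans_le hr.1)).continuousAt.continuousWithinAt

lemma phaseOn_radialPhase (ht : 0 < t) (ha : 0 < a) (hx : ∀ j, |(x j : ℝ)| < a)
    (hb : b ≤ 4 * t) : PhaseOn (radialPhase d t ε x) (radialPhaseDer d t ε x)
      (fun r => 2 * t ^ 2 / r ^ 3) (1 / (32 * t)) 3 a b := by
  refine ⟨fun r hr => ?_, fun i hi r hr => ?_, ?_, ?_, by positivity, fun r hr => ?_⟩
  · have hr0 : 0 < r := ha.trans_le hr.1
    have h1 : HasDerivAt (fun r : ℝ => t ^ 2 / (2 * r)) (-(t ^ 2 / (2 * r ^ 2))) r := by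
      refine ((hasDerivAt_const r (t ^ 2)).fun_div ((hasDerivAt_id' r).const_mul 2)
        (by positivity)).congr_deriv ?_
      field_simp
      ring
    have h2 : HasDerivAt (fun r : ℝ => (1 + 2 * (d : ℝ)) * r / 2) ((1 + 2 * d) / 2) r := by
      refine (((hasDerivAt_id' r).const_mul _).div_const 2).congr_deriv ?_
      ring
    exact (h1.fun_add h2).fun_add (HasDerivAt.fun_sum fun j _ =>
      (hasDerivAt_besselPhase (x j) hr0).const_mul (ε j))
  · have hr0 : 0 < r := ha.trans_le hr.1
    have hxr : ∀ j, |(x j : ℝ)| < r := fun j => (hx j).trans_le hr.1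
    interval_cases i
    · have h1 : HasDerivAt (fun r : ℝ => -(t ^ 2 / (2 * r ^ 2))) (t ^ 2 / r ^ 3) r := by
        refine ((hasDerivAt_const r (t ^ 2)).fun_div (((hasDerivAt_id' r).fun_pow 2).const_mul 2)
          (by positivity)).fun_neg.congr_deriv ?_
        field_simp
        ring
      refine ((h1.add_const ((1 + 2 * (d : ℝ)) / 2)).fun_add (HasDerivAt.fun_sum fun j _ =>
        (hasDerivAt_inv_slowness (hxr j)).const_mul (ε j))).congr_deriv ?_
      simp only [radialPhaseDer, zero_add]
      have e : ∑ j, ε j * ((x j : ℝ) ^ 2 * slowness (x j) r / r ^ 3) =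
          (∑ j, ε j * ((x j : ℝ) ^ 2 * slowness (x j) r / t ^ 2)) * (t ^ 2 / r ^ 3) := by
        rw [Finset.sum_mul]
        refine Finset.sum_congr rfl fun j _ => ?_
        field_simp
      rw [e]
      ring
    · refine (((HasDerivAt.fun_sum fun j _ => (((hasDerivAt_slowness (hxr j)).const_mul
        ((x j : ℝ) ^ 2)).div_const (t ^ 2)).const_mul (ε j)).const_add 1
          ).div_const 2).congr_deriv ?_
      simp only [radialPhaseDer]
      rw [Finset.sum_div, ← Finset.sum_neg_distrib, Finset.sum_div, Finset.sum_mul]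
      refine Finset.sum_congr rfl fun j _ => ?_
      field_simp
      ring
    · refine ((HasDerivAt.fun_sum fun j _ => ((((hasDerivAt_slowness (hxr j)).fun_pow 3).const_mul
        ((x j : ℝ) ^ 4)).div_const (t ^ 4)).const_mul (ε j)).fun_neg.div_const 4).congr_deriv ?_
      simp only [radialPhaseDer]
      rw [← Finset.sum_neg_distrib, Finset.sum_div, Finset.mul_sum, Finset.sum_mul]
      refine Finset.sum_congr rfl fun j _ => ?_
      field_simp
      push_cast
      ring
  · refine continuousOn_const.mul (continuousOn_finsetSum _ fun j _ => continuousOn_const.mul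
      ((continuousOn_const.mul ((continuousOn_slowness (hx j)).pow 5)).div_const _))
  · exact continuousOn_const.div (by fun_prop) fun r hr => by
      have : 0 < r := ha.trans_le hr.1
      positivity
  · have hr0 : 0 < r := ha.trans_le hr.1
    have : r ^ 3 ≤ (4 * t) ^ 3 := by
      have := hr.2
      gcongr
      linarith
    rw [div_le_div_iff₀ (by positivity) (by positivity)]
    nlinarith

end

lemma BVOn.const_one {a b : ℝ} : BVOn (fun _ => 1) 1 a b :=
  ⟨fun _ => 0, fun _ _ => hasDerivAt_const _ _, continuousOn_const, by simp, by simp⟩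

lemma BVOn.finsetProd {ι : Type*} {f : ι → ℝ → ℂ} {M : ι → ℝ} {a b : ℝ} (hab : a ≤ b)
    (s : Finset ι) (h : ∀ j ∈ s, BVOn (f j) (M j) a b) :
    BVOn (fun r => ∏ j ∈ s, f j r) (∏ j ∈ s, (2 * M j)) a b := by
  classical
  induction s using Finset.induction_on with
  | empty => simpa using BVOn.const_one
  | insert i s hi ih =>
    simp_rw [Finset.prod_insert hi]
    exact (h i (Finset.mem_insert_self i s)).mul
      (ih fun j hj => h j (Finset.mem_insert_of_mem hj)) hab

/-- The sign attached to a Boolean. -/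
def boolSign (c : Bool) : ℝ := bif c then 1 else -1

lemma boolSign_eq (c : Bool) : boolSign c = 1 ∨ boolSign c = -1 := by
  cases c <;> simp [boolSign]

lemma boolSign_sq (c : Bool) : boolSign c ^ 2 = 1 := by
  cases c <;> simp [boolSign]

lemma radialKer_eq_sum {d : ℕ} {t r : ℝ} {x : Fin d → ℤ} (hx : ∀ j, |(x j : ℝ)| < r) :
    radialKer d t x r = ∑ c : Fin d → Bool, (∏ j, wkbAmp (boolSign (c j)) (x j) r) *
      Complex.exp (Complex.I * (radialPhase d t (fun j => boolSign (c j)) x r : ℂ)) := by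
  have h : ∀ j, besselMom 0 (x j) r = ∑ c : Bool, wkbAmp (boolSign c) (x j) r *
      Complex.exp (Complex.I * ((boolSign c * besselPhase (x j) r : ℝ) : ℂ)) := fun j => by
    rw [Fintype.sum_bool, besselMom_eq_wkbAmp (hx j)]
    rfl
  simp only [radialKer, h]
  rw [Finset.prod_univ_sum, Finset.mul_sum, Fintype.piFinset_univ]
  refine Finset.sum_congr rfl fun c _ => ?_
  rw [Finset.prod_mul_distrib, mul_left_comm, ← Complex.exp_sum, ← Complex.exp_add, radialPhase,
    ← Finset.mul_sum, ← Complex.ofReal_sum, ← mul_add, ← Complex.ofReal_add]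

/-- Bounding the radial integral on a block by its oscillatory integrals. -/
lemma norm_integral_radialKer_le (d : ℕ) {κ : ℝ} (hκ : 0 < κ) : ∃ C > (0:ℝ),
    ∀ (t a b M X : ℝ) (A : ℝ → ℂ) (x : Fin d → ℤ), 0 < t → 0 < a → a ≤ b → b ≤ 4 * t →
      BVOn A M a b →
      (∀ j, |(x j : ℝ)| < a) → (∀ j, κ * a ^ 2 ≤ wkbRoot (x j) a ^ 6) →
      (∀ c : Fin d → Bool, ∀ s, a ≤ s → s ≤ b → ‖∫ r in a..s,
        Complex.exp (Complex.I * (radialPhase d t (fun j => boolSign (c j)) x r : ℂ))‖ ≤ X) →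
      ‖∫ r in a..b, A r * radialKer d t x r‖ ≤ C * M * X * ∏ j, (wkbRoot (x j) a)⁻¹ := by
  obtain ⟨C, hC, h⟩ := bvOn_wkbAmp hκ
  refine ⟨2 ^ d * (4 * (2 * C) ^ d), by positivity, fun t a b M X A x ht ha hab hb hA hx hw
    hX => ?_⟩
  have hbv : ∀ c : Fin d → Bool, BVOn (fun r => A r * ∏ j, wkbAmp (boolSign (c j)) (x j) r)
      (2 * M * ∏ j, (2 * (C / wkbRoot (x j) a))) a b := fun c =>
    hA.mul (BVOn.finsetProd hab _ fun j _ => h (x j) a b _ (boolSign_sq _) hab (hx j) (hw j)) hab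
  have hph : ∀ c : Fin d → Bool, PhaseOn _ _ _ _ 3 a b := fun c =>
    phaseOn_radialPhase (ε := fun j => boolSign (c j)) ht ha hx hb
  have e : ∫ r in a..b, A r * radialKer d t x r = ∑ c : Fin d → Bool, ∫ r in a..b,
      (A r * ∏ j, wkbAmp (boolSign (c j)) (x j) r) *
      Complex.exp (Complex.I * (radialPhase d t (fun j => boolSign (c j)) x r : ℂ)) := by
    rw [← intervalIntegral.integral_finsetSum fun c _ => ?_]
    · refine intervalIntegral.integral_congr fun r hr => ?_
      rw [Set.uIcc_of_le hab] at hr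
      simp only [radialKer_eq_sum fun j => (hx j).trans_le hr.1, Finset.mul_sum, mul_assoc]
    · exact intervalIntegrable_of_continuousOn_Icc (((hbv c).contOn).mul (hph c).continuousOn_exp)
        le_rfl hab le_rfl
  rw [e]
  calc _ ≤ ∑ c : Fin d → Bool, 2 * (2 * M * ∏ j, (2 * (C / wkbRoot (x j) a))) * X :=
        (norm_sum_le _ _).trans (Finset.sum_le_sum fun c _ =>
          (hbv c).norm_integral_mul_le hab (hph c).continuousOn_exp fun s h1 h2 => hX c s h1 h2)
    _ = _ := by
        rw [Finset.sum_const, Finset.card_univ, Fintype.card_fun, Fintype.card_bool,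
          Fintype.card_fin, nsmul_eq_mul]
        simp_rw [div_eq_mul_inv, ← mul_assoc]
        rw [Finset.prod_mul_distrib, Finset.prod_const, Finset.card_univ, Fintype.card_fin]
        push_cast
        ring

/-- Dyadic summation over blocks on which a monotone quantity at most doubles. -/
lemma norm_integral_le_of_dyadic {g : ℝ → ℂ} {e H B : ℝ → ℝ} {a b K : ℝ} (hab : a ≤ b)
    (hg : ContinuousOn g (Set.Icc a b)) (he : ContinuousOn e (Set.Icc a b))
    (h0 : 0 < e a)
    (hB : ∀ c d, a ≤ c → c ≤ d → d ≤ b → e d ≤ 2 * e c → ‖∫ r in c..d, g r‖ ≤ B (e c))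
    (hm : MonotoneOn e (Set.Icc a b))
    (hH : ∀ y, e a ≤ y → B y ≤ H (2 * y) - H y) (hH0 : ∀ y, e a ≤ y → H y ≤ 0)
    (hK : ∀ y, e a ≤ y → B y ≤ K) : ‖∫ r in a..b, g r‖ ≤ K - H (e a) := by
  have key : ∀ k : ℕ, ∀ c, a ≤ c → c ≤ b → e b ≤ 2 ^ k * e c →
      ∃ y, e a ≤ y ∧ ‖∫ r in c..b, g r‖ ≤ H y - H (e c) + K := by
    intro k
    induction k with
    | zero =>
      intro c hac hcb h
      have hac' : e a ≤ e c := hm ⟨le_rfl, hab⟩ ⟨hac, hcb⟩ hac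
      refine ⟨e c, hac', (hB c b hac hcb le_rfl ?_).trans ?_⟩
      · rw [pow_zero, one_mul] at h
        linarith
      · linarith [hK (e c) hac']
    | succ k ih =>
      intro c hac hcb h
      have hac' : e a ≤ e c := hm ⟨le_rfl, hab⟩ ⟨hac, hcb⟩ hac
      rcases le_total (e b) (2 * e c) with h2 | h2
      · exact ⟨e c, hac', (hB c b hac hcb le_rfl h2).trans (by linarith [hK (e c) hac'])⟩
      · obtain ⟨d, hd, hde⟩ := intermediate_value_Icc hcb
          (he.mono (Set.Icc_subset_Icc hac le_rfl)) (show 2 * e c ∈ Set.Icc (e c) (e b) from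
            ⟨by linarith, h2⟩)
        obtain ⟨y, hy, hyb⟩ := ih d (hac.trans hd.1) hd.2 (by
          rw [hde]
          rw [pow_succ] at h
          linarith)
        refine ⟨y, hy, ?_⟩
        rw [← intervalIntegral.integral_add_adjacent_intervals
          (intervalIntegrable_of_continuousOn_Icc hg hac hd.1 hd.2)
          (intervalIntegrable_of_continuousOn_Icc hg (hac.trans hd.1) hd.2 le_rfl)]
        refine (norm_add_le _ _).trans ?_
        have h3 := (hB c d hac hd.1 hd.2 hde.le).trans (hH (e c) hac')
        rw [hde] at hyb
        linarith
  obtain ⟨k, hk⟩ := pow_unbounded_of_one_lt (e b / e a) (one_lt_two)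
  obtain ⟨y, hy, hyb⟩ := key k a le_rfl hab ((div_lt_iff₀ h0).1 hk).le
  linarith [hH0 y hy]

lemma slowness_le_of_glance_le {n : ℤ} {r r' : ℝ} (hr : |(n : ℝ)| < r) (hrr : r ≤ r')
    (h : glance n r' ≤ 2 * glance n r) : slowness n r ≤ 4 * slowness n r' := by
  have h1 := glance_pos hr
  have h2 := glance_pos (hr.trans_le hrr)
  rw [slowness_eq hr, slowness_eq (hr.trans_le hrr), ← div_eq_mul_inv, inv_eq_one_div,
    div_le_div_iff₀ (by positivity) (by positivity)]
  nlinarith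

namespace PhaseOn
variable {Φ : ℝ → ℝ} {f : ℕ → ℝ → ℝ} {m : ℝ → ℝ} {m0 : ℝ} {k : ℕ} {a b : ℝ}

lemma monotoneOn (h : PhaseOn Φ f m m0 (k + 1) a b) (hf : ∀ r ∈ Set.Icc a b, 0 ≤ f (k + 1) r) :
    MonotoneOn (f k) (Set.Icc a b) := by
  refine monotoneOn_of_deriv_nonneg (convex_Icc a b) (h.contOn (by omega)) (fun r hr => ?_)
    fun r hr => ?_
  · rw [interior_Icc] at hr
    exact (h.deriv k (by omega) r ⟨hr.1.le, hr.2.le⟩).differentiableAt.differentiableWithinAt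
  · rw [interior_Icc] at hr
    have hr' : r ∈ Set.Icc a b := ⟨hr.1.le, hr.2.le⟩
    rw [(h.deriv k (by omega) r hr').deriv]
    exact mul_nonneg (hf r hr') (h.weight_pos.le.trans (h.le_weight r hr'))

lemma antitoneOn (h : PhaseOn Φ f m m0 (k + 1) a b) (hf : ∀ r ∈ Set.Icc a b, f (k + 1) r ≤ 0) :
    AntitoneOn (f k) (Set.Icc a b) := by
  refine antitoneOn_of_deriv_nonpos (convex_Icc a b) (h.contOn (by omega)) (fun r hr => ?_)
    fun r hr => ?_
  · rw [interior_Icc] at hr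
    exact (h.deriv k (by omega) r ⟨hr.1.le, hr.2.le⟩).differentiableAt.differentiableWithinAt
  · rw [interior_Icc] at hr
    have hr' : r ∈ Set.Icc a b := ⟨hr.1.le, hr.2.le⟩
    rw [(h.deriv k (by omega) r hr').deriv]
    exact mul_nonpos_of_nonpos_of_nonneg (hf r hr') (h.weight_pos.le.trans (h.le_weight r hr'))

end PhaseOn

section
variable {d : ℕ} {t r : ℝ} {ε : Fin d → ℝ} {x : Fin d → ℤ}

lemma radialPhaseDer_one (ht : 0 < t) (hx : ∀ j, |(x j : ℝ)| < r) : radialPhaseDer d t ε x 1 r =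
    (1 + ∑ j, ε j * phaseG (t ^ 2 / r ^ 2) (slowness (x j) r)) / 2 := by
  simp only [radialPhaseDer, phaseG_slowness ht (hx _)]

lemma radialPhaseDer_two (ht : 0 < t) (hx : ∀ j, |(x j : ℝ)| < r) : radialPhaseDer d t ε x 2 r =
    -(∑ j, ε j * (slowness (x j) r * phaseG (t ^ 2 / r ^ 2) (slowness (x j) r) ^ 2)) / 4 := by
  simp only [radialPhaseDer, phaseG_slowness ht (hx _)]
  congr 2
  refine Finset.sum_congr rfl fun j _ => ?_
  field_simp

lemma radialPhaseDer_three (ht : 0 < t) (hx : ∀ j, |(x j : ℝ)| < r) :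
    radialPhaseDer d t ε x 3 r = 3 / 8 *
      ∑ j, ε j * (slowness (x j) r ^ 2 * phaseG (t ^ 2 / r ^ 2) (slowness (x j) r) ^ 3) := by
  simp only [phaseG_slowness ht (hx _)]
  change 3 / 8 * ∑ j, ε j * ((x j : ℝ) ^ 6 * slowness (x j) r ^ 5 / t ^ 6) = _
  congr 1
  refine Finset.sum_congr rfl fun j _ => ?_
  field_simp

lemma weight_mem (ht : 0 < t) (h1 : t / 10 ≤ r) (h2 : r ≤ 4 * t) :
    1 / 16 ≤ t ^ 2 / r ^ 2 ∧ t ^ 2 / r ^ 2 ≤ 100 := by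
  have hr : 0 < r := by linarith
  constructor
  · rw [div_le_div_iff₀ (by norm_num) (by positivity)]
    nlinarith
  · rw [div_le_iff₀ (by positivity)]
    nlinarith

end

/-- Block estimate in dimension two. -/
lemma norm_integral_block_two {S y a b : ℝ} {x : Fin 2 → ℤ} {ε : Fin 2 → ℝ} (hS : 1 ≤ S)
    (hy : 1 ≤ y) (hε : ∀ j, ε j = 1 ∨ ε j = -1) (ha : S ^ 8 / 10 ≤ a) (hab : a ≤ b)
    (hb : b ≤ 4 * S ^ 8) (h01 : |(x 1 : ℝ)| ≤ |(x 0 : ℝ)|) (hx : |(x 0 : ℝ)| < a)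
    (hE : glance (x 0) a * S = y ^ 2) (h2 : glance (x 0) b ≤ 2 * glance (x 0) a) :
    ‖∫ r in a..b, Complex.exp (Complex.I * (radialPhase 2 (S ^ 8) ε x r : ℂ))‖ ≤
      120000 * (S ^ 4 * y ^ 3) := by
  have hS0 : 0 < S := by linarith
  have hy0 : 0 < y := by linarith
  have ht : 0 < S ^ 8 := by positivity
  have ha0 : 0 < a := by linarith
  have hxj : ∀ j, |(x j : ℝ)| < a := fun j => by
    fin_cases j
    · exact hx
    · exact h01.trans_lt hx
  have hph := phaseOn_radialPhase (ε := ε) ht ha0 hxj hb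
  have hxr : ∀ r ∈ Set.Icc a b, ∀ j, |(x j : ℝ)| < r := fun r hr j => (hxj j).trans_le hr.1
  have hw : ∀ r ∈ Set.Icc a b, 1 / 16 ≤ (S ^ 8) ^ 2 / r ^ 2 ∧ (S ^ 8) ^ 2 / r ^ 2 ≤ 100 :=
    fun r hr => weight_mem ht (ha.trans hr.1) (hr.2.trans hb)
  have hp : ∀ r ∈ Set.Icc a b, 1 ≤ slowness (x 1) r ∧ slowness (x 1) r ≤ slowness (x 0) r :=
    fun r hr => ⟨one_le_slowness (hxr r hr 1), slowness_mono (hxr r hr 0) h01⟩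
  have hp1 : ∀ r ∈ Set.Icc a b, S ^ 4 / (16 * y ^ 8) ≤ slowness (x 0) r ^ 2 := fun r hr => by
    have h3 := slowness_le_of_glance_le hx hab h2
    have h4 := slowness_anti (hxr r hr 0) hr.2
    have h5 : slowness (x 0) a = S ^ 2 / y ^ 4 := by
      rw [slowness_eq hx, (eq_div_iff hS0.ne').2 hE]
      field_simp
    have h6 : S ^ 2 / (4 * y ^ 4) ≤ slowness (x 0) r := by
      have : S ^ 2 / (4 * y ^ 4) = S ^ 2 / y ^ 4 / 4 := by field_simp
      linarith
    calc S ^ 4 / (16 * y ^ 8) = (S ^ 2 / (4 * y ^ 4)) ^ 2 := by field_simp; norm_num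
      _ ≤ _ := by gcongr
  have hmono : MonotoneOn (radialPhaseDer 2 (S ^ 8) ε x 1) (Set.Icc a b) ∨
      AntitoneOn (radialPhaseDer 2 (S ^ 8) ε x 1) (Set.Icc a b) := by
    have hcmp : ∀ r ∈ Set.Icc a b, 0 ≤ slowness (x 1) r *
        phaseG ((S ^ 8) ^ 2 / r ^ 2) (slowness (x 1) r) ^ 2 ∧ slowness (x 1) r *
        phaseG ((S ^ 8) ^ 2 / r ^ 2) (slowness (x 1) r) ^ 2 ≤ slowness (x 0) r *
        phaseG ((S ^ 8) ^ 2 / r ^ 2) (slowness (x 0) r) ^ 2 := fun r hr => by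
      have h1 := hp r hr
      have h3 := phaseG_nonneg (hw r hr).1 h1.1
      have h4 := phaseG_mono (hw r hr).1 h1.1 h1.2
      have h5 : 0 < slowness (x 1) r := by linarith
      exact ⟨by positivity, mul_le_mul h1.2 (by gcongr) (by positivity) (h5.le.trans h1.2)⟩
    rcases hε 0 with h0 | h0
    · refine Or.inr ((hph.of_le (by norm_num)).antitoneOn fun r hr => ?_)
      rw [radialPhaseDer_two ht (hxr r hr), Fin.sum_univ_two, h0]
      obtain ⟨h3, h4⟩ := hcmp r hr
      rcases hε 1 with h1 | h1 <;> rw [h1] <;> linarith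
    · refine Or.inl ((hph.of_le (by norm_num)).monotoneOn fun r hr => ?_)
      rw [radialPhaseDer_two ht (hxr r hr), Fin.sum_univ_two, h0]
      obtain ⟨h3, h4⟩ := hcmp r hr
      rcases hε 1 with h1 | h1 <;> rw [h1] <;> linarith
  have hpow : (1:ℝ) ≤ y ^ 3 := one_le_pow₀ hy
  have key := norm_integral_le_of_abs_split (δ := 1 / 4) (B₁ := 120 * S ^ 4)
    (B₂ := 110000 * (S ^ 4 * y ^ 3)) hab hph.continuousOn_exp (hph.contOn (by norm_num)) hmono
    (by positivity) (by positivity) ?_ ?_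
  · refine key.trans ?_
    have : S ^ 4 * 1 ≤ S ^ 4 * y ^ 3 := by gcongr
    have : 0 < S ^ 4 * y ^ 3 := by positivity
    linarith
  · intro c e hac hce heb hP
    refine (((hph.mono hac heb).of_le (j := 0 + 1) (by norm_num)).norm_integral_exp_le hce
      (x := 12 * S ^ 4)
      (by positivity) (L := 1 / 4) (by norm_num) hP ?_).trans (by linarith)
    have : 1 / 4 * (1 / (32 * S ^ 8)) ^ (0 + 1) * (12 * S ^ 4) ^ (0 + 2) = 144 / 128 := by
      norm_num only
      field_simp
      norm_num
    rw [this]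
    norm_num
  · intro c e hac hce heb hP
    refine (((hph.mono hac heb).of_le (j := 1 + 1) (by norm_num)).norm_integral_exp_le hce
      (x := 5000 * (S ^ 4 * y ^ 3)) (by positivity) (L := S ^ 4 / (64 * 10 ^ 6 * y ^ 8))
      (by positivity) (fun r hr => ?_) ?_).trans (by linarith)
    · have hr' : r ∈ Set.Icc a b := ⟨hac.trans hr.1, hr.2.trans heb⟩
      have h1 := hP r hr
      simp only at h1
      rw [radialPhaseDer_one ht (hxr r hr'), Fin.sum_univ_two, ← add_assoc, abs_div, abs_two] at h1
      have h3 := le_abs_second_two (hw r hr').1 (hw r hr').2 (hp r hr').1 (hp r hr').2 (hε 0) (hε 1)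
        (by linarith)
      rw [radialPhaseDer_two ht (hxr r hr'), Fin.sum_univ_two, abs_div, abs_neg,
        abs_of_pos (show (0:ℝ) < 4 by norm_num)]
      have h4 := hp1 r hr'
      have h5 : S ^ 4 / (64 * 10 ^ 6 * y ^ 8) = S ^ 4 / (16 * y ^ 8) / 10 ^ 6 / 4 := by
        field_simp; norm_num
      rw [h5]
      gcongr
      refine le_trans ?_ (h3.trans_eq ?_)
      · gcongr
      · congr 1
    · have : S ^ 4 / (64 * 10 ^ 6 * y ^ 8) * (1 / (32 * S ^ 8)) ^ (1 + 1) *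
        (5000 * (S ^ 4 * y ^ 3)) ^ (1 + 2) = 5000 ^ 3 / (64 * 10 ^ 6 * 32 ^ 2) * y := by
        norm_num only
        field_simp
        norm_num
      rw [this]
      nlinarith

/-- Size of an oscillatory integral over one block in dimension three, at time `T ^ 12`. -/
def blockSize (T E₁ E₃ : ℝ) : ℝ :=
  T ^ 8 * E₁ * E₃ + T ^ 10 * E₁ ^ 2 * E₃ * (T * E₁ / ((1 + T * E₁) * (1 + 2 * (T * E₁))))

/-- A block in dimension three: on `[a, b]` the slowest factor doubles at most once. -/
structure BlockThree (T E₁ E₃ a b : ℝ) (x : Fin 3 → ℤ) (ε : Fin 3 → ℝ) : Prop where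
  one_le : 1 ≤ T
  sign : ∀ j, ε j = 1 ∨ ε j = -1
  le_left : T ^ 12 / 10 ≤ a
  le : a ≤ b
  right_le : b ≤ 4 * T ^ 12
  abs_two_le : |(x 2 : ℝ)| ≤ |(x 1 : ℝ)|
  abs_one_le : |(x 1 : ℝ)| ≤ |(x 0 : ℝ)|
  abs_lt : |(x 0 : ℝ)| < a
  glance_zero : glance (x 0) a = E₁
  glance_two : glance (x 2) a = E₃
  one_le_mul : 1 ≤ T ^ 2 * E₁
  doubling : glance (x 0) b ≤ 2 * E₁

namespace BlockThree
variable {T E₁ E₃ a b : ℝ} {x : Fin 3 → ℤ} {ε : Fin 3 → ℝ}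
  {r : ℝ}

lemma pos (h : BlockThree T E₁ E₃ a b x ε) : 0 < T := zero_lt_one.trans_le h.one_le

lemma pow_pos (h : BlockThree T E₁ E₃ a b x ε) : 0 < T ^ 12 := _root_.pow_pos h.pos 12

lemma left_pos (h : BlockThree T E₁ E₃ a b x ε) : 0 < a := by
  have := h.pow_pos
  linarith [h.le_left]

lemma abs_lt_left (h : BlockThree T E₁ E₃ a b x ε) (j : Fin 3) : |(x j : ℝ)| < a := by
  fin_cases j
  · exact h.abs_lt
  · exact h.abs_one_le.trans_lt h.abs_lt
  · exact (h.abs_two_le.trans h.abs_one_le).trans_lt h.abs_lt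

lemma abs_lt_of_mem (h : BlockThree T E₁ E₃ a b x ε) (hr : r ∈ Set.Icc a b) (j : Fin 3) :
    |(x j : ℝ)| < r :=
  (h.abs_lt_left j).trans_le hr.1

lemma phaseOn (h : BlockThree T E₁ E₃ a b x ε) :
    PhaseOn (radialPhase 3 (T ^ 12) ε x) (radialPhaseDer 3 (T ^ 12) ε x)
    (fun r => 2 * (T ^ 12) ^ 2 / r ^ 3) (1 / (32 * T ^ 12)) 3 a b :=
  phaseOn_radialPhase h.pow_pos h.left_pos h.abs_lt_left h.right_le

lemma weight (h : BlockThree T E₁ E₃ a b x ε) (hr : r ∈ Set.Icc a b) :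
    1 / 16 ≤ (T ^ 12) ^ 2 / r ^ 2 ∧ (T ^ 12) ^ 2 / r ^ 2 ≤ 100 :=
  weight_mem h.pow_pos (h.le_left.trans hr.1) (hr.2.trans h.right_le)

lemma one_le_slow (h : BlockThree T E₁ E₃ a b x ε) (hr : r ∈ Set.Icc a b) : 1 ≤ slowness (x 2) r :=
  one_le_slowness (h.abs_lt_of_mem hr 2)

lemma slow_two_le (h : BlockThree T E₁ E₃ a b x ε) (hr : r ∈ Set.Icc a b) :
    slowness (x 2) r ≤ slowness (x 1) r :=
  slowness_mono (h.abs_lt_of_mem hr 1) h.abs_two_le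

lemma slow_one_le (h : BlockThree T E₁ E₃ a b x ε) (hr : r ∈ Set.Icc a b) :
    slowness (x 1) r ≤ slowness (x 0) r :=
  slowness_mono (h.abs_lt_of_mem hr 0) h.abs_one_le

lemma pos_one (h : BlockThree T E₁ E₃ a b x ε) : 0 < E₁ := h.glance_zero ▸ glance_pos h.abs_lt

lemma pos_three (h : BlockThree T E₁ E₃ a b x ε) : 0 < E₃ :=
  h.glance_two ▸ glance_pos (h.abs_lt_left 2)

lemma one_le_three (h : BlockThree T E₁ E₃ a b x ε) : E₁ ≤ E₃ := by
  rw [← h.glance_zero, ← h.glance_two]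
  exact glance_anti h.abs_lt (h.abs_two_le.trans h.abs_one_le)

lemma slow_zero_left (h : BlockThree T E₁ E₃ a b x ε) : slowness (x 0) a = 1 / E₁ ^ 2 := by
  rw [slowness_eq h.abs_lt, h.glance_zero, one_div]

lemma slow_two_left (h : BlockThree T E₁ E₃ a b x ε) : slowness (x 2) a = 1 / E₃ ^ 2 := by
  rw [slowness_eq (h.abs_lt_left 2), h.glance_two, one_div]

lemma slow_zero_le (h : BlockThree T E₁ E₃ a b x ε) (hr : r ∈ Set.Icc a b) :
    slowness (x 0) r ≤ 1 / E₁ ^ 2 :=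
  (slowness_anti h.abs_lt hr.1).trans_eq h.slow_zero_left

lemma slow_zero_left_le (h : BlockThree T E₁ E₃ a b x ε) (hr : r ∈ Set.Icc a b) :
    slowness (x 0) a ≤ 4 * slowness (x 0) r := by
  have h1 := slowness_le_of_glance_le h.abs_lt h.le (h.glance_zero.symm ▸ h.doubling)
  have h2 := slowness_anti (h.abs_lt_of_mem hr 0) hr.2
  linarith

lemma le_slow_zero (h : BlockThree T E₁ E₃ a b x ε) (hr : r ∈ Set.Icc a b) :
    1 / (4 * E₁ ^ 2) ≤ slowness (x 0) r := by
  have h1 := h.slow_zero_left_le hr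
  have : 1 / (4 * E₁ ^ 2) = 1 / E₁ ^ 2 / 4 := by
    have := h.pos_one
    field_simp
  rw [this, ← h.slow_zero_left]
  linarith

lemma le_slow_two (h : BlockThree T E₁ E₃ a b x ε) (hr : r ∈ Set.Icc a b) :
    1 / (4 * E₃ ^ 2) ≤ slowness (x 2) r := by
  have h1 := slowness_le_four_mul h.abs_lt (h.abs_two_le.trans h.abs_one_le) hr.1
    (h.slow_zero_left_le hr)
  have : 1 / (4 * E₃ ^ 2) = 1 / E₃ ^ 2 / 4 := by
    have := h.pos_three
    field_simp
  rw [this, ← h.slow_two_left]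
  linarith

lemma sign_mul (h : BlockThree T E₁ E₃ a b x ε) (j : Fin 3) : ε j = ε 0 * (ε 0 * ε j) := by
  rcases h.sign 0 with h0 | h0 <;> rw [h0] <;> ring

lemma der_one (h : BlockThree T E₁ E₃ a b x ε) (hr : r ∈ Set.Icc a b) :
    radialPhaseDer 3 (T ^ 12) ε x 1 r =
    (1 + ε 0 * (phaseG ((T ^ 12) ^ 2 / r ^ 2) (slowness (x 0) r) +
      ε 0 * ε 1 * phaseG ((T ^ 12) ^ 2 / r ^ 2) (slowness (x 1) r) +
      ε 0 * ε 2 * phaseG ((T ^ 12) ^ 2 / r ^ 2) (slowness (x 2) r))) / 2 := by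
  rw [radialPhaseDer_one h.pow_pos (h.abs_lt_of_mem hr), Fin.sum_univ_three]
  rw [h.sign_mul 1, h.sign_mul 2]
  rcases h.sign 0 with h0 | h0 <;> rw [h0] <;> ring

lemma der_two (h : BlockThree T E₁ E₃ a b x ε) (hr : r ∈ Set.Icc a b) :
    radialPhaseDer 3 (T ^ 12) ε x 2 r =
    -(ε 0 * phaseS ((T ^ 12) ^ 2 / r ^ 2) (ε 0 * ε 1) (ε 0 * ε 2) (slowness (x 0) r)
      (slowness (x 1) r) (slowness (x 2) r)) / 4 := by
  rw [radialPhaseDer_two h.pow_pos (h.abs_lt_of_mem hr), Fin.sum_univ_three, phaseS]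
  rw [h.sign_mul 1, h.sign_mul 2]
  rcases h.sign 0 with h0 | h0 <;> rw [h0] <;> ring

lemma abs_sign_zero (h : BlockThree T E₁ E₃ a b x ε) : |ε 0| = 1 := by
  rcases h.sign 0 with h0 | h0 <;> rw [h0] <;> simp

lemma abs_der_two (h : BlockThree T E₁ E₃ a b x ε) (hr : r ∈ Set.Icc a b) :
    |radialPhaseDer 3 (T ^ 12) ε x 2 r| =
    |phaseS ((T ^ 12) ^ 2 / r ^ 2) (ε 0 * ε 1) (ε 0 * ε 2) (slowness (x 0) r)
      (slowness (x 1) r) (slowness (x 2) r)| / 4 := by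
  rw [h.der_two hr, abs_div, abs_neg, abs_mul, h.abs_sign_zero, one_mul,
    abs_of_pos (show (0 : ℝ) < 4 by norm_num)]

lemma norm_integral_le_length (h : BlockThree T E₁ E₃ a b x ε) {c e : ℝ} (hac : a ≤ c) (hce : c ≤ e)
    (heb : e ≤ b) :
    ‖∫ r in c..e, Complex.exp (Complex.I * (radialPhase 3 (T ^ 12) ε x r : ℂ))‖ ≤
      64 * (E₁ ^ 4 * T ^ 12) := by
  have h1 := sub_le_of_glance_le h.abs_lt h.le (h.glance_zero.symm ▸ h.doubling)
  rw [h.glance_zero] at h1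
  have h2 := intervalIntegral.norm_integral_le_of_norm_le_const (C := 1) (a := c) (b := e)
    (f := fun r => Complex.exp (Complex.I * (radialPhase 3 (T ^ 12) ε x r : ℂ)))
    fun r _ => (norm_exp_I_mul_ofReal' _).le
  rw [abs_of_nonneg (by linarith), one_mul] at h2
  have h3 : 16 * E₁ ^ 4 * b ≤ 16 * E₁ ^ 4 * (4 * T ^ 12) := by
    have := h.right_le
    gcongr
  linarith

/-- van der Corput bound on the part of a block where the first derivative is large. -/
lemma bound_first (h : BlockThree T E₁ E₃ a b x ε) : IntegralBoundOn
    (fun r => Complex.exp (Complex.I * (radialPhase 3 (T ^ 12) ε x r : ℂ))) a b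
    (fun r => 1 / (51200 * E₃ ^ 2) ≤ |radialPhaseDer 3 (T ^ 12) ε x 1 r|)
    (20000 * (T ^ 6 * E₃)) := by
  intro c e hac hce heb hP
  have := h.pos
  have := h.pos_three
  refine (((h.phaseOn.mono hac heb).of_le (j := 0 + 1) (by norm_num)).norm_integral_exp_le hce
    (x := 2000 * (T ^ 6 * E₃)) (by positivity) (L := 1 / (51200 * E₃ ^ 2)) (by positivity)
    hP ?_).trans (by linarith)
  have : 1 / (51200 * E₃ ^ 2) * (1 / (32 * T ^ 12)) ^ (0 + 1) * (2000 * (T ^ 6 * E₃)) ^ (0 + 2) =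
      4000000 / 1638400 := by
    norm_num only
    field_simp
    norm_num
  rw [this]
  norm_num

/-- van der Corput bound on the part of a block where the second derivative is as large as
possible. -/
lemma bound_second (h : BlockThree T E₁ E₃ a b x ε) : IntegralBoundOn
    (fun r => Complex.exp (Complex.I * (radialPhase 3 (T ^ 12) ε x r : ℂ))) a b
    (fun r => slowness (x 0) r ^ 2 * slowness (x 2) r / (4 * 10 ^ 10) ≤
      |radialPhaseDer 3 (T ^ 12) ε x 2 r|) (4400000 * (T ^ 8 * E₁ * E₃)) := by
  intro c e hac hce heb hP
  have := h.pos
  have h1 := h.pos_one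
  have := h.pos_three
  refine (((h.phaseOn.mono hac heb).of_le (j := 1 + 1) (by norm_num)).norm_integral_exp_le hce
    (x := 200000 * (T ^ 8 * E₁ * E₃)) (by positivity) (L := 1 / (256 * 10 ^ 10 * E₁ ^ 4 * E₃ ^ 2))
    (by positivity) (fun r hr => ?_) ?_).trans (by linarith)
  · have hr' : r ∈ Set.Icc a b := ⟨hac.trans hr.1, hr.2.trans heb⟩
    refine le_trans ?_ (hP r hr)
    have h2 := h.le_slow_zero hr'
    have h3 := h.le_slow_two hr'
    calc 1 / (256 * 10 ^ 10 * E₁ ^ 4 * E₃ ^ 2)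
        = (1 / (4 * E₁ ^ 2)) ^ 2 * (1 / (4 * E₃ ^ 2)) / (4 * 10 ^ 10) := by
          field_simp; norm_num
      _ ≤ _ := by gcongr
  · have : 1 / (256 * 10 ^ 10 * E₁ ^ 4 * E₃ ^ 2) * (1 / (32 * T ^ 12)) ^ (1 + 1) *
        (200000 * (T ^ 8 * E₁ * E₃)) ^ (1 + 2) =
        200000 ^ 3 / (256 * 10 ^ 10 * 1024) * (E₃ / E₁) := by
      norm_num only
      field_simp
      norm_num
    rw [this]
    have : 1 ≤ E₃ / E₁ := (one_le_div h1).2 h.one_le_three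
    linarith

/-- van der Corput bound on the part of a block where the second derivative is bounded below. -/
lemma bound_second_const (h : BlockThree T E₁ E₃ a b x ε) : IntegralBoundOn
    (fun r => Complex.exp (Complex.I * (radialPhase 3 (T ^ 12) ε x r : ℂ))) a b
    (fun r => 1 / 32768 ≤ |radialPhaseDer 3 (T ^ 12) ε x 2 r|) (7260 * T ^ 8) := by
  intro c e hac hce heb hP
  have := h.pos
  refine (((h.phaseOn.mono hac heb).of_le (j := 1 + 1) (by norm_num)).norm_integral_exp_le hce
    (x := 330 * T ^ 8) (by positivity) (L := 1 / 32768) (by positivity) hP ?_).trans (by linarith)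
  have : 1 / 32768 * (1 / (32 * T ^ 12)) ^ (1 + 1) * (330 * T ^ 8) ^ (1 + 2) =
      330 ^ 3 / (32768 * 1024) := by
    norm_num only
    field_simp
    norm_num
  rw [this]
  norm_num

/-- van der Corput bound on the part of a block where only the third derivative is large. -/
lemma bound_third (h : BlockThree T E₁ E₃ a b x ε) : IntegralBoundOn
    (fun r => Complex.exp (Complex.I * (radialPhase 3 (T ^ 12) ε x r : ℂ))) a b
    (fun r => 3 / 8 * (slowness (x 0) r ^ 2 / 10 ^ 7) ≤ |radialPhaseDer 3 (T ^ 12) ε x 3 r|)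
    (96600 * (T ^ 9 * E₁)) := by
  intro c e hac hce heb hP
  have := h.pos
  have h1 := h.pos_one
  refine (((h.phaseOn.mono hac heb).of_le (j := 2 + 1) (by norm_num)).norm_integral_exp_le hce
    (x := 2100 * (T ^ 9 * E₁)) (by positivity) (L := 1 / (5 * 10 ^ 8 * E₁ ^ 4))
    (by positivity) (fun r hr => ?_) ?_).trans (by linarith)
  · have hr' : r ∈ Set.Icc a b := ⟨hac.trans hr.1, hr.2.trans heb⟩
    refine le_trans ?_ (hP r hr)
    have h2 := h.le_slow_zero hr'
    calc 1 / (5 * 10 ^ 8 * E₁ ^ 4) ≤ 3 / 8 * ((1 / (4 * E₁ ^ 2)) ^ 2 / 10 ^ 7) := by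
          have : 3 / 8 * ((1 / (4 * E₁ ^ 2)) ^ 2 / 10 ^ 7) =
            3 / (128 * 10 ^ 7) * (1 / E₁ ^ 4) := by field_simp; norm_num
          have h3 : 1 / (5 * 10 ^ 8 * E₁ ^ 4) = 1 / (5 * 10 ^ 8) * (1 / E₁ ^ 4) := by field_simp
          have h4 : 0 ≤ 1 / E₁ ^ 4 := by positivity
          rw [this, h3]
          linarith
      _ ≤ _ := by gcongr
  · have : 1 / (5 * 10 ^ 8 * E₁ ^ 4) * (1 / (32 * T ^ 12)) ^ (2 + 1) *
        (2100 * (T ^ 9 * E₁)) ^ (2 + 2) = 2100 ^ 4 / (5 * 10 ^ 8 * 32 ^ 3) := by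
      norm_num only
      field_simp
      norm_num
    rw [this]
    norm_num

lemma first_le (h : BlockThree T E₁ E₃ a b x ε) : T ^ 6 * E₃ ≤ blockSize T E₁ E₃ := by
  have := h.pos
  have := h.pos_one
  have := h.pos_three
  have h1 : T ^ 6 * E₃ * 1 ≤ T ^ 6 * E₃ * (T ^ 2 * E₁) := by gcongr; exact h.one_le_mul
  have h2 : 0 ≤ T ^ 10 * E₁ ^ 2 * E₃ * (T * E₁ / ((1 + T * E₁) * (1 + 2 * (T * E₁)))) := by
    positivity
  have h3 : T ^ 6 * E₃ * (T ^ 2 * E₁) = T ^ 8 * E₁ * E₃ := by ring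
  rw [blockSize]
  linarith

lemma second_le (h : BlockThree T E₁ E₃ a b x ε) : T ^ 8 * E₁ * E₃ ≤ blockSize T E₁ E₃ := by
  have := h.pos
  have := h.pos_one
  have := h.pos_three
  have h2 : 0 ≤ T ^ 10 * E₁ ^ 2 * E₃ * (T * E₁ / ((1 + T * E₁) * (1 + 2 * (T * E₁)))) := by
    positivity
  rw [blockSize]
  linarith

lemma min_le (h : BlockThree T E₁ E₃ a b x ε) {z : ℝ} (h₃ : 1 / 114 ≤ E₃)
    (hz : z ≤ 100000 * (T ^ 8 + T ^ 9 * E₁))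
    (hz' : z ≤ 64 * (E₁ ^ 4 * T ^ 12)) : z ≤ 2 * 10 ^ 8 * blockSize T E₁ E₃ := by
  have hT := h.pos
  have h1 := h.pos_one
  have := h.pos_three
  set u := T * E₁ with hu
  have hu0 : 0 < u := by positivity
  have key : z ≤ 1200000 * T ^ 8 * (u ^ 3 / ((1 + u) * (1 + 2 * u))) := by
    rcases le_total u 1 with h2 | h2
    · have h4 : u ^ 3 / 6 ≤ u ^ 3 / ((1 + u) * (1 + 2 * u)) := by
        gcongr
        nlinarith
      have h5 : u ^ 4 ≤ u ^ 3 := pow_le_pow_of_le_one hu0.le h2 (by norm_num)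
      have h6 : E₁ ^ 4 * T ^ 12 = T ^ 8 * u ^ 4 := by rw [hu]; ring
      have h7 : T ^ 8 * u ^ 4 ≤ T ^ 8 * (6 * (u ^ 3 / ((1 + u) * (1 + 2 * u)))) := by
        gcongr
        linarith
      have h8 : 0 ≤ T ^ 8 * u ^ 4 := by positivity
      linarith
    · have h4 : u / 6 ≤ u ^ 3 / ((1 + u) * (1 + 2 * u)) := by
        rw [div_le_div_iff₀ (by norm_num) (by positivity)]
        have : (1 + u) * (1 + 2 * u) ≤ 6 * u ^ 2 := by nlinarith
        calc u * ((1 + u) * (1 + 2 * u)) ≤ u * (6 * u ^ 2) := by gcongr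
          _ = _ := by ring
      have h6 : T ^ 8 + T ^ 9 * E₁ = T ^ 8 * (1 + u) := by rw [hu]; ring
      have h7 : T ^ 8 * (1 + u) ≤ T ^ 8 * (12 * (u ^ 3 / ((1 + u) * (1 + 2 * u)))) := by
        gcongr
        linarith
      rw [h6] at hz
      linarith
  refine key.trans ?_
  have h4 : T ^ 8 * (u ^ 3 / ((1 + u) * (1 + 2 * u))) / 114 ≤ blockSize T E₁ E₃ := by
    have h5 : T ^ 8 * (u ^ 3 / ((1 + u) * (1 + 2 * u))) * (1 / 114) ≤
      T ^ 8 * (u ^ 3 / ((1 + u) * (1 + 2 * u))) * E₃ := by gcongr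
    have h6 : T ^ 8 * (u ^ 3 / ((1 + u) * (1 + 2 * u))) * E₃ =
      T ^ 10 * E₁ ^ 2 * E₃ * (u / ((1 + u) * (1 + 2 * u))) := by
      rw [hu]
      field_simp
    have h7 : 0 ≤ T ^ 8 * E₁ * E₃ := by positivity
    rw [blockSize, ← hu]
    linarith
  have h5 : 0 ≤ T ^ 8 * (u ^ 3 / ((1 + u) * (1 + 2 * u))) := by positivity
  linarith

end BlockThree

lemma IntegralBoundOn.sub_interval {a b c e : ℝ} {P : ℝ → Prop} {B : ℝ} {g : ℝ → ℂ}
    (H : IntegralBoundOn g a b P B) (hac : a ≤ c) (heb : e ≤ b) : IntegralBoundOn g c e P B :=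
  fun c' e' h1 h2 h3 hP => H c' e' (hac.trans h1) h2 (h3.trans heb) hP

namespace BlockThree
variable {T E₁ E₃ a b : ℝ} {x : Fin 3 → ℤ} {ε : Fin 3 → ℝ}
  {r : ℝ}

/-- Reduction to the zone of small first derivative on an interval of monotonicity. -/
lemma norm_integral_le_of_zone (h : BlockThree T E₁ E₃ a b x ε) {c e B : ℝ} (hac : a ≤ c)
    (hce : c ≤ e) (heb : e ≤ b)
    (hm : MonotoneOn (radialPhaseDer 3 (T ^ 12) ε x 1) (Set.Icc c e) ∨
      AntitoneOn (radialPhaseDer 3 (T ^ 12) ε x 1) (Set.Icc c e))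
    (hB : 0 ≤ B) (hz : IntegralBoundOn
    (fun r => Complex.exp (Complex.I * (radialPhase 3 (T ^ 12) ε x r : ℂ))) c e
    (fun r => |radialPhaseDer 3 (T ^ 12) ε x 1 r| ≤ 1 / (51200 * E₃ ^ 2)) B) :
    ‖∫ r in c..e, Complex.exp (Complex.I * (radialPhase 3 (T ^ 12) ε x r : ℂ))‖ ≤
      40000 * blockSize T E₁ E₃ + B := by
  have hph := h.phaseOn.mono hac heb
  have := h.pos
  have := h.pos_three
  have key := norm_integral_le_of_abs_split (δ := 1 / (51200 * E₃ ^ 2))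
    (B₁ := 20000 * (T ^ 6 * E₃)) hce
    hph.continuousOn_exp (hph.contOn (by norm_num)) hm (by positivity) hB
    (h.bound_first.sub_interval hac heb) hz
  linarith [h.first_le]

lemma abs_der_one_le (h : BlockThree T E₁ E₃ a b x ε) (hr : r ∈ Set.Icc a b)
    (hz : |radialPhaseDer 3 (T ^ 12) ε x 1 r| ≤ 1 / (51200 * E₃ ^ 2)) :
    |1 + ε 0 * (phaseG ((T ^ 12) ^ 2 / r ^ 2) (slowness (x 0) r) +
      ε 0 * ε 1 * phaseG ((T ^ 12) ^ 2 / r ^ 2) (slowness (x 1) r) +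
      ε 0 * ε 2 * phaseG ((T ^ 12) ^ 2 / r ^ 2) (slowness (x 2) r))| ≤
      slowness (x 2) r / 6400 ∧
    |1 + ε 0 * (phaseG ((T ^ 12) ^ 2 / r ^ 2) (slowness (x 0) r) +
      ε 0 * ε 1 * phaseG ((T ^ 12) ^ 2 / r ^ 2) (slowness (x 1) r) +
      ε 0 * ε 2 * phaseG ((T ^ 12) ^ 2 / r ^ 2) (slowness (x 2) r))| ≤
      1 / (25600 * E₃ ^ 2) := by
  have h3 := h.pos_three
  rw [h.der_one hr, abs_div, abs_two, div_le_iff₀ (by norm_num)] at hz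
  have h1 := h.le_slow_two hr
  have h4 : 1 / (51200 * E₃ ^ 2) * 2 = 1 / (25600 * E₃ ^ 2) := by field_simp; norm_num
  have h5 : 1 / (25600 * E₃ ^ 2) = 1 / (4 * E₃ ^ 2) / 6400 := by field_simp; norm_num
  rw [h4] at hz
  refine ⟨hz.trans ?_, hz⟩
  rw [h5]
  gcongr

lemma pf_nonneg (h : BlockThree T E₁ E₃ a b x ε) (hr : r ∈ Set.Icc a b) :
    0 ≤ slowness (x 2) r * phaseG ((T ^ 12) ^ 2 / r ^ 2) (slowness (x 2) r) ^ 2 ∧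
    slowness (x 2) r * phaseG ((T ^ 12) ^ 2 / r ^ 2) (slowness (x 2) r) ^ 2 ≤
      slowness (x 1) r * phaseG ((T ^ 12) ^ 2 / r ^ 2) (slowness (x 1) r) ^ 2 ∧
    slowness (x 1) r * phaseG ((T ^ 12) ^ 2 / r ^ 2) (slowness (x 1) r) ^ 2 ≤
      slowness (x 0) r * phaseG ((T ^ 12) ^ 2 / r ^ 2) (slowness (x 0) r) ^ 2 := by
  have hw := (h.weight hr).1
  have h2 := h.one_le_slow hr
  have h1 := h.slow_two_le hr
  have h0 := h.slow_one_le hr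
  have g2 := phaseG_nonneg hw h2
  have g1 := phaseG_nonneg hw (h2.trans h1)
  have := phaseG_mono hw h2 h1
  have := phaseG_mono hw (h2.trans h1) h0
  refine ⟨by positivity, mul_le_mul h1 (by gcongr) (by positivity) (by linarith),
    mul_le_mul h0 (by gcongr) (by positivity) (by linarith)⟩

lemma monotone_or_antitone (h : BlockThree T E₁ E₃ a b x ε) {c e : ℝ} (hac : a ≤ c) (heb : e ≤ b)
    (hS : (∀ r ∈ Set.Icc c e, 0 ≤ phaseS ((T ^ 12) ^ 2 / r ^ 2) (ε 0 * ε 1) (ε 0 * ε 2)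
      (slowness (x 0) r) (slowness (x 1) r) (slowness (x 2) r)) ∨
      (∀ r ∈ Set.Icc c e, phaseS ((T ^ 12) ^ 2 / r ^ 2) (ε 0 * ε 1) (ε 0 * ε 2)
      (slowness (x 0) r) (slowness (x 1) r) (slowness (x 2) r) ≤ 0)) :
    MonotoneOn (radialPhaseDer 3 (T ^ 12) ε x 1) (Set.Icc c e) ∨
      AntitoneOn (radialPhaseDer 3 (T ^ 12) ε x 1) (Set.Icc c e) := by
  have hph := (h.phaseOn.mono hac heb).of_le (j := 1 + 1) (by norm_num)
  rcases h.sign 0 with h0 | h0 <;> rcases hS with hS | hS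
  · refine Or.inr (hph.antitoneOn fun r hr => ?_)
    rw [h.der_two ⟨hac.trans hr.1, hr.2.trans heb⟩]
    have := hS r hr
    rw [h0] at this ⊢
    linarith
  · refine Or.inl (hph.monotoneOn fun r hr => ?_)
    rw [h.der_two ⟨hac.trans hr.1, hr.2.trans heb⟩]
    have := hS r hr
    rw [h0] at this ⊢
    linarith
  · refine Or.inl (hph.monotoneOn fun r hr => ?_)
    rw [h.der_two ⟨hac.trans hr.1, hr.2.trans heb⟩]
    have := hS r hr
    rw [h0] at this ⊢
    linarith
  · refine Or.inr (hph.antitoneOn fun r hr => ?_)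
    rw [h.der_two ⟨hac.trans hr.1, hr.2.trans heb⟩]
    have := hS r hr
    rw [h0] at this ⊢
    linarith

lemma sign_mul_self (h : BlockThree T E₁ E₃ a b x ε) (j : Fin 3) :
    ε 0 * ε j = 1 ∨ ε 0 * ε j = -1 := by
  rcases h.sign 0 with h0 | h0 <;> rcases h.sign j with h1 | h1 <;> rw [h0, h1] <;> norm_num

lemma blockSize_pos (h : BlockThree T E₁ E₃ a b x ε) : 0 < blockSize T E₁ E₃ := by
  have := h.pos
  have := h.pos_three
  exact lt_of_lt_of_le (by positivity) h.first_le

lemma inv_le_three_of_slow_le (h : BlockThree T E₁ E₃ a b x ε) (hr : r ∈ Set.Icc a b)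
    (hs : slowness (x 2) r ≤ 3240) :
    1 / 114 ≤ E₃ := by
  have h3 := h.pos_three
  have h1 := (h.le_slow_two hr).trans hs
  rw [div_le_iff₀ (by positivity)] at h1
  nlinarith

lemma norm_integral_le_pos (h : BlockThree T E₁ E₃ a b x ε) (h01 : ε 0 * ε 1 = 1) :
    ‖∫ r in a..b, Complex.exp (Complex.I * (radialPhase 3 (T ^ 12) ε x r : ℂ))‖ ≤
      5 * 10 ^ 6 * blockSize T E₁ E₃ := by
  have hpos := h.pos
  have h1 := h.pos_one
  have h3 := h.pos_three
  have := h.norm_integral_le_of_zone (B := 4400000 * (T ^ 8 * E₁ * E₃)) le_rfl h.le le_rfl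
    (h.monotone_or_antitone le_rfl le_rfl (Or.inl fun r hr => ?_)) (by positivity) ?_
  · linarith [h.second_le, h.blockSize_pos]
  · obtain ⟨h1, h2, h3⟩ := h.pf_nonneg hr
    rw [phaseS, h01]
    rcases h.sign_mul_self 2 with h4 | h4 <;> rw [h4] <;> linarith
  · intro c e hac hce heb hP
    refine h.bound_second c e hac hce heb fun r hr => ?_
    have hr' : r ∈ Set.Icc a b := ⟨hac.trans hr.1, hr.2.trans heb⟩
    have hz := (h.abs_der_one_le hr' (hP r hr)).1
    rw [h01, one_mul] at hz
    have key := le_phaseS_pos (h.weight hr').1 (h.weight hr').2 (h.one_le_slow hr')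
      (h.slow_two_le hr') (h.slow_one_le hr') (h.sign 0) (h.sign_mul_self 2) hz
    simp only
    rw [h.abs_der_two hr', h01]
    have := key.trans (le_abs_self _)
    linarith

lemma norm_integral_le_neg_pos (h : BlockThree T E₁ E₃ a b x ε) (h01 : ε 0 * ε 1 = -1)
    (h02 : ε 0 * ε 2 = 1) :
    ‖∫ r in a..b, Complex.exp (Complex.I * (radialPhase 3 (T ^ 12) ε x r : ℂ))‖ ≤
      3 * 10 ^ 8 * blockSize T E₁ E₃ := by
  have hpos := h.pos
  have h1 := h.pos_one
  have h3 := h.pos_three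
  have h4 := h.blockSize_pos
  have := h.norm_integral_le_of_zone (B := 2 * 10 ^ 8 * blockSize T E₁ E₃) le_rfl h.le le_rfl
    (h.monotone_or_antitone le_rfl le_rfl (Or.inl fun r hr => ?_)) (by positivity) ?_
  · linarith
  · obtain ⟨h1, h2, h3⟩ := h.pf_nonneg hr
    rw [phaseS, h01, h02]
    linarith
  · intro c e hac hce heb hP
    have key : ∀ r ∈ Set.Icc c e, slowness (x 2) r ≤ 110 ∧ 1 / 5 ≤
        phaseS ((T ^ 12) ^ 2 / r ^ 2) (-1) 1 (slowness (x 0) r) (slowness (x 1) r)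
          (slowness (x 2) r) := fun r hr => by
      have hr' : r ∈ Set.Icc a b := ⟨hac.trans hr.1, hr.2.trans heb⟩
      have hz := (h.abs_der_one_le hr' (hP r hr)).1
      rw [h01, h02, one_mul, neg_one_mul, ← sub_eq_add_neg] at hz
      exact le_phaseS_neg_pos (h.weight hr').1 (h.weight hr').2 (h.one_le_slow hr')
        (h.slow_two_le hr') (h.slow_one_le hr') (h.sign 0) hz
    have hc : c ∈ Set.Icc a b := ⟨hac, hce.trans heb⟩
    refine h.min_le (h.inv_le_three_of_slow_le hc
      ((key c ⟨le_rfl, hce⟩).1.trans (by norm_num))) ?_ (h.norm_integral_le_length hac hce heb)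
    have := h.bound_second_const c e hac hce heb fun r hr => by
      have hr' : r ∈ Set.Icc a b := ⟨hac.trans hr.1, hr.2.trans heb⟩
      simp only
      rw [h.abs_der_two hr', h01, h02]
      have := (key r hr).2.trans (le_abs_self _)
      linarith
    have h5 : 0 ≤ T ^ 9 * E₁ := by positivity
    have h6 : 0 ≤ T ^ 8 := by positivity
    linarith

/-- The second derivative profile divided by the cube of the largest slowness, which is
antitone. -/
lemma phaseS_neg_neg_eq (h : BlockThree T E₁ E₃ a b x ε) (hr : r ∈ Set.Icc a b) :
    phaseS ((T ^ 12) ^ 2 / r ^ 2) (-1) (-1) (slowness (x 0) r) (slowness (x 1) r)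
      (slowness (x 2) r) = slowness (x 0) r ^ 3 *
      (((x 0 : ℝ) ^ 4 - (x 1 : ℝ) ^ 4 * (slowness (x 1) r / slowness (x 0) r) ^ 3 -
        (x 2 : ℝ) ^ 4 * (slowness (x 2) r / slowness (x 0) r) ^ 3) / (T ^ 12) ^ 4) := by
  have h0 := slowness_pos (h.abs_lt_of_mem hr 0)
  have := h.pos
  rw [phaseS]
  simp only [phaseG_slowness h.pow_pos (h.abs_lt_of_mem hr _)]
  field_simp
  ring

end BlockThree

lemma slowness_div_mono {n n' : ℤ} {r r' : ℝ} (hr : |(n : ℝ)| < r) (hn : |(n' : ℝ)| ≤ |(n : ℝ)|)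
    (hrr : r ≤ r') : slowness n' r / slowness n r ≤ slowness n' r' / slowness n r' := by
  have hr' := hr.trans_le hrr
  have h1 := slowness_pos hr
  have h2 := slowness_pos hr'
  have h3 := slowness_pos (hn.trans_lt hr)
  have h4 := slowness_pos (hn.trans_lt hr')
  refine le_of_sq_le_sq ?_ (by positivity)
  rw [div_pow, div_pow, slowness_sq hr, slowness_sq hr', slowness_sq (hn.trans_lt hr),
    slowness_sq (hn.trans_lt hr')]
  have e1 := sq_sub_sq_pos hr
  have e2 := sq_sub_sq_pos hr'
  have e3 := sq_sub_sq_pos (hn.trans_lt hr)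
  have e4 := sq_sub_sq_pos (hn.trans_lt hr')
  have h0 := pos_of_abs_int_lt hr
  have h0' := pos_of_abs_int_lt hr'
  have key : (r ^ 2 - (n : ℝ) ^ 2) / (r ^ 2 - (n' : ℝ) ^ 2) ≤
      (r' ^ 2 - (n : ℝ) ^ 2) / (r' ^ 2 - (n' : ℝ) ^ 2) := by
    rw [div_le_div_iff₀ e3 e4]
    have hn2 : (n' : ℝ) ^ 2 ≤ (n : ℝ) ^ 2 := sq_le_sq.2 hn
    have hrr2 : r ^ 2 ≤ r' ^ 2 := by gcongr
    nlinarith [mul_nonneg (sub_nonneg.2 hn2) (sub_nonneg.2 hrr2)]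
  calc _ = (r ^ 2 - (n : ℝ) ^ 2) / (r ^ 2 - (n' : ℝ) ^ 2) := by field_simp
    _ ≤ _ := key
    _ = _ := by field_simp

namespace BlockThree
variable {T E₁ E₃ a b : ℝ} {x : Fin 3 → ℤ} {ε : Fin 3 → ℝ}
  {r : ℝ}

/-- Zone of small first derivative in the case of opposite signs. -/
lemma zone_neg_neg (h : BlockThree T E₁ E₃ a b x ε) {c₀ e₀ : ℝ} {F : ℝ → ℝ} (h01 : ε 0 * ε 1 = -1)
    (h02 : ε 0 * ε 2 = -1)
    (hc₀ : a ≤ c₀) (he₀ : e₀ ≤ b) (hF : AntitoneOn F (Set.Icc a b))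
    (hFc : ContinuousOn F (Set.Icc a b))
    (hS : ∀ r ∈ Set.Icc a b, phaseS ((T ^ 12) ^ 2 / r ^ 2) (-1) (-1) (slowness (x 0) r)
      (slowness (x 1) r) (slowness (x 2) r) = slowness (x 0) r ^ 3 * F r) :
    IntegralBoundOn (fun r => Complex.exp (Complex.I * (radialPhase 3 (T ^ 12) ε x r : ℂ))) c₀ e₀
    (fun r => |radialPhaseDer 3 (T ^ 12) ε x 1 r| ≤ 1 / (51200 * E₃ ^ 2))
    (2 * 10 ^ 8 * blockSize T E₁ E₃) := by
  have hpos := h.pos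
  have h1 := h.pos_one
  have h3 := h.pos_three
  have h4 := h.blockSize_pos
  intro c e hac hce heb hP
  replace hac := hc₀.trans hac
  replace heb := heb.trans he₀
  rcases le_total 3200 (1 / (4 * E₃ ^ 2)) with hbig | hsmall
  · refine (h.bound_second c e hac hce heb fun r hr => ?_).trans (by linarith [h.second_le])
    have hr' : r ∈ Set.Icc a b := ⟨hac.trans hr.1, hr.2.trans heb⟩
    have hz := (h.abs_der_one_le hr' (hP r hr)).1
    rw [h01, h02, neg_one_mul, neg_one_mul, ← sub_eq_add_neg, ← sub_eq_add_neg] at hz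
    have key := le_phaseS_neg_neg (h.weight hr').1 (h.weight hr').2
      (hbig.trans (h.le_slow_two hr')) (h.slow_two_le hr') (h.slow_one_le hr') (h.sign 0) hz
    simp only
    rw [h.abs_der_two hr', h01, h02]
    have := key.trans (le_abs_self _)
    linarith
  · have hsub : Set.Icc c e ⊆ Set.Icc a b := Set.Icc_subset_Icc hac heb
    have hE3 : 1 / 114 ≤ E₃ := by
      rw [div_le_iff₀ (by positivity)] at hsmall
      nlinarith
    refine h.min_le hE3 ?_ (h.norm_integral_le_length hac hce heb)
    have key := norm_integral_le_of_abs_split (f := F) (δ := E₁ ^ 6 / 128) (B₁ := 7260 * T ^ 8)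
      (B₂ := 96600 * (T ^ 9 * E₁)) hce (h.phaseOn.mono hac heb).continuousOn_exp
      (hFc.mono hsub) (Or.inr (hF.mono hsub)) (by positivity) (by positivity) ?_ ?_
    · have h5 : 0 ≤ T ^ 9 * E₁ := by positivity
      have h6 : 0 ≤ T ^ 8 := by positivity
      linarith
    · intro c' e' hc' hce' he' hP'
      refine h.bound_second_const c' e' (hac.trans hc') hce' (he'.trans heb) fun r hr => ?_
      have hr' : r ∈ Set.Icc a b := ⟨(hac.trans hc').trans hr.1, hr.2.trans (he'.trans heb)⟩
      have h5 := hP' r hr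
      simp only at h5 ⊢
      rw [h.abs_der_two hr', h01, h02, hS r hr', abs_mul]
      have h6 := h.le_slow_zero hr'
      have h7 := slowness_pos (h.abs_lt_of_mem hr' 0)
      calc (1 : ℝ) / 32768 = (1 / (4 * E₁ ^ 2)) ^ 3 * (E₁ ^ 6 / 128) / 4 := by
            field_simp; norm_num
        _ ≤ slowness (x 0) r ^ 3 * |F r| / 4 := by gcongr
        _ ≤ _ := by gcongr; exact le_abs_self _
    · intro c' e' hc' hce' he' hP'
      refine h.bound_third c' e' (hac.trans hc') hce' (he'.trans heb) fun r hr => ?_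
      have hr' : r ∈ Set.Icc a b := ⟨(hac.trans hc').trans hr.1, hr.2.trans (he'.trans heb)⟩
      have h5 := hP' r hr
      simp only at h5 ⊢
      have hz := (h.abs_der_one_le hr' (hP r ⟨hc'.trans hr.1, hr.2.trans he'⟩)).2
      rw [h01, h02, neg_one_mul, neg_one_mul, ← sub_eq_add_neg, ← sub_eq_add_neg] at hz
      have h0 := slowness_pos (h.abs_lt_of_mem hr' 0)
      have hSle : |phaseS ((T ^ 12) ^ 2 / r ^ 2) (-1) (-1) (slowness (x 0) r)
          (slowness (x 1) r) (slowness (x 2) r)| ≤ 1 / 128 := by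
        rw [hS r hr', abs_mul, abs_of_pos (_root_.pow_pos h0 3)]
        have h6 := h.slow_zero_le hr'
        calc slowness (x 0) r ^ 3 * |F r| ≤ (1 / E₁ ^ 2) ^ 3 * (E₁ ^ 6 / 128) := by gcongr
          _ = 1 / 128 := by field_simp
      have hz' : 1 / (25600 * E₃ ^ 2) ≤ 1 / 2 := by
        have : 1 / (25600 * E₃ ^ 2) = 1 / (4 * E₃ ^ 2) / 6400 := by field_simp; norm_num
        rw [this]
        linarith
      have key := le_third_neg_neg (h.weight hr').1 (h.weight hr').2 (h.one_le_slow hr')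
        (h.slow_two_le hr') (h.slow_one_le hr') (h.sign 0) (hz.trans hz') hSle
      rw [radialPhaseDer_three h.pow_pos (h.abs_lt_of_mem hr'), Fin.sum_univ_three,
        h.sign_mul 1, h.sign_mul 2, h01, h02]
      rw [abs_mul, abs_of_pos (show (0 : ℝ) < 3 / 8 by norm_num)]
      gcongr
      refine (key.trans (le_abs_self _)).trans_eq ?_
      rcases h.sign 0 with h0 | h0 <;> rw [h0]
      · congr 1
        ring
      · rw [← abs_neg]
        congr 1
        ring

lemma norm_integral_le_neg_neg (h : BlockThree T E₁ E₃ a b x ε) (h01 : ε 0 * ε 1 = -1)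
    (h02 : ε 0 * ε 2 = -1) :
    ‖∫ r in a..b, Complex.exp (Complex.I * (radialPhase 3 (T ^ 12) ε x r : ℂ))‖ ≤
      5 * 10 ^ 8 * blockSize T E₁ E₃ := by
  have hpos := h.pos
  have h4 := h.blockSize_pos
  set F : ℝ → ℝ := fun r => ((x 0 : ℝ) ^ 4 - (x 1 : ℝ) ^ 4 *
    (slowness (x 1) r / slowness (x 0) r) ^ 3 -
      (x 2 : ℝ) ^ 4 * (slowness (x 2) r / slowness (x 0) r) ^ 3) / (T ^ 12) ^ 4 with hFdef
  have hF : AntitoneOn F (Set.Icc a b) := fun r hr r' hr' hrr => by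
    have h1 := slowness_div_mono (h.abs_lt_of_mem hr 0) h.abs_one_le hrr
    have h2 := slowness_div_mono (h.abs_lt_of_mem hr 0) (h.abs_two_le.trans h.abs_one_le) hrr
    have h3 := slowness_pos (h.abs_lt_of_mem hr 0)
    have h5 := slowness_pos (h.abs_lt_of_mem hr 1)
    have h6 := slowness_pos (h.abs_lt_of_mem hr 2)
    simp only [hFdef]
    gcongr
  have hcs : ∀ j, ContinuousOn (slowness (x j)) (Set.Icc a b) := fun j =>
    continuousOn_slowness (h.abs_lt_left j)
  have hFc : ContinuousOn F (Set.Icc a b) := by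
    have h0 : ∀ r ∈ Set.Icc a b, slowness (x 0) r ≠ 0 := fun r hr =>
      (slowness_pos (h.abs_lt_of_mem hr 0)).ne'
    have h1 := (hcs 1).div (hcs 0) h0
    have h2 := (hcs 2).div (hcs 0) h0
    exact ((continuousOn_const.sub (continuousOn_const.mul (h1.pow 3))).sub
      (continuousOn_const.mul (h2.pow 3))).div_const _
  have hS : ∀ r ∈ Set.Icc a b, _ := fun r hr => h.phaseS_neg_neg_eq hr
  have hzone : ∀ c e, a ≤ c → e ≤ b → _ := fun c e hac heb =>
    h.zone_neg_neg h01 h02 hac heb hF hFc hS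
  have key := norm_integral_le_of_monotone_split (f := fun r => -F r) (y := 0)
    (B₁ := 40000 * blockSize T E₁ E₃ + 2 * 10 ^ 8 * blockSize T E₁ E₃)
    (B₂ := 40000 * blockSize T E₁ E₃ + 2 * 10 ^ 8 * blockSize T E₁ E₃) h.le
    h.phaseOn.continuousOn_exp hFc.neg hF.neg (by positivity) (by positivity) ?_ ?_
  · linarith
  · intro c e hac hce heb hP
    refine h.norm_integral_le_of_zone hac hce heb (h.monotone_or_antitone hac heb
      (Or.inl fun r hr => ?_)) (by positivity) (hzone c e hac heb)
    have hr' : r ∈ Set.Icc a b := ⟨hac.trans hr.1, hr.2.trans heb⟩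
    rw [h01, h02, hS r hr']
    have h1 := slowness_pos (h.abs_lt_of_mem hr' 0)
    have h2 : 0 ≤ F r := by linarith [hP r hr]
    exact mul_nonneg (_root_.pow_pos h1 3).le h2
  · intro c e hac hce heb hP
    refine h.norm_integral_le_of_zone hac hce heb (h.monotone_or_antitone hac heb
      (Or.inr fun r hr => ?_)) (by positivity) (hzone c e hac heb)
    have hr' : r ∈ Set.Icc a b := ⟨hac.trans hr.1, hr.2.trans heb⟩
    rw [h01, h02, hS r hr']
    have h1 := slowness_pos (h.abs_lt_of_mem hr' 0)
    have h2 : F r ≤ 0 := by linarith [hP r hr]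
    exact mul_nonpos_of_nonneg_of_nonpos (_root_.pow_pos h1 3).le h2

/-- Block estimate in dimension three. -/
lemma norm_integral_le (h : BlockThree T E₁ E₃ a b x ε) :
    ‖∫ r in a..b, Complex.exp (Complex.I * (radialPhase 3 (T ^ 12) ε x r : ℂ))‖ ≤
      5 * 10 ^ 8 * blockSize T E₁ E₃ := by
  have h4 := h.blockSize_pos
  rcases h.sign_mul_self 1 with h1 | h1
  · linarith [h.norm_integral_le_pos h1]
  · rcases h.sign_mul_self 2 with h2 | h2
    · linarith [h.norm_integral_le_neg_pos h1 h2]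
    · exact h.norm_integral_le_neg_neg h1 h2

end BlockThree

section
variable {n : ℤ} {r : ℝ}

lemma glance_mul_sqrt (hr : |(n : ℝ)| < r) : glance n r * √r = wkbRoot n r :=
  div_mul_cancel₀ _ (Real.sqrt_pos.2 (pos_of_abs_int_lt hr)).ne'

lemma inv_wkbRoot_le {s : ℝ} (hs : 0 < s) (hr : |(n : ℝ)| < r) (h : s ^ 2 / 10 ≤ r) :
    (wkbRoot n r)⁻¹ ≤ 4 / (s * glance n r) := by
  have h1 := glance_pos hr
  have h2 : s / 4 ≤ √r := Real.le_sqrt_of_sq_le (by nlinarith)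
  calc (wkbRoot n r)⁻¹ ≤ (glance n r * (s / 4))⁻¹ := by
        rw [← glance_mul_sqrt hr]
        gcongr
    _ = _ := by field_simp

lemma sq_div_le_wkbRoot_pow {t : ℝ} (hr : |(n : ℝ)| < r) (h : t / 10 ≤ r)
    (h1 : 1 ≤ glance n r ^ 6 * t) : 1 / 10 * r ^ 2 ≤ wkbRoot n r ^ 6 := by
  have h0 := pos_of_abs_int_lt hr
  have h2 := glance_pos hr
  have e : wkbRoot n r ^ 6 = glance n r ^ 6 * r * r ^ 2 := by
    rw [← glance_mul_sqrt hr, mul_pow, show √r ^ 6 = (√r ^ 2) ^ 3 by ring, Real.sq_sqrt h0.le]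
    ring
  rw [e]
  gcongr
  have : glance n r ^ 6 * (t / 10) ≤ glance n r ^ 6 * r := by gcongr
  linarith

end

/-- Contribution of the oscillatory zone in dimension two. -/
lemma norm_integral_osc_two : ∃ C > (0:ℝ), ∀ (S M a b : ℝ) (A : ℝ → ℂ) (x : Fin 2 → ℤ),
    1 ≤ S → S ^ 8 / 10 ≤ a → a ≤ b → b ≤ 4 * S ^ 8 → BVOn A M a b → |(x 1 : ℝ)| ≤ |(x 0 : ℝ)| →
    |(x 0 : ℝ)| < a → 1 ≤ glance (x 0) a * S →
    ‖∫ r in a..b, A r * radialKer 2 (S ^ 8) x r‖ ≤ C * M * (S ^ 2)⁻¹ := by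
  obtain ⟨C, hC, h⟩ := norm_integral_radialKer_le 2 (κ := 1 / 10) (by norm_num)
  refine ⟨5 * (C * (120000 * 16)), by positivity,
    fun S M a b A x hS ha hab hb hA h10 h0 hE => ?_⟩
  have hS0 : 0 < S := by linarith
  have hM := hA.nonneg hab
  have ha0 : 0 < a := pos_of_abs_int_lt h0
  have hsub : Set.Icc a b ⊆ Set.Icc (S ^ 8 / 10) (4 * S ^ 8) := Set.Icc_subset_Icc ha hb
  set D := C * M * (120000 * 16) * (S ^ 2)⁻¹ with hD
  have hD0 : 0 ≤ D := by positivity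
  have key := norm_integral_le_of_dyadic (g := fun r => A r * radialKer 2 (S ^ 8) x r)
    (e := glance (x 0)) (B := fun y => D * (√(y * S))⁻¹) (H := fun y => -(4 * D * (√(y * S))⁻¹))
    (K := D) hab (hA.contOn.mul ((continuousOn_radialKer 2 (by positivity) x).mono hsub))
    (continuousOn_glance ha0) (glance_pos h0) ?_ ?_ ?_ ?_ ?_
  · refine key.trans ?_
    have h1 : (√(glance (x 0) a * S))⁻¹ ≤ 1 := inv_le_one_of_one_le₀ (Real.one_le_sqrt.2 hE)
    have h2 : 4 * D * (√(glance (x 0) a * S))⁻¹ ≤ 4 * D * 1 := by gcongr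
    have h3 : 5 * (C * (120000 * 16)) * M * (S ^ 2)⁻¹ = 5 * D := by rw [hD]; ring
    linarith
  · intro c d hac hcd hdb hdc
    have h0c := h0.trans_le hac
    have hE1 := glance_pos h0c
    have hES : 1 ≤ glance (x 0) c * S := hE.trans (by gcongr; exact glance_mono h0 hac)
    have hy : 1 ≤ √(glance (x 0) c * S) := Real.one_le_sqrt.2 hES
    set y := √(glance (x 0) c * S) with hydef
    have hy2 : glance (x 0) c * S = y ^ 2 := (Real.sq_sqrt (by positivity)).symm
    have hxc : ∀ j, |(x j : ℝ)| < c := fun j => by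
      fin_cases j
      · exact h0c
      · exact h10.trans_lt h0c
    have hgj : ∀ j, glance (x 0) c ≤ glance (x j) c := fun j => by
      fin_cases j
      · exact le_rfl
      · exact glance_anti h0c h10
    have h6 : 1 ≤ glance (x 0) c ^ 6 * S ^ 8 := by
      have h1 : 1 ≤ (glance (x 0) c * S) ^ 6 := one_le_pow₀ hES
      have h2 : (1:ℝ) ≤ S ^ 2 := one_le_pow₀ hS
      calc (1:ℝ) ≤ (glance (x 0) c * S) ^ 6 * S ^ 2 := by nlinarith
        _ = _ := by ring
    have hmain := h (S ^ 8) c d M (120000 * (S ^ 4 * y ^ 3)) A x (by positivity) (by linarith) hcd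
      (hdb.trans hb) (hA.mono hac hcd hdb) hxc (fun j => sq_div_le_wkbRoot_pow (hxc j)
        (ha.trans hac)
        (h6.trans (by gcongr; exact hgj j))) fun cs s hcs hsd =>
        norm_integral_block_two hS hy (fun j => boolSign_eq _) (ha.trans hac) hcs
          ((hsd.trans hdb).trans hb) h10 h0c hy2 ((glance_mono (h0c.trans_le hcs) hsd).trans hdc)
    refine hmain.trans ?_
    have hw : ∀ j, (wkbRoot (x j) c)⁻¹ ≤ 4 / (S ^ 4 * glance (x 0) c) := fun j =>
      (inv_wkbRoot_le (s := S ^ 4) (by positivity) (hxc j) (by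
        rw [← pow_mul]; exact ha.trans hac)).trans (by gcongr; exact hgj j)
    have hprod : ∏ j, (wkbRoot (x j) c)⁻¹ ≤ (4 / (S ^ 4 * glance (x 0) c)) ^ 2 := by
      rw [Fin.prod_univ_two, sq]
      have := wkbRoot_pos (hxc 1)
      exact mul_le_mul (hw 0) (hw 1) (by positivity) (by positivity)
    calc _ ≤ C * M * (120000 * (S ^ 4 * y ^ 3)) * (4 / (S ^ 4 * glance (x 0) c)) ^ 2 := by gcongr
      _ = _ := by
        rw [(eq_div_iff hS0.ne').2 hy2, hD]
        field_simp
        norm_num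
  · intro r hr r' hr' hrr
    exact glance_mono (h0.trans_le hr.1) hrr
  · intro y hy
    have hy0 : 0 < y := (glance_pos h0).trans_le hy
    have h2 : √(2 * y * S) = √2 * √(y * S) := by
      rw [mul_assoc, Real.sqrt_mul (by norm_num)]
    have h3 : 0 < √(y * S) := Real.sqrt_pos.2 (by positivity)
    have h4 : (√2)⁻¹ ≤ 3 / 4 := by
      rw [inv_le_comm₀ (by positivity) (by norm_num)]
      exact Real.le_sqrt_of_sq_le (by norm_num)
    rw [h2, mul_inv]
    have h5 : 0 ≤ D * (√(y * S))⁻¹ := by positivity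
    nlinarith
  · intro y hy
    have hy0 : 0 < y := (glance_pos h0).trans_le hy
    have : 0 ≤ 4 * D * (√(y * S))⁻¹ := by positivity
    linarith
  · intro y hy
    have hy0 : 0 < y := (glance_pos h0).trans_le hy
    have : (√(y * S))⁻¹ ≤ 1 := inv_le_one_of_one_le₀ (Real.one_le_sqrt.2
      (hE.trans (by gcongr)))
    exact mul_le_of_le_one_right hD0 this

/-- Contribution of the oscillatory zone in dimension three. -/
lemma norm_integral_osc_three : ∃ C > (0:ℝ), ∀ (T M a b : ℝ) (A : ℝ → ℂ) (x : Fin 3 → ℤ),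
    1 ≤ T → T ^ 12 / 10 ≤ a → a ≤ b → b ≤ 4 * T ^ 12 → BVOn A M a b →
    |(x 2 : ℝ)| ≤ |(x 1 : ℝ)| → |(x 1 : ℝ)| ≤ |(x 0 : ℝ)| →
    |(x 0 : ℝ)| < a → 1 ≤ T ^ 2 * glance (x 0) a →
    ‖∫ r in a..b, A r * radialKer 3 (T ^ 12) x r‖ ≤ C * M * (T ^ 8)⁻¹ := by
  obtain ⟨C, hC, h⟩ := norm_integral_radialKer_le 3 (κ := 1 / 10) (by norm_num)
  refine ⟨5 * (C * (5 * 10 ^ 8 * 64)), by positivity,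
    fun T M a b A x hT ha hab hb hA h21 h10 h0 hE => ?_⟩
  have hT0 : 0 < T := by linarith
  have hM := hA.nonneg hab
  have ha0 : 0 < a := pos_of_abs_int_lt h0
  have hsub : Set.Icc a b ⊆ Set.Icc (T ^ 12 / 10) (4 * T ^ 12) := Set.Icc_subset_Icc ha hb
  set D := C * M * (5 * 10 ^ 8 * 64) * (T ^ 8)⁻¹ with hD
  have hD0 : 0 ≤ D := by positivity
  have key := norm_integral_le_of_dyadic (g := fun r => A r * radialKer 3 (T ^ 12) x r)
    (e := glance (x 0))
    (B := fun y => D * (1 / (T ^ 2 * y) + T * y / ((1 + T * y) * (1 + 2 * (T * y)))))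
    (H := fun y => -(D * (2 / (T ^ 2 * y) + 1 / (1 + T * y))))
    (K := 2 * D) hab (hA.contOn.mul ((continuousOn_radialKer 3 (by positivity) x).mono hsub))
    (continuousOn_glance ha0) (glance_pos h0) ?_ ?_ ?_ ?_ ?_
  · refine key.trans ?_
    have h1 : 2 / (T ^ 2 * glance (x 0) a) ≤ 2 := by
      rw [div_le_iff₀ (by linarith)]
      linarith
    have h2 : 1 / (1 + T * glance (x 0) a) ≤ 1 := by
      have := mul_pos hT0 (glance_pos h0)
      rw [div_le_iff₀ (by linarith)]
      linarith
    have h3 : 5 * (C * (5 * 10 ^ 8 * 64)) * M * (T ^ 8)⁻¹ = 5 * D := by rw [hD]; ring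
    have h4 : D * (2 / (T ^ 2 * glance (x 0) a) + 1 / (1 + T * glance (x 0) a)) ≤ D * (2 + 1) := by
      gcongr
    linarith
  · intro c d hac hcd hdb hdc
    have h0c := h0.trans_le hac
    have hE1 := glance_pos h0c
    have hET : 1 ≤ T ^ 2 * glance (x 0) c := hE.trans (by gcongr; exact glance_mono h0 hac)
    have hx1 := h10.trans_lt h0c
    have hx2 := h21.trans_lt hx1
    have hE3 := glance_pos hx2
    have hxc : ∀ j, |(x j : ℝ)| < c := fun j => by
      fin_cases j
      · exact h0c
      · exact hx1
      · exact hx2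
    have hgj : ∀ j, glance (x 0) c ≤ glance (x j) c := fun j => by
      fin_cases j
      · exact le_rfl
      · exact glance_anti h0c h10
      · exact glance_anti h0c (h21.trans h10)
    have h6 : 1 ≤ glance (x 0) c ^ 6 * T ^ 12 := by
      calc (1:ℝ) ≤ (T ^ 2 * glance (x 0) c) ^ 6 := one_le_pow₀ hET
        _ = _ := by ring
    have hmain := h (T ^ 12) c d M (5 * 10 ^ 8 * blockSize T (glance (x 0) c) (glance (x 2) c)) A x
      (by positivity) (by linarith) hcd
      (hdb.trans hb) (hA.mono hac hcd hdb) hxc (fun j => sq_div_le_wkbRoot_pow (hxc j)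
        (ha.trans hac)
        (h6.trans (by gcongr; exact hgj j))) fun cs s hcs hsd =>
        (BlockThree.mk hT (fun j => boolSign_eq _) (ha.trans hac) hcs
          ((hsd.trans hdb).trans hb) h21 h10 h0c rfl rfl hET
          ((glance_mono (h0c.trans_le hcs) hsd).trans hdc)).norm_integral_le
    refine hmain.trans ?_
    have hw : ∀ j, (wkbRoot (x j) c)⁻¹ ≤ 4 / (T ^ 6 * glance (x j) c) := fun j =>
      inv_wkbRoot_le (s := T ^ 6) (by positivity) (hxc j) (by
        rw [← pow_mul]; exact ha.trans hac)
    have hw0 : ∀ j, 0 ≤ (wkbRoot (x j) c)⁻¹ := fun j => (inv_pos.2 (wkbRoot_pos (hxc j))).le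
    have hprod : ∏ j, (wkbRoot (x j) c)⁻¹ ≤ 4 / (T ^ 6 * glance (x 0) c) *
        (4 / (T ^ 6 * glance (x 0) c)) * (4 / (T ^ 6 * glance (x 2) c)) := by
      rw [Fin.prod_univ_three]
      refine mul_le_mul (mul_le_mul (hw 0) ((hw 1).trans ?_) (hw0 1) (by positivity)) (hw 2) (hw0 2)
        (by positivity)
      gcongr
      exact hgj 1
    have hbs : 0 ≤ blockSize T (glance (x 0) c) (glance (x 2) c) := by
      unfold blockSize
      positivity
    calc _ ≤ C * M * (5 * 10 ^ 8 * blockSize T (glance (x 0) c) (glance (x 2) c)) *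
          (4 / (T ^ 6 * glance (x 0) c) *
        (4 / (T ^ 6 * glance (x 0) c)) * (4 / (T ^ 6 * glance (x 2) c))) := by gcongr
      _ = _ := by
        rw [hD, blockSize]
        field_simp
        ring
  · intro r hr r' hr' hrr
    exact glance_mono (h0.trans_le hr.1) hrr
  · intro y hy
    have hy0 : 0 < y := (glance_pos h0).trans_le hy
    apply le_of_eq
    field_simp
    ring
  · intro y hy
    have hy0 : 0 < y := (glance_pos h0).trans_le hy
    have : 0 ≤ D * (2 / (T ^ 2 * y) + 1 / (1 + T * y)) := by positivity
    linarith
  · intro y hy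
    have hy0 : 0 < y := (glance_pos h0).trans_le hy
    have h1 : 1 / (T ^ 2 * y) ≤ 1 := by
      have : 1 ≤ T ^ 2 * y := hE.trans (by gcongr)
      exact div_le_one_of_le₀ this (by positivity)
    have h2 : T * y / ((1 + T * y) * (1 + 2 * (T * y))) ≤ 1 := by
      have : 0 < T * y := by positivity
      exact div_le_one_of_le₀ (by nlinarith) (by positivity)
    have : D * (1 / (T ^ 2 * y) + T * y / ((1 + T * y) * (1 + 2 * (T * y)))) ≤ D * (1 + 1) := by
      gcongr
    linarith

lemma le_glance_of_div_sqrt_le {n : ℤ} {τ a : ℝ} (ha : 0 < a) (h0 : 0 < τ) (h1 : τ < 1)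
    (h : |(n : ℝ)| / √(1 - τ ^ 4) ≤ a) : |(n : ℝ)| < a ∧ τ ≤ glance n a := by
  have h4 : τ ^ 4 < 1 := pow_lt_one₀ h0.le h1 (by norm_num)
  have hp : 0 < τ ^ 4 := by positivity
  have hs : 0 < √(1 - τ ^ 4) := Real.sqrt_pos.2 (by linarith)
  rw [div_le_iff₀ hs] at h
  have hsq : (n : ℝ) ^ 2 ≤ a ^ 2 * (1 - τ ^ 4) := by
    calc (n : ℝ) ^ 2 = |(n : ℝ)| ^ 2 := (sq_abs _).symm
      _ ≤ (a * √(1 - τ ^ 4)) ^ 2 := by gcongr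
      _ = _ := by rw [mul_pow, Real.sq_sqrt (by linarith)]
  have ha2 : 0 < a ^ 2 * τ ^ 4 := by positivity
  have hn : |(n : ℝ)| < a := by
    refine abs_lt_of_sq_lt_sq (by linarith) ha.le
  refine ⟨hn, ?_⟩
  have h5 := glance_pow_four_mul hn
  have h6 : τ ^ 4 ≤ glance n a ^ 4 := by
    refine le_of_mul_le_mul_right ?_ (show 0 < a ^ 2 by positivity)
    rw [h5]
    linarith
  exact (pow_le_pow_iff_left₀ h0.le (glance_pos hn).le (by norm_num)).1 h6

/-- Splitting of a radial integral at the turning point of a Bessel factor. -/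
lemma norm_integral_le_of_glance {g : ℝ → ℂ} {n : ℤ} {τ lam α β K₁ K₂ K₃ : ℝ} (hα : 0 < α)
    (hαβ : α ≤ β) (h0 : 0 < τ) (h1 : τ < 1) (hlam : β * τ ^ 4 ≤ 4 * lam)
    (hg : ContinuousOn g (Set.Icc α β)) (hK₁ : 0 ≤ K₁) (hK₂ : 0 ≤ K₂) (hK₃ : 0 ≤ K₃)
    (hfar : ∀ c, α ≤ c → c ≤ β → (∀ r ∈ Set.Icc α c, r + lam ≤ |(n : ℝ)|) →
      ‖∫ r in α..c, g r‖ ≤ K₁)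
    (hnear : ∀ c b, α ≤ c → c ≤ b → b ≤ β → b - c ≤ 5 * lam → ‖∫ r in c..b, g r‖ ≤ K₂)
    (hosc : ∀ a, α ≤ a → a ≤ β → |(n : ℝ)| < a → τ ≤ glance n a → ‖∫ r in a..β, g r‖ ≤ K₃) :
    ‖∫ r in α..β, g r‖ ≤ K₁ + K₂ + K₃ := by
  have h4 : τ ^ 4 < 1 := pow_lt_one₀ h0.le h1 (by norm_num)
  have hp : 0 < τ ^ 4 := by positivity
  have hs : 0 < √(1 - τ ^ 4) := Real.sqrt_pos.2 (by linarith)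
  have hs1 : 1 - τ ^ 4 ≤ √(1 - τ ^ 4) := Real.le_sqrt_of_sq_le (by nlinarith)
  set R := |(n : ℝ)| / √(1 - τ ^ 4) with hR
  rcases le_or_gt R α with h | h
  · obtain ⟨h2, h3⟩ := le_glance_of_div_sqrt_le hα h0 h1 h
    linarith [hosc α le_rfl hαβ h2 h3]
  have hlam0 : 0 ≤ lam := by
    have : 0 ≤ β * τ ^ 4 := mul_nonneg (by linarith) hp.le
    linarith
  set b := min R β with hb
  have hαb : α ≤ b := le_min h.le hαβ
  have hbβ : b ≤ β := min_le_right _ _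
  have hbn : b - |(n : ℝ)| ≤ 4 * lam := by
    have h2 : b * √(1 - τ ^ 4) ≤ |(n : ℝ)| := by
      rw [← le_div_iff₀ hs]
      exact min_le_left _ _
    have h3 : b * (1 - τ ^ 4) ≤ b * √(1 - τ ^ 4) := by gcongr; linarith
    have h4 : b * τ ^ 4 ≤ β * τ ^ 4 := by gcongr
    linarith
  set c := max α (min b (|(n : ℝ)| - lam)) with hc
  have hαc : α ≤ c := le_max_left _ _
  have hcb : c ≤ b := max_le hαb (min_le_left _ _)
  have hi : ∀ u v, α ≤ u → u ≤ v → v ≤ β → IntervalIntegrable g volume u v := fun u v hu huv hv =>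
    intervalIntegrable_of_continuousOn_Icc hg hu huv hv
  have e : ∫ r in α..β, g r = ((∫ r in α..c, g r) + ∫ r in c..b, g r) + ∫ r in b..β, g r := by
    rw [intervalIntegral.integral_add_adjacent_intervals (hi _ _ le_rfl hαc (hcb.trans hbβ))
      (hi _ _ hαc hcb hbβ), intervalIntegral.integral_add_adjacent_intervals
      (hi _ _ le_rfl hαb hbβ) (hi _ _ hαb hbβ le_rfl)]
  rw [e]
  refine (norm_add₃_le).trans (add_le_add (add_le_add ?_ ?_) ?_)
  · rcases le_or_gt (|(n : ℝ)| - lam) α with h2 | h2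
    · have : c = α := max_eq_left ((min_le_right _ _).trans h2)
      rw [this, intervalIntegral.integral_same, norm_zero]
      exact hK₁
    · refine hfar c hαc (hcb.trans hbβ) fun r hr => ?_
      have : c ≤ |(n : ℝ)| - lam := max_le h2.le (min_le_right _ _)
      linarith [hr.2]
  · refine hnear c b hαc hcb hbβ ?_
    have h2 : min b (|(n : ℝ)| - lam) ≤ c := le_max_right _ _
    rcases min_choice b (|(n : ℝ)| - lam) with h3 | h3 <;> rw [h3] at h2 <;> linarith
  · rcases le_or_gt R β with h2 | h2
    · have : b = R := min_eq_left h2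
      obtain ⟨h3, h4⟩ := le_glance_of_div_sqrt_le (n := n) (hα.trans h) h0 h1 le_rfl
      rw [this]
      exact hosc R h.le h2 h3 h4
    · have : b = β := min_eq_right h2.le
      rw [this, intervalIntegral.integral_same, norm_zero]
      exact hK₃

lemma rpow_neg_mul_rpow_neg_le {u v a b : ℝ} (hu : 0 < u) (hv : 0 < v) (ha : 0 ≤ a) (hb : 0 ≤ b) :
    u ^ (-a) * v ^ (-b) ≤ u ^ (-(a + b)) + v ^ (-(a + b)) := by
  have h1 := Real.rpow_nonneg hu.le (-(a + b))
  have h2 := Real.rpow_nonneg hv.le (-(a + b))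
  rcases le_total u v with h | h
  · have : v ^ (-b) ≤ u ^ (-b) := Real.rpow_le_rpow_of_nonpos hu h (by linarith)
    calc _ ≤ u ^ (-a) * u ^ (-b) := by gcongr
      _ = u ^ (-(a + b)) := by rw [← Real.rpow_add hu]; ring_nf
      _ ≤ _ := by linarith
  · have : u ^ (-a) ≤ v ^ (-a) := Real.rpow_le_rpow_of_nonpos hv h (by linarith)
    calc _ ≤ v ^ (-a) * v ^ (-b) := by gcongr
      _ = v ^ (-(a + b)) := by rw [← Real.rpow_add hv]; ring_nf
      _ ≤ _ := by linarith

/-- Bound by a finite sum of shifted power weights. -/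
lemma BVOn.norm_integral_mul_le_of_shift {f g : ℝ → ℂ} {M a b K s lam W : ℝ} (hf : BVOn f M a b)
    (hab : a ≤ b) (hK : 0 ≤ K) (hl : 0 < lam) {ι : Type*} (S : Finset ι) (N : ι → ℝ)
    (h : ∀ r ∈ Set.Icc a b, ‖g r‖ ≤ ∑ j ∈ S, K * (|r - N j| + lam) ^ (-s))
    (hW : ∀ N, ∫ r in a..b, (|r - N| + lam) ^ (-s) ≤ W) :
    ‖∫ r in a..b, f r * g r‖ ≤ M * (S.card * (K * W)) := by
  have hM := hf.nonneg hab
  have hi : ∀ j, Continuous fun r => K * (|r - N j| + lam) ^ (-s) := fun j =>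
    continuous_const.mul (Continuous.rpow_const (by fun_prop) fun u => Or.inl (by positivity))
  refine (hf.norm_integral_mul_le_of_norm_le hab (continuous_finsetSum _ fun j _ => hi j)
    h).trans ?_
  rw [intervalIntegral.integral_finsetSum fun j _ => (hi j).intervalIntegrable _ _, ← nsmul_eq_mul]
  gcongr
  refine Finset.sum_le_card_nsmul _ _ _ fun j _ => ?_
  rw [intervalIntegral.integral_const_mul]
  gcongr
  exact hW _

/-- Fourth-root form of a pointwise bound. -/
lemma le_mul_rpow_of_pow_four_le {B C S u : ℝ} (hB : 0 ≤ B) (hC : 0 ≤ C) (hS : 0 < S) (hu : 0 < u)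
    (h : B ^ 4 ≤ C / S ^ 4 * u⁻¹) : B ≤ (C + 1) / S * u ^ (-(1 / 4) : ℝ) := by
  refine (pow_le_pow_iff_left₀ hB (by positivity) (n := 4) (by norm_num)).1 (h.trans ?_)
  have e : (u ^ (-(1 / 4) : ℝ)) ^ 4 = u⁻¹ := by
    rw [← Real.rpow_natCast, ← Real.rpow_mul hu.le]
    norm_num
    exact Real.rpow_neg_one u
  have h1 : C ≤ (C + 1) ^ 4 := by
    have : (1:ℝ) ≤ (C + 1) ^ 3 := one_le_pow₀ (by linarith)
    nlinarith
  rw [mul_pow, div_pow, e]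
  gcongr

lemma norm_radialOsc_two_of_sorted : ∃ C > (0:ℝ), ∀ (S M : ℝ) (A : ℝ → ℂ) (x : Fin 2 → ℤ),
    2 ≤ S → BVOn A M (S ^ 8 / 10) (4 * S ^ 8) → |(x 1 : ℝ)| ≤ |(x 0 : ℝ)| →
    ‖radialOsc 2 A (S ^ 8) x‖ ≤ C * M * (S ^ 2)⁻¹ := by
  obtain ⟨C₀, hC₀, hosc⟩ := norm_integral_osc_two
  obtain ⟨C₁, hC₁, hB⟩ := norm_bessel_le_rpow
  refine ⟨2 * (128 * (C₁ + 1) * 16) + 2 * ((C₁ + 1) ^ 2 * 12) + C₀, by positivity,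
    fun S M A x hS hA h10 => ?_⟩
  have hS0 : 0 < S := by linarith
  have hS4 : 1 ≤ S ^ 4 := one_le_pow₀ (by linarith)
  have hS8 : 10 ≤ S ^ 8 := by
    have : (2:ℝ) ^ 8 ≤ S ^ 8 := by gcongr
    linarith
  have hab : S ^ 8 / 10 ≤ 4 * S ^ 8 := by linarith
  have hM := hA.nonneg hab
  have hpt : ∀ j r, S ^ 8 / 10 ≤ r → ‖besselMom 0 (x j) r‖ ≤
      (C₁ + 1) / S ^ 2 * (abs (r - |(x j : ℝ)|) + 1) ^ (-(1 / 4) : ℝ) := fun j r hr =>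
    le_mul_rpow_of_pow_four_le (norm_nonneg _) hC₁.le (by positivity) (by positivity)
      (by rw [← pow_mul]; exact hB (x j) (S ^ 8) r hS8 hr)
  rw [radialOsc_eq]
  refine (norm_integral_le_of_glance (n := x 0) (τ := 1 / S) (lam := S ^ 4)
    (K₁ := M * (2 * (128 * (C₁ + 1) / S ^ 4 * (16 * S ^ 2))))
    (K₂ := M * (2 * ((C₁ + 1) ^ 2 / S ^ 4 * (12 * S ^ 2)))) (K₃ := C₀ * M * (S ^ 2)⁻¹)
    (by positivity) hab (by positivity) (by rw [div_lt_one hS0]; linarith)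
    (le_of_eq (by field_simp)) (hA.contOn.mul (continuousOn_radialKer 2 (by positivity) x))
    (by positivity) (by positivity) (by positivity) ?_ ?_ ?_).trans (le_of_eq (by field_simp))
  · intro c hc hcb hfar
    have := (hA.mono le_rfl hc hcb).norm_integral_mul_le_of_shift (s := 3 / 4) (lam := 1)
      (g := radialKer 2 (S ^ 8) x) (K := 128 * (C₁ + 1) / S ^ 4) (W := 16 * S ^ 2) hc
      (by positivity) one_pos Finset.univ (fun j => |(x j : ℝ)|) ?_ ?_
    · simpa using this
    · intro r hr
      have h1 := hfar r hr
      have hr0 : 0 ≤ r := by linarith [hr.1]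
      rw [norm_radialKer, Fin.prod_univ_two, Fin.sum_univ_two, ← mul_add]
      have hv := hpt 1 r hr.1
      set u := abs (r - |(x 0 : ℝ)|) + 1 with hu
      set v := abs (r - |(x 1 : ℝ)|) + 1 with hv'
      have hu0 : 0 < u := by positivity
      have hv0 : 0 < v := by positivity
      have hB0 := norm_bessel_mul_sub_le hr0 (show r < |((x 0 : ℤ) : ℝ)| by linarith)
      have hue : u = |(x 0 : ℝ)| - r + 1 := by
        rw [hu, abs_sub_comm, abs_of_nonneg (by linarith)]
      have hu4 : S ^ 4 ≤ u := by linarith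
      have e1 : S ^ 2 * u⁻¹ ≤ u ^ (-(1 / 2) : ℝ) := by
        have h2 : S ^ 2 ≤ u ^ (1 / 2 : ℝ) := by
          rw [← Real.sqrt_eq_rpow]
          exact Real.le_sqrt_of_sq_le (by rw [← pow_mul]; exact hu4)
        calc S ^ 2 * u⁻¹ ≤ u ^ (1 / 2 : ℝ) * u⁻¹ := by gcongr
          _ = _ := by rw [← Real.rpow_neg_one, ← Real.rpow_add hu0]; norm_num
      have hB0' : ‖besselMom 0 (x 0) r‖ ≤ 128 / S ^ 2 * u ^ (-(1 / 2) : ℝ) := by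
        have h3 : ‖besselMom 0 (x 0) r‖ * u ≤ 128 := by
          have : ‖besselMom 0 (x 0) r‖ * u ≤ ‖besselMom 0 (x 0) r‖ * (2 * (|(x 0 : ℝ)| - r)) := by
            gcongr
            linarith
          linarith
        calc ‖besselMom 0 (x 0) r‖ ≤ 128 / u := by rwa [le_div_iff₀ hu0]
          _ = 128 / S ^ 2 * (S ^ 2 * u⁻¹) := by field_simp
          _ ≤ _ := by gcongr
      have h5 := rpow_neg_mul_rpow_neg_le hu0 hv0 (show (0:ℝ) ≤ 1 / 2 by norm_num)
        (show (0:ℝ) ≤ 1 / 4 by norm_num)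
      calc _ ≤ (128 / S ^ 2 * u ^ (-(1 / 2) : ℝ)) * ((C₁ + 1) / S ^ 2 * v ^ (-(1 / 4) : ℝ)) := by
            gcongr
        _ = 128 * (C₁ + 1) / S ^ 4 * (u ^ (-(1 / 2) : ℝ) * v ^ (-(1 / 4) : ℝ)) := by
            field_simp
        _ ≤ _ := by
            have e : (1 / 2 + 1 / 4 : ℝ) = 3 / 4 := by norm_num
            rw [e] at h5
            gcongr
    · intro N
      refine (integral_shift_rpow_le (by norm_num) (by norm_num) one_pos hc N).trans ?_
      have h6 : (c - S ^ 8 / 10 + 1) ^ (1 - 3 / 4 : ℝ) ≤ 2 * S ^ 2 := by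
        calc (c - S ^ 8 / 10 + 1) ^ (1 - 3 / 4 : ℝ) ≤ ((2 * S ^ 2) ^ 4) ^ (1 - 3 / 4 : ℝ) := by
              refine Real.rpow_le_rpow (by linarith) ?_ (by norm_num)
              have : (2 * S ^ 2) ^ 4 = 16 * S ^ 8 := by ring
              linarith
          _ = _ := by
            rw [← Real.rpow_natCast, ← Real.rpow_mul (by positivity)]
            norm_num
      norm_num at h6 ⊢
      linarith
  · intro c b hc hcb hb hlen
    have := (hA.mono hc hcb hb).norm_integral_mul_le_of_shift (s := 1 / 2) (lam := 1)
      (g := radialKer 2 (S ^ 8) x) (K := (C₁ + 1) ^ 2 / S ^ 4) (W := 12 * S ^ 2) hcb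
      (by positivity) one_pos Finset.univ (fun j => |(x j : ℝ)|) ?_ ?_
    · simpa using this
    · intro r hr
      rw [norm_radialKer, Fin.prod_univ_two, Fin.sum_univ_two, ← mul_add]
      have hu := hpt 0 r (hc.trans hr.1)
      have hv := hpt 1 r (hc.trans hr.1)
      set u := abs (r - |(x 0 : ℝ)|) + 1 with hu'
      set v := abs (r - |(x 1 : ℝ)|) + 1 with hv'
      have hu0 : 0 < u := by positivity
      have hv0 : 0 < v := by positivity
      have h5 := rpow_neg_mul_rpow_neg_le hu0 hv0 (show (0:ℝ) ≤ 1 / 4 by norm_num)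
        (show (0:ℝ) ≤ 1 / 4 by norm_num)
      calc _ ≤ ((C₁ + 1) / S ^ 2 * u ^ (-(1 / 4) : ℝ)) *
             ((C₁ + 1) / S ^ 2 * v ^ (-(1 / 4) : ℝ)) := by
            gcongr
        _ = (C₁ + 1) ^ 2 / S ^ 4 * (u ^ (-(1 / 4) : ℝ) * v ^ (-(1 / 4) : ℝ)) := by
            field_simp
        _ ≤ _ := by
            have e : (1 / 4 + 1 / 4 : ℝ) = 1 / 2 := by norm_num
            rw [e] at h5
            gcongr
    · intro N
      refine (integral_shift_rpow_le (by norm_num) (by norm_num) one_pos hcb N).trans ?_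
      have h6 : (b - c + 1) ^ (1 - 1 / 2 : ℝ) ≤ 3 * S ^ 2 := by
        calc (b - c + 1) ^ (1 - 1 / 2 : ℝ) ≤ ((3 * S ^ 2) ^ 2) ^ (1 - 1 / 2 : ℝ) := by
              refine Real.rpow_le_rpow (by linarith) ?_ (by norm_num)
              have : (3 * S ^ 2) ^ 2 = 9 * S ^ 4 := by ring
              linarith
          _ = _ := by
            rw [← Real.rpow_natCast, ← Real.rpow_mul (by positivity)]
            norm_num
      norm_num at h6 ⊢
      linarith
  · intro a ha hab' h0 hE
    refine hosc S M a (4 * S ^ 8) A x (by linarith) ha hab' le_rfl (hA.mono ha hab' le_rfl) h10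
      h0 ?_
    rwa [div_le_iff₀ hS0] at hE

lemma norm_bessel_pow_four_le_shift : ∃ C > (0:ℝ), ∀ (n : ℤ) (T r : ℝ), 2 ≤ T → T ^ 12 / 10 ≤ r →
    ‖besselMom 0 n r‖ ^ 4 ≤ C / T ^ 12 * (abs (r - |(n : ℝ)|) + T ^ 4)⁻¹ := by
  obtain ⟨C₁, hC₁, h1⟩ := norm_bessel_le_rpow
  obtain ⟨C₂, hC₂, h2⟩ := norm_bessel_cube_mul_le
  refine ⟨2 * C₁ + 2 * (10 * C₂ + 1) ^ 2, by positivity, fun n T r hT hr => ?_⟩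
  have hT0 : 0 < T := by linarith
  have hT12 : 10 ≤ T ^ 12 := by
    have : (2:ℝ) ^ 12 ≤ T ^ 12 := by gcongr
    linarith
  set w := abs (r - |(n : ℝ)|) with hw
  have hw0 : 0 ≤ w := abs_nonneg _
  rcases le_total (T ^ 4) w with h | h
  · refine (h1 n (T ^ 12) r hT12 hr).trans ?_
    rw [← hw]
    have : (w + 1)⁻¹ ≤ 2 * (w + T ^ 4)⁻¹ := by
      rw [← div_eq_mul_inv, ← one_div, div_le_div_iff₀ (by positivity) (by positivity)]
      linarith
    calc _ ≤ C₁ / T ^ 12 * (2 * (w + T ^ 4)⁻¹) := by gcongr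
      _ = 2 * C₁ / T ^ 12 * (w + T ^ 4)⁻¹ := by ring
      _ ≤ _ := by
        gcongr
        have := sq_nonneg (10 * C₂ + 1)
        linarith
  · have hr0 : 0 < r := lt_of_lt_of_le (by positivity) hr
    have h3 : ‖besselMom 0 n r‖ ^ 3 ≤ 10 * C₂ / T ^ 12 := by
      rw [le_div_iff₀ (by positivity)]
      have h4 : ‖besselMom 0 n r‖ ^ 3 * (T ^ 12 / 10) ≤ ‖besselMom 0 n r‖ ^ 3 * r := by gcongr
      linarith [h2 n r hr0.le]
    have h5 : ‖besselMom 0 n r‖ ^ 4 ≤ (10 * C₂ + 1) ^ 2 / T ^ 16 := by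
      refine (pow_le_pow_iff_left₀ (by positivity) (by positivity) (n := 3) (by norm_num)).1 ?_
      calc (‖besselMom 0 n r‖ ^ 4) ^ 3 = (‖besselMom 0 n r‖ ^ 3) ^ 4 := by ring
        _ ≤ (10 * C₂ / T ^ 12) ^ 4 := by gcongr
        _ ≤ ((10 * C₂ + 1) / T ^ 12) ^ 4 := by gcongr; linarith
        _ = (10 * C₂ + 1) ^ 4 / T ^ 48 := by rw [div_pow, ← pow_mul]
        _ ≤ (10 * C₂ + 1) ^ 6 / T ^ 48 := by
          gcongr
          · linarith
          · norm_num
        _ = _ := by rw [div_pow, ← pow_mul, ← pow_mul]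
    have h6 : (2 * T ^ 4)⁻¹ ≤ (w + T ^ 4)⁻¹ := by
      gcongr
      linarith
    calc _ ≤ (10 * C₂ + 1) ^ 2 / T ^ 16 := h5
      _ = 2 * (10 * C₂ + 1) ^ 2 / T ^ 12 * (2 * T ^ 4)⁻¹ := by
        field_simp
      _ ≤ (2 * C₁ + 2 * (10 * C₂ + 1) ^ 2) / T ^ 12 * (w + T ^ 4)⁻¹ := by
        gcongr
        linarith

lemma mul_three_le {a b c : ℝ} (ha : 0 ≤ a) (hb : 0 ≤ b) (hc : 0 ≤ c) :
    a * b * c ≤ a ^ 3 + b ^ 3 + c ^ 3 := by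
  have h1 := pow_nonneg ha 3
  have h2 := pow_nonneg hb 3
  have h3 := pow_nonneg hc 3
  have hm : ∀ m, a ≤ m → b ≤ m → c ≤ m → a * b * c ≤ m ^ 3 := fun m h1 h2 h3 => by
    calc a * b * c ≤ m * m * m := by
          have := ha.trans h1
          gcongr
      _ = m ^ 3 := by ring
  rcases le_total a b with h | h <;> rcases le_total b c with h' | h' <;>
    rcases le_total a c with h'' | h''
  all_goals first
    | linarith [hm a le_rfl (by linarith) (by linarith)]
    | linarith [hm b (by linarith) le_rfl (by linarith)]
    | linarith [hm c (by linarith) (by linarith) le_rfl]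

lemma norm_radialOsc_three_of_sorted : ∃ C > (0:ℝ), ∀ (T M : ℝ) (A : ℝ → ℂ) (x : Fin 3 → ℤ),
    2 ≤ T → BVOn A M (T ^ 12 / 10) (4 * T ^ 12) → |(x 2 : ℝ)| ≤ |(x 1 : ℝ)| →
    |(x 1 : ℝ)| ≤ |(x 0 : ℝ)| → ‖radialOsc 3 A (T ^ 12) x‖ ≤ C * M * (T ^ 8)⁻¹ := by
  obtain ⟨C₀, hC₀, hosc⟩ := norm_integral_osc_three
  obtain ⟨C₁, hC₁, hB⟩ := norm_bessel_pow_four_le_shift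
  obtain ⟨C₂, hC₂, hcube⟩ := norm_bessel_cube_mul_le
  refine ⟨3 * (256 * (C₁ + 1) ^ 2 * 4) + 150 * C₂ + C₀, by positivity,
    fun T M A x hT hA h21 h10 => ?_⟩
  have hT0 : 0 < T := by linarith
  have hT4 : 0 < T ^ 4 := by positivity
  have hT12 : 0 < T ^ 12 := by positivity
  have hab : T ^ 12 / 10 ≤ 4 * T ^ 12 := by linarith
  have hM := hA.nonneg hab
  have hpt : ∀ j r, T ^ 12 / 10 ≤ r → ‖besselMom 0 (x j) r‖ ≤
      (C₁ + 1) / T ^ 3 * (abs (r - |(x j : ℝ)|) + T ^ 4) ^ (-(1 / 4) : ℝ) := fun j r hr =>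
    le_mul_rpow_of_pow_four_le (norm_nonneg _) hC₁.le (by positivity) (by positivity)
      (by rw [← pow_mul]; exact hB (x j) T r hT hr)
  rw [radialOsc_eq]
  refine (norm_integral_le_of_glance (n := x 0) (τ := 1 / T ^ 2) (lam := T ^ 4)
    (K₁ := M * (3 * (256 * (C₁ + 1) ^ 2 / T ^ 6 * (4 / T ^ 2))))
    (K₂ := M * (5 * T ^ 4 * (30 * C₂ / T ^ 12))) (K₃ := C₀ * M * (T ^ 8)⁻¹)
    (by positivity) hab (by positivity) ?_
    (le_of_eq (by field_simp)) (hA.contOn.mul (continuousOn_radialKer 3 (by positivity) x))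
    (by positivity) (by positivity) (by positivity) ?_ ?_ ?_).trans
      (le_of_eq (by field_simp; ring))
  · rw [div_lt_one (by positivity)]
    nlinarith
  · intro c hc hcb hfar
    have := (hA.mono le_rfl hc hcb).norm_integral_mul_le_of_shift (s := 3 / 2) (lam := T ^ 4)
      (g := radialKer 3 (T ^ 12) x) (K := 256 * (C₁ + 1) ^ 2 / T ^ 6) (W := 4 / T ^ 2) hc
      (by positivity) hT4 Finset.univ (fun j => |(x j : ℝ)|) ?_ ?_
    · simpa using this
    · intro r hr
      have h1 := hfar r hr
      have hr0 : 0 ≤ r := by linarith [hr.1]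
      rw [norm_radialKer, Fin.prod_univ_three, Fin.sum_univ_three, ← mul_add, ← mul_add]
      have hv := hpt 1 r hr.1
      have hv2 := hpt 2 r hr.1
      set u := abs (r - |(x 0 : ℝ)|) + T ^ 4 with hu
      set v := abs (r - |(x 1 : ℝ)|) + T ^ 4 with hv'
      set w := abs (r - |(x 2 : ℝ)|) + T ^ 4 with hw'
      have hu0 : 0 < u := by positivity
      have hv0 : 0 < v := by positivity
      have hw0 : 0 < w := by positivity
      have hB0 := norm_bessel_mul_sub_le hr0 (show r < |((x 0 : ℤ) : ℝ)| by linarith)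
      have hue : u = |(x 0 : ℝ)| - r + T ^ 4 := by
        rw [hu, abs_sub_comm, abs_of_nonneg (by linarith)]
      have hB0' : ‖besselMom 0 (x 0) r‖ ≤ 128 * u ^ (-1 : ℝ) := by
        have h3 : ‖besselMom 0 (x 0) r‖ * u ≤ 128 := by
          have : ‖besselMom 0 (x 0) r‖ * u ≤ ‖besselMom 0 (x 0) r‖ * (2 * (|(x 0 : ℝ)| - r)) := by
            gcongr
            linarith
          linarith
        rw [Real.rpow_neg_one]
        rwa [← div_eq_mul_inv, le_div_iff₀ hu0]
      have h5 := rpow_neg_mul_rpow_neg_le hv0 hw0 (show (0:ℝ) ≤ 1 / 4 by norm_num)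
        (show (0:ℝ) ≤ 1 / 4 by norm_num)
      have h6 := rpow_neg_mul_rpow_neg_le hu0 hv0 (show (0:ℝ) ≤ 1 by norm_num)
        (show (0:ℝ) ≤ 1 / 2 by norm_num)
      have h7 := rpow_neg_mul_rpow_neg_le hu0 hw0 (show (0:ℝ) ≤ 1 by norm_num)
        (show (0:ℝ) ≤ 1 / 2 by norm_num)
      rw [show (1 / 4 + 1 / 4 : ℝ) = 1 / 2 by norm_num] at h5
      rw [show (1 + 1 / 2 : ℝ) = 3 / 2 by norm_num] at h6 h7
      have h8 := Real.rpow_nonneg hv0.le (-(3 / 2) : ℝ)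
      have h9 := Real.rpow_nonneg hw0.le (-(3 / 2) : ℝ)
      calc _ ≤ (128 * u ^ (-1 : ℝ)) * ((C₁ + 1) / T ^ 3 * v ^ (-(1 / 4) : ℝ)) *
            ((C₁ + 1) / T ^ 3 * w ^ (-(1 / 4) : ℝ)) := by gcongr
        _ = 128 * (C₁ + 1) ^ 2 / T ^ 6 *
            (u ^ (-1 : ℝ) * (v ^ (-(1 / 4) : ℝ) * w ^ (-(1 / 4) : ℝ))) := by
            field_simp
        _ ≤ 128 * (C₁ + 1) ^ 2 / T ^ 6 *
            (u ^ (-1 : ℝ) * (v ^ (-(1 / 2) : ℝ) + w ^ (-(1 / 2) : ℝ))) := by gcongr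
        _ ≤ 128 * (C₁ + 1) ^ 2 / T ^ 6 * (2 * (u ^ (-(3 / 2) : ℝ) + v ^ (-(3 / 2) : ℝ) +
            w ^ (-(3 / 2) : ℝ))) := by
            refine mul_le_mul_of_nonneg_left ?_ (by positivity)
            rw [mul_add]
            linarith
        _ = _ := by ring
    · intro N
      refine (integral_shift_rpow_le' (by norm_num) hT4 hc N).trans (le_of_eq ?_)
      have h6 : (T ^ 4) ^ (1 - 3 / 2 : ℝ) = (T ^ 2)⁻¹ := by
        rw [show T ^ 4 = (T ^ 2) ^ 2 by ring, ← Real.rpow_natCast, ← Real.rpow_mul (by positivity)]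
        norm_num
        exact Real.rpow_neg_one _
      rw [h6]
      field_simp
      norm_num
  · intro c b hc hcb hb hlen
    have hw : ∀ r ∈ Set.Icc c b, ‖radialKer 3 (T ^ 12) x r‖ ≤ 30 * C₂ / T ^ 12 := fun r hr => by
      have hr1 : T ^ 12 / 10 ≤ r := hc.trans hr.1
      have hj : ∀ j, ‖besselMom 0 (x j) r‖ ^ 3 ≤ 10 * C₂ / T ^ 12 := fun j => by
        rw [le_div_iff₀ (by positivity)]
        have h4 : ‖besselMom 0 (x j) r‖ ^ 3 * (T ^ 12 / 10) ≤ ‖besselMom 0 (x j) r‖ ^ 3 * r := by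
          gcongr
        linarith [hcube (x j) r (by linarith)]
      rw [norm_radialKer, Fin.prod_univ_three]
      refine (mul_three_le (norm_nonneg _) (norm_nonneg _) (norm_nonneg _)).trans
        ((add_le_add (add_le_add (hj 0) (hj 1)) (hj 2)).trans (le_of_eq (by ring)))
    refine ((hA.mono hc hcb hb).norm_integral_mul_le_of_norm_le hcb continuous_const hw).trans ?_
    rw [intervalIntegral.integral_const, smul_eq_mul]
    gcongr
  · intro a ha hab' h0 hE
    refine hosc T M a (4 * T ^ 12) A x (by linarith) ha hab' le_rfl (hA.mono ha hab' le_rfl) h21 h10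
      h0 ?_
    rw [div_le_iff₀ (by positivity)] at hE
    linarith

lemma radialOsc_comp_equiv {d : ℕ} (a : ℝ → ℂ) (t : ℝ) (x : Fin d → ℤ) (σ : Equiv.Perm (Fin d)) :
    radialOsc d a t (x ∘ σ) = radialOsc d a t x := by
  rw [radialOsc_eq, radialOsc_eq]
  refine intervalIntegral.integral_congr fun r _ => ?_
  have := Equiv.prod_comp σ (fun j => besselMom 0 (x j) r)
  simp only [radialKer, Function.comp_apply, this]

lemma exists_perm_antitone_abs {d : ℕ} (x : Fin d → ℤ) : ∃ σ : Equiv.Perm (Fin d),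
    ∀ i j, i ≤ j → |((x ∘ σ) j : ℝ)| ≤ |((x ∘ σ) i : ℝ)| :=
  ⟨Tuple.sort fun j => -|(x j : ℝ)|, fun _ _ h =>
    neg_le_neg_iff.1 (Tuple.monotone_sort (fun j => -|(x j : ℝ)|) h)⟩

lemma sqrt_div_sq_le_rpow {t s : ℝ} (ht : 1 ≤ t) (hs : -(3 / 2) ≤ s) : √t / t ^ 2 ≤ t ^ s := by
  have ht0 : 0 < t := by linarith
  calc √t / t ^ 2 = t ^ (-(3 / 2) : ℝ) := by
        rw [Real.sqrt_eq_rpow, ← Real.rpow_natCast t 2, ← Real.rpow_sub ht0]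
        norm_num
    _ ≤ _ := Real.rpow_le_rpow_of_exponent_le ht hs

lemma radialOsc_bound_two :
    ∃ C > (0:ℝ), ∀ t M : ℝ, 1 ≤ t → ∀ a, BVOn a M (t / 10) (4 * t) → ∀ x : Fin 2 → ℤ,
      ‖radialOsc 2 a t x‖ ≤ C * M * t ^ (-(1 / 4) : ℝ) := by
  refine radialOsc_bound_of_large (T := 2 ^ 8) (c := (2 ^ 8) ^ (-(1 / 4) : ℝ)) (by norm_num)
    (by positivity) (fun t ht hT => Real.rpow_le_rpow_of_nonpos (by linarith) hT (by norm_num))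
    (fun t ht => by positivity) ?_
  obtain ⟨C, hC, h⟩ := norm_radialOsc_two_of_sorted
  refine ⟨C, hC, fun t M ht a ha x => ?_⟩
  have ht0 : 0 < t := lt_of_lt_of_le (by norm_num) ht
  obtain ⟨σ, hσ⟩ := exists_perm_antitone_abs x
  have e1 : (t ^ (1 / 8 : ℝ)) ^ 8 = t := by
    rw [← Real.rpow_natCast, ← Real.rpow_mul ht0.le]
    norm_num
  have e2 : ((t ^ (1 / 8 : ℝ)) ^ 2)⁻¹ = t ^ (-(1 / 4) : ℝ) := by
    rw [← Real.rpow_natCast, ← Real.rpow_mul ht0.le, ← Real.rpow_neg ht0.le]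
    norm_num
  have hS : 2 ≤ t ^ (1 / 8 : ℝ) := by
    refine (pow_le_pow_iff_left₀ (by norm_num) (by positivity) (n := 8) (by norm_num)).1 ?_
    rwa [e1]
  have := h (t ^ (1 / 8 : ℝ)) M a (x ∘ σ) hS (by rwa [e1]) (hσ 0 1 (by decide))
  rwa [e1, e2, radialOsc_comp_equiv] at this

lemma radialOsc_bound_three :
    ∃ C > (0:ℝ), ∀ t M : ℝ, 1 ≤ t → ∀ a, BVOn a M (t / 10) (4 * t) → ∀ x : Fin 3 → ℤ,
      ‖radialOsc 3 a t x‖ ≤ C * M * t ^ (-(2 / 3) : ℝ) := by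
  refine radialOsc_bound_of_large (T := 2 ^ 12) (c := (2 ^ 12) ^ (-(2 / 3) : ℝ)) (by norm_num)
    (by positivity) (fun t ht hT => Real.rpow_le_rpow_of_nonpos (by linarith) hT (by norm_num))
    (fun t ht => by positivity) ?_
  obtain ⟨C, hC, h⟩ := norm_radialOsc_three_of_sorted
  refine ⟨C, hC, fun t M ht a ha x => ?_⟩
  have ht0 : 0 < t := lt_of_lt_of_le (by norm_num) ht
  obtain ⟨σ, hσ⟩ := exists_perm_antitone_abs x
  have e1 : (t ^ (1 / 12 : ℝ)) ^ 12 = t := by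
    rw [← Real.rpow_natCast, ← Real.rpow_mul ht0.le]
    norm_num
  have e2 : ((t ^ (1 / 12 : ℝ)) ^ 8)⁻¹ = t ^ (-(2 / 3) : ℝ) := by
    rw [← Real.rpow_natCast, ← Real.rpow_mul ht0.le, ← Real.rpow_neg ht0.le]
    norm_num
  have hS : 2 ≤ t ^ (1 / 12 : ℝ) := by
    refine (pow_le_pow_iff_left₀ (by norm_num) (by positivity) (n := 12) (by norm_num)).1 ?_
    rwa [e1]
  have := h (t ^ (1 / 12 : ℝ)) M a (x ∘ σ) hS (by rwa [e1]) (hσ 1 2 (by decide))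
    (hσ 0 1 (by decide))
  rwa [e1, e2, radialOsc_comp_equiv] at this

/-- Dispersive bounds for the propagator kernels at times `t ≥ 1`. -/
lemma norm_multKernel_le_rpow (d : ℕ) (hd : d = 2 ∨ d = 3 ∨ d = 4) {δ : ℝ} (hδ : 0 < δ) :
    ∃ C > (0:ℝ), ∀ t, 1 ≤ t → ∀ x : Fin d → ℤ,
      ‖multKernel d (fun ξ => Real.cos (t * omegaKG d ξ)) x‖ ≤ C * t ^ (-sigmaD d δ) ∧
      ‖multKernel d (fun ξ => Real.sin (t * omegaKG d ξ) / omegaKG d ξ) x‖ ≤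
        C * t ^ (-sigmaD d δ) := by
  have key : ∃ g : ℝ → ℝ, (∃ C > (0:ℝ), ∀ t M : ℝ, 1 ≤ t → ∀ a, BVOn a M (t / 10) (4 * t) →
      ∀ x : Fin d → ℤ, ‖radialOsc d a t x‖ ≤ C * M * g t) ∧ (∀ t, 1 ≤ t → √t / t ^ 2 ≤ g t) ∧
      ∀ t, 1 ≤ t → g t / √t ≤ t ^ (-sigmaD d δ) := by
    rcases hd with rfl | rfl | rfl
    · refine ⟨_, radialOsc_bound_two, fun t ht => sqrt_div_sq_le_rpow ht (by norm_num),
        fun t ht => le_of_eq ?_⟩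
      rw [Real.sqrt_eq_rpow, ← Real.rpow_sub (by linarith)]
      norm_num [sigmaD]
    · refine ⟨_, radialOsc_bound_three, fun t ht => sqrt_div_sq_le_rpow ht (by norm_num),
        fun t ht => le_of_eq ?_⟩
      rw [Real.sqrt_eq_rpow, ← Real.rpow_sub (by linarith)]
      norm_num [sigmaD]
    · have hε : 0 < min δ (1 / 2) := lt_min hδ (by norm_num)
      have hε1 : min δ (1 / 2) < 1 := (min_le_right _ _).trans_lt (by norm_num)
      have e : ∀ t : ℝ, 1 ≤ t → t ^ min δ (1 / 2) / t = t ^ (min δ (1 / 2) - 1) := fun t ht => by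
        rw [Real.rpow_sub_one (by linarith)]
      refine ⟨_, radialOsc_bound_four hε hε1, fun t ht => ?_, fun t ht => ?_⟩
      · simp only [e t ht]
        exact sqrt_div_sq_le_rpow ht (by linarith)
      · simp only [e t ht]
        rw [Real.sqrt_eq_rpow, ← Real.rpow_sub (by linarith)]
        refine Real.rpow_le_rpow_of_exponent_le ht ?_
        have := min_le_left δ (1 / 2)
        have e4 : sigmaD 4 δ = 3 / 2 - δ := by norm_num [sigmaD]
        rw [e4]
        linarith
  obtain ⟨g, hg1, hg2, hg3⟩ := key
  obtain ⟨C, hC, h⟩ := norm_multKernel_le_of_radialOsc (by omega) hg1 hg2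
  refine ⟨C, hC, fun t ht x => ⟨(h t ht x).1.trans ?_, (h t ht x).2.trans ?_⟩⟩ <;>
  · gcongr
    exact hg3 t ht

/-- The analytic family of powers through `c` used in complex interpolation. -/
def interpFamily (q : ℝ) (c z : ℂ) : ℂ :=
  c / ((‖c‖ : ℝ) : ℂ) * Complex.exp (((Real.log ‖c‖ : ℝ) : ℂ) * (((q : ℝ) : ℂ) * (1 - z / 2)))

lemma norm_interpFamily_le (q : ℝ) (c z : ℂ) : ‖interpFamily q c z‖ ≤
    ‖c‖ ^ (q * (1 - z.re / 2)) := by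
  rcases eq_or_ne c 0 with rfl | hc
  · simp only [interpFamily, zero_div, zero_mul, norm_zero]
    exact Real.rpow_nonneg le_rfl _
  · have hc' : 0 < ‖c‖ := norm_pos_iff.2 hc
    rw [interpFamily, norm_mul, norm_div, Complex.norm_real, norm_norm, div_self hc'.ne', one_mul,
      Complex.norm_exp, Complex.re_ofReal_mul, Complex.re_ofReal_mul, Real.rpow_def_of_pos hc']
    simp

lemma norm_interpFamily_le_exp {q : ℝ} (hq : 0 ≤ q) (c : ℂ) {z : ℂ} (h0 : 0 ≤ z.re)
    (h1 : z.re ≤ 1) :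
    ‖interpFamily q c z‖ ≤ Real.exp (|Real.log ‖c‖| * q) := by
  rcases eq_or_ne c 0 with rfl | hc
  · simp [interpFamily]
  · have hc' : 0 < ‖c‖ := norm_pos_iff.2 hc
    refine (norm_interpFamily_le q c z).trans ?_
    rw [Real.rpow_def_of_pos hc', Real.exp_le_exp]
    have h2 : q * (1 - z.re / 2) ≤ q := mul_le_of_le_one_right hq (by linarith)
    have h3 : 0 ≤ q * (1 - z.re / 2) := mul_nonneg hq (by linarith)
    calc _ ≤ |Real.log ‖c‖| * (q * (1 - z.re / 2)) := by
          gcongr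
          exact le_abs_self _
      _ ≤ _ := by gcongr

lemma interpFamily_eq {q θ : ℝ} (h : q * (1 - θ / 2) = 1) (c : ℂ) :
    interpFamily q c ((θ : ℝ) : ℂ) = c := by
  rcases eq_or_ne c 0 with rfl | hc
  · simp [interpFamily]
  · have hc' : 0 < ‖c‖ := norm_pos_iff.2 hc
    have e : ((q : ℝ) : ℂ) * (1 - ((θ : ℝ) : ℂ) / 2) = 1 := by exact_mod_cast h
    rw [interpFamily, e, mul_one, ← Complex.ofReal_exp, Real.exp_log hc', div_mul_cancel₀]
    exact_mod_cast hc'.ne'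

lemma differentiable_interpFamily (q : ℝ) (c : ℂ) : Differentiable ℂ (interpFamily q c) := by
  unfold interpFamily
  fun_prop

section
variable {ι κ : Type*} {S : Finset ι} {F : Finset κ} {a : κ → ι → ℂ} {A : ℝ}

/-- Complex interpolation between an `ℓ¹ → ℓ^∞` and an `ℓ² → ℓ²` bound, normalized form. -/
lemma norm_sum_mul_le_rpow_of_le_one
    (h1 : ∀ x ∈ F, ∀ y ∈ S, ‖a x y‖ ≤ A)
    (h2 : ∀ (f : ι → ℂ) (h : κ → ℂ), ‖∑ x ∈ F, ∑ y ∈ S, a x y * h x * f y‖ ≤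
      ((∑ x ∈ F, ‖h x‖ ^ 2) + ∑ y ∈ S, ‖f y‖ ^ 2) / 2) (hA : 0 ≤ A)
    {q θ : ℝ} (hq : 0 < q) (h0 : 0 ≤ θ) (hθ : θ ≤ 1) (hqθ : q * (1 - θ / 2) = 1)
    {f : ι → ℂ} {h : κ → ℂ} (hf : ∑ y ∈ S, ‖f y‖ ^ q ≤ 1) (hh : ∑ x ∈ F, ‖h x‖ ^ q ≤ 1) :
    ‖∑ x ∈ F, ∑ y ∈ S, a x y * h x * f y‖ ≤ A ^ (1 - θ) := by
  set Φ : ℂ → ℂ := fun z =>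
    ∑ x ∈ F, ∑ y ∈ S, a x y * interpFamily q (h x) z * interpFamily q (f y) z
    with hΦ
  have key := Complex.HadamardThreeLines.norm_le_interp_of_mem_verticalClosedStrip₀₁' Φ
    (z := ((θ : ℝ) : ℂ)) (a := A) (b := 1) ?_ ?_ ?_ ?_ ?_
  · simpa [hΦ, interpFamily_eq hqθ] using key
  · simpa [Complex.HadamardThreeLines.verticalClosedStrip] using ⟨h0, hθ⟩
  · refine Differentiable.diffContOnCl (Differentiable.fun_sum fun x _ => Differentiable.fun_sum
      fun y _ => ?_)
    exact ((differentiable_interpFamily q (h x)).const_mul _).mul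
      (differentiable_interpFamily q (f y))
  · refine ⟨∑ x ∈ F, ∑ y ∈ S, A * Real.exp (|Real.log ‖h x‖| * q) *
      Real.exp (|Real.log ‖f y‖| * q), ?_⟩
    rintro _ ⟨z, hz, rfl⟩
    refine (norm_sum_le _ _).trans (Finset.sum_le_sum fun x hx => (norm_sum_le _ _).trans
      (Finset.sum_le_sum fun y hy => ?_))
    rw [norm_mul, norm_mul]
    have h3 := norm_interpFamily_le_exp hq.le (h x) hz.1 hz.2
    have h4 := norm_interpFamily_le_exp hq.le (f y) hz.1 hz.2
    have h5 := h1 x hx y hy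
    gcongr
  · intro z hz
    have hz0 : z.re = 0 := hz
    have hb : ∀ c, ‖interpFamily q c z‖ ≤ ‖c‖ ^ q := fun c => by
      simpa [hz0] using norm_interpFamily_le q c z
    calc ‖Φ z‖ ≤ ∑ x ∈ F, ∑ y ∈ S, A * ‖h x‖ ^ q * ‖f y‖ ^ q := by
          refine (norm_sum_le _ _).trans (Finset.sum_le_sum fun x hx => (norm_sum_le _ _).trans
            (Finset.sum_le_sum fun y hy => ?_))
          rw [norm_mul, norm_mul]
          have h3 := hb (h x)
          have h4 := hb (f y)
          have h5 := h1 x hx y hy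
          gcongr
      _ = A * ((∑ x ∈ F, ‖h x‖ ^ q) * ∑ y ∈ S, ‖f y‖ ^ q) := by
          rw [Finset.sum_mul_sum, Finset.mul_sum]
          refine Finset.sum_congr rfl fun x _ => ?_
          rw [Finset.mul_sum]
          exact Finset.sum_congr rfl fun y _ => by ring
      _ ≤ A * (1 * 1) := by
          gcongr
      _ = A := by ring
  · intro z hz
    have hz0 : z.re = 1 := hz
    have hb : ∀ c, ‖interpFamily q c z‖ ^ 2 ≤ ‖c‖ ^ q := fun c => by
      have h3 := norm_interpFamily_le q c z
      rw [hz0] at h3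
      calc ‖interpFamily q c z‖ ^ 2 ≤ (‖c‖ ^ (q * (1 - 1 / 2))) ^ 2 := by gcongr
        _ = ‖c‖ ^ q := by
          rw [← Real.rpow_natCast, ← Real.rpow_mul (norm_nonneg _)]
          congr 1
          push_cast
          ring
    refine (h2 _ _).trans ?_
    have h3 : ∑ x ∈ F, ‖interpFamily q (h x) z‖ ^ 2 ≤ 1 :=
      (Finset.sum_le_sum fun x _ => hb (h x)).trans hh
    have h4 : ∑ y ∈ S, ‖interpFamily q (f y) z‖ ^ 2 ≤ 1 :=
      (Finset.sum_le_sum fun y _ => hb (f y)).trans hf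
    linarith

lemma sum_norm_div_rpow {q : ℝ} (hq : 0 < q) {f : ι → ℂ} (h : 0 < ∑ y ∈ S, ‖f y‖ ^ q) :
    ∑ y ∈ S, ‖f y / (((∑ y ∈ S, ‖f y‖ ^ q) ^ (1 / q) : ℝ) : ℂ)‖ ^ q = 1 := by
  have hp := Real.rpow_pos_of_pos h (1 / q)
  have e : ∀ y, ‖f y / (((∑ y ∈ S, ‖f y‖ ^ q) ^ (1 / q) : ℝ) : ℂ)‖ ^ q =
      ‖f y‖ ^ q / ∑ y ∈ S, ‖f y‖ ^ q := fun y => by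
    rw [norm_div, Complex.norm_real, Real.norm_of_nonneg hp.le, Real.div_rpow (norm_nonneg _) hp.le,
      ← Real.rpow_mul h.le, one_div_mul_cancel hq.ne', Real.rpow_one]
  simp only [e]
  rw [← Finset.sum_div, div_self h.ne']

lemma eq_zero_of_sum_rpow_eq_zero {α : Type*} {T : Finset α} {g : α → ℂ} {q : ℝ} (hq : 0 < q)
    (h : ∑ y ∈ T, ‖g y‖ ^ q = 0) : ∀ y ∈ T, g y = 0 := fun y hy => by
  have := (Finset.sum_eq_zero_iff_of_nonneg fun y _ => by positivity).1 h y hy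
  rw [Real.rpow_eq_zero (norm_nonneg _) hq.ne'] at this
  exact norm_eq_zero.1 this

/-- Complex interpolation between an `ℓ¹ → ℓ^∞` and an `ℓ² → ℓ²` bound, bilinear form. -/
lemma norm_sum_mul_le_rpow
    (h1 : ∀ x ∈ F, ∀ y ∈ S, ‖a x y‖ ≤ A)
    (h2 : ∀ (f : ι → ℂ) (h : κ → ℂ), ‖∑ x ∈ F, ∑ y ∈ S, a x y * h x * f y‖ ≤
      ((∑ x ∈ F, ‖h x‖ ^ 2) + ∑ y ∈ S, ‖f y‖ ^ 2) / 2) (hA : 0 ≤ A)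
    {q θ : ℝ} (hq : 0 < q) (h0 : 0 ≤ θ) (hθ : θ ≤ 1) (hqθ : q * (1 - θ / 2) = 1)
    (f : ι → ℂ) (h : κ → ℂ) :
    ‖∑ x ∈ F, ∑ y ∈ S, a x y * h x * f y‖ ≤
      A ^ (1 - θ) * (∑ x ∈ F, ‖h x‖ ^ q) ^ (1 / q) * (∑ y ∈ S, ‖f y‖ ^ q) ^ (1 / q) := by
  have hr : 0 ≤ A ^ (1 - θ) * (∑ x ∈ F, ‖h x‖ ^ q) ^ (1 / q) * (∑ y ∈ S, ‖f y‖ ^ q) ^ (1 / q) := by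
    have := Finset.sum_nonneg fun (y : ι) (_ : y ∈ S) => Real.rpow_nonneg (norm_nonneg (f y)) q
    have := Finset.sum_nonneg fun (y : κ) (_ : y ∈ F) => Real.rpow_nonneg (norm_nonneg (h y)) q
    positivity
  have hF := Finset.sum_nonneg fun (y : κ) (_ : y ∈ F) => Real.rpow_nonneg (norm_nonneg (h y)) q
  have hS := Finset.sum_nonneg fun (y : ι) (_ : y ∈ S) => Real.rpow_nonneg (norm_nonneg (f y)) q
  rcases hF.eq_or_lt with h3 | h3
  · have : ∑ x ∈ F, ∑ y ∈ S, a x y * h x * f y = 0 :=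
      Finset.sum_eq_zero fun x hx => Finset.sum_eq_zero fun y _ => by
        rw [eq_zero_of_sum_rpow_eq_zero hq h3.symm x hx]
        ring
    rwa [this, norm_zero]
  rcases hS.eq_or_lt with h4 | h4
  · have : ∑ x ∈ F, ∑ y ∈ S, a x y * h x * f y = 0 :=
      Finset.sum_eq_zero fun x _ => Finset.sum_eq_zero fun y hy => by
        rw [eq_zero_of_sum_rpow_eq_zero hq h4.symm y hy]
        ring
    rwa [this, norm_zero]
  have key := norm_sum_mul_le_rpow_of_le_one h1 h2 hA hq h0 hθ hqθ (sum_norm_div_rpow hq h4).le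
    (sum_norm_div_rpow hq h3).le
  set P := (∑ x ∈ F, ‖h x‖ ^ q) ^ (1 / q)
  set Q := (∑ y ∈ S, ‖f y‖ ^ q) ^ (1 / q)
  have hP : 0 < P := Real.rpow_pos_of_pos h3 _
  have hQ : 0 < Q := Real.rpow_pos_of_pos h4 _
  have e : ∑ x ∈ F, ∑ y ∈ S, a x y * (h x / ((P : ℝ) : ℂ)) * (f y / ((Q : ℝ) : ℂ)) =
      (∑ x ∈ F, ∑ y ∈ S, a x y * h x * f y) / ((P * Q : ℝ) : ℂ) := by
    rw [Finset.sum_div]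
    refine Finset.sum_congr rfl fun x _ => ?_
    rw [Finset.sum_div]
    refine Finset.sum_congr rfl fun y _ => ?_
    push_cast
    ring
  rw [e, norm_div, Complex.norm_real, Real.norm_of_nonneg (by positivity),
    div_le_iff₀ (by positivity)] at key
  linarith

/-- Complex interpolation between an `ℓ¹ → ℓ^∞` and an `ℓ² → ℓ²` bound for finite matrices. -/
lemma sum_norm_sum_rpow_le
    (h1 : ∀ x ∈ F, ∀ y ∈ S, ‖a x y‖ ≤ A)
    (h2 : ∀ (f : ι → ℂ) (h : κ → ℂ), ‖∑ x ∈ F, ∑ y ∈ S, a x y * h x * f y‖ ≤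
      ((∑ x ∈ F, ‖h x‖ ^ 2) + ∑ y ∈ S, ‖f y‖ ^ 2) / 2) (hA : 0 ≤ A)
    {p q : ℝ} (hp : 2 ≤ p) (hpq : p.HolderConjugate q) (f : ι → ℂ) :
    (∑ x ∈ F, ‖∑ y ∈ S, a x y * f y‖ ^ p) ^ (1 / p) ≤
      A ^ (1 - 2 / p) * (∑ y ∈ S, ‖f y‖ ^ q) ^ (1 / q) := by
  have hp0 : 0 < p := hpq.pos
  have hq0 : 0 < q := hpq.symm.pos
  have hinv : 1 / p + 1 / q = 1 := by simpa using hpq.inv_add_inv_eq_one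
  have hpq' : q * (p - 1) = p := by
    field_simp at hinv
    linarith
  set u : κ → ℂ := fun x => ∑ y ∈ S, a x y * f y with hu
  set U := ∑ x ∈ F, ‖u x‖ ^ p with hU
  have hU0 : 0 ≤ U := Finset.sum_nonneg fun x _ => by positivity
  have hS := Finset.sum_nonneg fun (y : ι) (_ : y ∈ S) => Real.rpow_nonneg (norm_nonneg (f y)) q
  rcases hU0.eq_or_lt with h3 | h3
  · rw [← h3, Real.zero_rpow (by positivity)]
    positivity
  have key := norm_sum_mul_le_rpow h1 h2 hA (q := q) (θ := 2 / p) hq0 (by positivity)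
    (by rw [div_le_one hp0]; exact hp) (by field_simp; linarith) f
    (fun x => (starRingEnd ℂ) (u x) * ((‖u x‖ ^ (p - 2) : ℝ) : ℂ))
  have e1 : ∑ x ∈ F, ∑ y ∈ S, a x y * ((starRingEnd ℂ) (u x) * ((‖u x‖ ^ (p - 2) : ℝ) : ℂ)) * f y =
      ((U : ℝ) : ℂ) := by
    rw [hU, Complex.ofReal_sum]
    refine Finset.sum_congr rfl fun x _ => ?_
    have : ∑ y ∈ S, a x y * ((starRingEnd ℂ) (u x) * ((‖u x‖ ^ (p - 2) : ℝ) : ℂ)) * f y =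
        u x * (starRingEnd ℂ) (u x) * ((‖u x‖ ^ (p - 2) : ℝ) : ℂ) := by
      simp only [hu, Finset.sum_mul]
      exact Finset.sum_congr rfl fun y _ => by ring
    rw [this, Complex.mul_conj, Complex.normSq_eq_norm_sq, ← Complex.ofReal_mul]
    congr 1
    rcases (norm_nonneg (u x)).eq_or_lt with h4 | h4
    · rw [← h4, Real.zero_rpow hp0.ne']
      ring
    · rw [← Real.rpow_natCast, ← Real.rpow_add h4]
      congr 1
      push_cast
      ring
  have e2 : ∀ x, ‖(starRingEnd ℂ) (u x) * ((‖u x‖ ^ (p - 2) : ℝ) : ℂ)‖ ^ q = ‖u x‖ ^ p :=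
      fun x => by
    rw [norm_mul, RCLike.norm_conj, Complex.norm_real, Real.norm_of_nonneg (by positivity)]
    rcases (norm_nonneg (u x)).eq_or_lt with h4 | h4
    · rw [← h4, zero_mul, Real.zero_rpow hp0.ne', Real.zero_rpow hq0.ne']
    · nth_rewrite 1 [← Real.rpow_one ‖u x‖]
      rw [← Real.rpow_add h4, ← Real.rpow_mul h4.le]
      congr 1
      linarith
  simp only [e1, e2] at key
  rw [Complex.norm_real, Real.norm_of_nonneg hU0] at key
  have e3 : U = U ^ (1 / p) * U ^ (1 / q) := by
    rw [← Real.rpow_add h3, hinv, Real.rpow_one]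
  have h5 : 0 < U ^ (1 / q) := Real.rpow_pos_of_pos h3 _
  refine le_of_mul_le_mul_right ?_ h5
  calc U ^ (1 / p) * U ^ (1 / q) = U := e3.symm
    _ ≤ _ := key
    _ = _ := by ring

end

/-- The character `ξ ↦ e^{i x·ξ}` of the torus. -/
def torusChar {d : ℕ} (x : Fin d → ℤ) (ξ : Fin d → ℝ) : ℂ :=
  Complex.exp (Complex.I * ((∑ j : Fin d, (x j : ℝ) * ξ j : ℝ) : ℂ))

lemma continuous_torusChar {d : ℕ} (x : Fin d → ℤ) : Continuous (torusChar x) := by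
  unfold torusChar
  fun_prop

lemma torusChar_sub {d : ℕ} (x y : Fin d → ℤ) (ξ : Fin d → ℝ) :
    torusChar (x - y) ξ = torusChar x ξ * torusChar (-y) ξ := by
  unfold torusChar
  rw [← Complex.exp_add, ← mul_add, ← Complex.ofReal_add, ← Finset.sum_add_distrib]
  congr 3
  refine Finset.sum_congr rfl fun j _ => ?_
  simp only [Pi.sub_apply, Pi.neg_apply]
  push_cast
  ring

lemma star_torusChar {d : ℕ} (x : Fin d → ℤ) (ξ : Fin d → ℝ) :
    (starRingEnd ℂ) (torusChar x ξ) = torusChar (-x) ξ := by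
  unfold torusChar
  rw [← Complex.exp_conj, map_mul, Complex.conj_I, Complex.conj_ofReal]
  congr 1
  simp only [Pi.neg_apply]
  push_cast
  simp only [neg_mul, Finset.sum_neg_distrib, mul_neg]

lemma integral_exp_int_mul (n : ℤ) :
    ∫ θ in (0 : ℝ)..(2 * π), Complex.exp (Complex.I * (((n : ℝ) * θ : ℝ) : ℂ)) =
      if n = 0 then ((2 * π : ℝ) : ℂ) else 0 := by
  split_ifs with h
  · subst h
    simp
  · have hc : Complex.I * (n : ℂ) ≠ 0 :=
      mul_ne_zero Complex.I_ne_zero (Int.cast_ne_zero.2 h)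
    have e : ∀ θ : ℝ, Complex.I * (((n : ℝ) * θ : ℝ) : ℂ) = Complex.I * (n : ℂ) * (θ : ℂ) :=
      fun θ => by
        push_cast
        ring
    simp only [e]
    rw [integral_exp_mul_complex hc]
    have : Complex.I * (n : ℂ) * ((2 * π : ℝ) : ℂ) = n * (2 * π * Complex.I) := by
      push_cast
      ring
    rw [this, Complex.exp_int_mul_two_pi_mul_I]
    simp

lemma integral_torusChar {d : ℕ} (x : Fin d → ℤ) :
    ∫ ξ in cube d, torusChar x ξ = if x = 0 then (((2 * π) ^ d : ℝ) : ℂ) else 0 := by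
  have e : ∀ ξ : Fin d → ℝ, torusChar x ξ =
      ∏ j, Complex.exp (Complex.I * (((x j : ℝ) * ξ j : ℝ) : ℂ)) := fun ξ => by
    rw [torusChar, ← Complex.exp_sum, ← Finset.mul_sum, ← Complex.ofReal_sum]
  simp only [e]
  rw [integral_cube_prod d fun j θ => Complex.exp (Complex.I * (((x j : ℝ) * θ : ℝ) : ℂ))]
  simp only [integral_exp_int_mul]
  split_ifs with h
  · subst h
    simp
  · obtain ⟨j, hj⟩ := Function.ne_iff.1 h
    exact Finset.prod_eq_zero (Finset.mem_univ j) (if_neg hj)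

lemma integrable_cube {d : ℕ} {E : Type*} [NormedAddCommGroup E] {f : (Fin d → ℝ) → E}
    (hf : Continuous f) : IntegrableOn f (cube d) :=
  hf.continuousOn.integrableOn_compact isCompact_Icc

lemma integral_norm_sum_torusChar_sq {d : ℕ} (F : Finset (Fin d → ℤ)) (h : (Fin d → ℤ) → ℂ) :
    ∫ ξ in cube d, ‖∑ x ∈ F, h x * torusChar x ξ‖ ^ 2 = (2 * π) ^ d * ∑ x ∈ F, ‖h x‖ ^ 2 := by
  have e : ∀ ξ : Fin d → ℝ, (((‖∑ x ∈ F, h x * torusChar x ξ‖ ^ 2 : ℝ)) : ℂ) =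
      ∑ x ∈ F, ∑ y ∈ F, h x * (starRingEnd ℂ) (h y) * torusChar (x - y) ξ := fun ξ => by
    rw [← Complex.normSq_eq_norm_sq, ← Complex.mul_conj, map_sum, Finset.sum_mul_sum]
    refine Finset.sum_congr rfl fun x _ => Finset.sum_congr rfl fun y _ => ?_
    rw [map_mul, star_torusChar, torusChar_sub]
    ring
  have hc := fun x : Fin d → ℤ => continuous_torusChar x
  apply Complex.ofReal_injective
  rw [← integral_complex_ofReal]
  simp only [e]
  rw [integral_finsetSum _ fun x _ => integrable_cube (by fun_prop), Complex.ofReal_mul,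
    Complex.ofReal_sum, Finset.mul_sum]
  refine Finset.sum_congr rfl fun x hx => ?_
  rw [integral_finsetSum _ fun y _ => integrable_cube (by fun_prop)]
  simp only [integral_const_mul, integral_torusChar, sub_eq_zero]
  rw [Finset.sum_eq_single_of_mem x hx fun y _ hy => by rw [if_neg hy.symm, mul_zero], if_pos rfl,
    Complex.mul_conj, Complex.normSq_eq_norm_sq]
  ring

/-- Fourier multipliers with symbol bounded by `1` are contractions on `ℓ²`, bilinear form. -/
lemma norm_sum_multKernel_mul_le {d : ℕ} {m : (Fin d → ℝ) → ℝ} (hm : Continuous m)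
    (hm1 : ∀ ξ, |m ξ| ≤ 1) (F S : Finset (Fin d → ℤ)) (f h : (Fin d → ℤ) → ℂ) :
    ‖∑ x ∈ F, ∑ y ∈ S, multKernel d m (x - y) * h x * f y‖ ≤
      ((∑ x ∈ F, ‖h x‖ ^ 2) + ∑ y ∈ S, ‖f y‖ ^ 2) / 2 := by
  have hc := fun x : Fin d → ℤ => continuous_torusChar x
  set H : (Fin d → ℝ) → ℂ := fun ξ => ∑ x ∈ F, h x * torusChar x ξ with hH
  set G : (Fin d → ℝ) → ℂ := fun ξ => ∑ y ∈ S, (starRingEnd ℂ) (f y) * torusChar y ξ with hG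
  have hHc : Continuous H := by fun_prop
  have hGc : Continuous G := by fun_prop
  have e : ∑ x ∈ F, ∑ y ∈ S, multKernel d m (x - y) * h x * f y =
      ((((2 * π) ^ d)⁻¹ : ℝ) : ℂ) * ∫ ξ in cube d, H ξ * (starRingEnd ℂ) (G ξ) * (m ξ : ℂ) := by
    have e1 : ∀ ξ, H ξ * (starRingEnd ℂ) (G ξ) * (m ξ : ℂ) =
        ∑ x ∈ F, ∑ y ∈ S, torusChar (x - y) ξ * (m ξ : ℂ) * (h x * f y) := fun ξ => by
      simp only [hH, hG]
      rw [map_sum, Finset.sum_mul_sum, Finset.sum_mul]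
      refine Finset.sum_congr rfl fun x _ => ?_
      rw [Finset.sum_mul]
      refine Finset.sum_congr rfl fun y _ => ?_
      rw [map_mul, Complex.conj_conj, star_torusChar, torusChar_sub]
      ring
    simp only [e1]
    rw [integral_finsetSum _ fun x _ => integrable_cube (by fun_prop), Finset.mul_sum]
    refine Finset.sum_congr rfl fun x _ => ?_
    rw [integral_finsetSum _ fun y _ => integrable_cube (by fun_prop), Finset.mul_sum]
    refine Finset.sum_congr rfl fun y _ => ?_
    rw [integral_mul_const, multKernel]
    simp only [torusChar]
    ring
  have hpos : 0 < (2 * π) ^ d := by positivity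
  have hle : ‖∫ ξ in cube d, H ξ * (starRingEnd ℂ) (G ξ) * (m ξ : ℂ)‖ ≤
      ∫ ξ in cube d, (‖H ξ‖ ^ 2 + ‖G ξ‖ ^ 2) / 2 := by
    refine norm_integral_le_of_norm_le (integrable_cube (by fun_prop))
      (Filter.Eventually.of_forall fun ξ => ?_)
    rw [norm_mul, norm_mul, RCLike.norm_conj, Complex.norm_real]
    have h1 : ‖H ξ‖ * ‖G ξ‖ * ‖m ξ‖ ≤ ‖H ξ‖ * ‖G ξ‖ :=
      mul_le_of_le_one_right (by positivity) (hm1 ξ)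
    have h2 := two_mul_le_add_sq ‖H ξ‖ ‖G ξ‖
    linarith
  rw [integral_div, integral_add (integrable_cube (by fun_prop)) (integrable_cube (by fun_prop)),
    integral_norm_sum_torusChar_sq, integral_norm_sum_torusChar_sq] at hle
  rw [e, norm_mul, Complex.norm_real, Real.norm_of_nonneg (by positivity), inv_mul_le_iff₀ hpos]
  simp only [RCLike.norm_conj] at hle
  linarith

lemma norm_multKernel_le_one {d : ℕ} {m : (Fin d → ℝ) → ℝ} (hm1 : ∀ ξ, |m ξ| ≤ 1)
    (x : Fin d → ℤ) : ‖multKernel d m x‖ ≤ 1 := by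
  have hpos : 0 < (2 * π) ^ d := by positivity
  have hv : volume.real (cube d) = (2 * π) ^ d := by
    rw [cube, measureReal_def, Real.volume_Icc_pi_toReal fun j => by simp; positivity]
    simp
  rw [multKernel, norm_mul, Complex.norm_real, Real.norm_of_nonneg (by positivity),
    inv_mul_le_iff₀ hpos, mul_one, ← hv, ← one_mul (volume.real (cube d))]
  refine norm_setIntegral_le_of_norm_le_const (volume_cube_lt_top d) fun ξ _ => ?_
  rw [norm_mul, norm_exp_I_mul_ofReal', Complex.norm_real, one_mul]
  exact hm1 ξ

lemma ofReal_sum_norm_rpow_rpow {α : Type*} (T : Finset α) (g : α → ℂ) {r : ℝ} (hr : 0 < r) :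
    ENNReal.ofReal ((∑ x ∈ T, ‖g x‖ ^ r) ^ (1 / r)) = (∑ x ∈ T, ‖g x‖ₑ ^ r) ^ (1 / r) := by
  rw [← ENNReal.ofReal_rpow_of_nonneg (Finset.sum_nonneg fun _ _ => by positivity) (by positivity),
    ENNReal.ofReal_sum_of_nonneg fun _ _ => by positivity]
  congr 1
  refine Finset.sum_congr rfl fun x _ => ?_
  rw [← ENNReal.ofReal_rpow_of_nonneg (norm_nonneg _) hr.le, ofReal_norm]

lemma eLpNorm_count_eq_tsum {α : Type*} [MeasurableSpace α] [MeasurableSingletonClass α]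
    (f : α → ℂ) {p : ℝ≥0∞} (h0 : p ≠ 0) (ht : p ≠ ⊤) :
    eLpNorm f p Measure.count = (∑' x, ‖f x‖ₑ ^ p.toReal) ^ (1 / p.toReal) := by
  rw [eLpNorm_eq_lintegral_rpow_enorm_toReal h0 ht, lintegral_count]

/-- Riesz--Thorin interpolation between `ℓ¹ → ℓ^∞` and `ℓ² → ℓ²` for infinite matrices. -/
lemma eLpNorm_tsum_mul_le {ι κ : Type*} [MeasurableSpace ι] [MeasurableSingletonClass ι]
    [MeasurableSpace κ] [MeasurableSingletonClass κ] {a : κ → ι → ℂ} {A : ℝ}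
    (h1 : ∀ x y, ‖a x y‖ ≤ A)
    (h2 : ∀ (F : Finset κ) (S : Finset ι) (f : ι → ℂ) (h : κ → ℂ),
      ‖∑ x ∈ F, ∑ y ∈ S, a x y * h x * f y‖ ≤
        ((∑ x ∈ F, ‖h x‖ ^ 2) + ∑ y ∈ S, ‖f y‖ ^ 2) / 2) (hA : 0 ≤ A)
    {p q : ℝ≥0∞} (hp : 2 ≤ p) (hpq : 1 / p + 1 / q = 1) (f : ι → ℂ) :
    eLpNorm (fun x => ∑' y, a x y * f y) p Measure.count ≤
      ENNReal.ofReal (A ^ (1 - 2 / p.toReal)) * eLpNorm f q Measure.count := by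
  rcases eq_or_ne p ⊤ with rfl | hpt
  · have hq : q = 1 := by simpa using hpq
    subst hq
    rw [eLpNorm_exponent_top, eLpNormEssSup_count, eLpNorm_one_eq_lintegral_enorm, lintegral_count]
    simp only [ENNReal.toReal_top, div_zero, sub_zero, Real.rpow_one]
    refine iSup_le fun x => enorm_tsum_le_tsum_enorm.trans ?_
    rw [← ENNReal.tsum_mul_left]
    refine ENNReal.tsum_le_tsum fun y => ?_
    rw [enorm_mul, ← ofReal_norm (a x y)]
    gcongr
    exact h1 x y
  have hpr : 2 ≤ p.toReal := by
    simpa using ENNReal.toReal_mono hpt hp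
  have hp0 : 0 < p.toReal := by linarith
  have hqt : q ≠ ⊤ := by
    rintro rfl
    have : p = 1 := by simpa using hpq
    rw [this] at hpr
    norm_num at hpr
  have hconjr : p.toReal.HolderConjugate q.toReal := by
    rw [Real.holderConjugate_iff]
    refine ⟨by linarith, ?_⟩
    have := congrArg ENNReal.toReal hpq
    rw [ENNReal.toReal_add (by simp; rintro rfl; simp at hp) (by simp; rintro rfl; simp at hpq)]
      at this
    simpa using this
  have hq0 : 0 < q.toReal := hconjr.symm.pos
  have hp0' : p ≠ 0 := fun h => by simp [h] at hp0
  have hq0' : q ≠ 0 := fun h => by simp [h] at hq0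
  rw [eLpNorm_count_eq_tsum _ hp0' hpt, eLpNorm_count_eq_tsum _ hq0' hqt, one_div,
    ENNReal.rpow_inv_le_iff hp0, ENNReal.tsum_eq_iSup_sum]
  refine iSup_le fun F => ?_
  rw [← ENNReal.rpow_inv_le_iff hp0, ← one_div]
  classical
  have hfil : ∑ x ∈ F, ‖∑' y, a x y * f y‖ₑ ^ p.toReal =
      ∑ x ∈ F with Summable fun y => a x y * f y, ‖∑' y, a x y * f y‖ₑ ^ p.toReal := by
    refine (Finset.sum_filter_of_ne fun x _ hx => ?_).symm
    by_contra h
    rw [tsum_eq_zero_of_not_summable h] at hx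
    simp [hp0] at hx
  rw [hfil]
  refine le_of_tendsto' (x := Filter.atTop) (f := fun S : Finset ι =>
    (∑ x ∈ F with Summable fun y => a x y * f y, ‖∑ y ∈ S, a x y * f y‖ₑ ^ p.toReal) ^
      (1 / p.toReal)) ?_ fun S => ?_
  · refine (ENNReal.continuous_rpow_const.tendsto _).comp (tendsto_finsetSum _ fun x hx => ?_)
    exact (ENNReal.continuous_rpow_const.tendsto _).comp
      ((continuous_enorm.tendsto _).comp (Finset.mem_filter.1 hx).2.hasSum)
  · have := sum_norm_sum_rpow_le (F := F.filter fun x => Summable fun y => a x y * f y) (S := S)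
      (fun x _ y _ => h1 x y) (h2 _ S) hA hpr hconjr f
    have := ENNReal.ofReal_le_ofReal this
    rw [ENNReal.ofReal_mul (by positivity), ofReal_sum_norm_rpow_rpow _ _ hp0,
      ofReal_sum_norm_rpow_rpow _ _ hq0] at this
    refine this.trans ?_
    gcongr
    exact ENNReal.sum_le_tsum S

lemma rpow_neg_le_two_rpow_abs_mul {r s : ℝ} (hr : 0 < r) (hrs : r ≤ s) (hs : s ≤ 2 * r) (σ : ℝ) :
    r ^ (-σ) ≤ 2 ^ |σ| * s ^ (-σ) := by
  have hs0 : 0 < s := hr.trans_le hrs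
  rcases le_total 0 σ with h | h
  · rw [abs_of_nonneg h, Real.rpow_neg hr.le, Real.rpow_neg hs0.le, ← div_eq_mul_inv,
      le_div_iff₀ (by positivity), inv_mul_le_iff₀ (by positivity), mul_comm,
      ← Real.mul_rpow (by norm_num) hr.le]
    exact Real.rpow_le_rpow hs0.le hs h
  · refine (Real.rpow_le_rpow hr.le hrs (neg_nonneg.2 h)).trans ?_
    exact le_mul_of_one_le_left (by positivity)
      (Real.one_le_rpow (by norm_num) (abs_nonneg σ))

lemma abs_sin_mul_div_omegaKG_le_one (d : ℕ) (t : ℝ) (ξ : Fin d → ℝ) :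
    |Real.sin (t * omegaKG d ξ) / omegaKG d ξ| ≤ 1 := by
  have h := one_le_omegaKG d ξ
  rw [abs_div, abs_of_pos (by linarith : 0 < omegaKG d ξ), div_le_one (by linarith)]
  exact (Real.abs_sin_le_one _).trans h

lemma multKernel_neg (d : ℕ) (m : (Fin d → ℝ) → ℝ) (x : Fin d → ℤ) :
    multKernel d (fun ξ => -m ξ) x = -multKernel d m x := by
  simp only [multKernel, Complex.ofReal_neg, mul_neg, integral_neg]

lemma norm_multKernel_cos_abs (d : ℕ) (t : ℝ) (x : Fin d → ℤ) :
    ‖multKernel d (fun ξ => Real.cos (|t| * omegaKG d ξ)) x‖ =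
      ‖multKernel d (fun ξ => Real.cos (t * omegaKG d ξ)) x‖ := by
  rcases abs_choice t with h | h <;> rw [h]
  simp only [neg_mul, Real.cos_neg]

lemma norm_multKernel_sin_abs (d : ℕ) (t : ℝ) (x : Fin d → ℤ) :
    ‖multKernel d (fun ξ => Real.sin (|t| * omegaKG d ξ) / omegaKG d ξ) x‖ =
      ‖multKernel d (fun ξ => Real.sin (t * omegaKG d ξ) / omegaKG d ξ) x‖ := by
  rcases abs_choice t with h | h <;> rw [h]
  simp only [neg_mul, Real.sin_neg, neg_div, multKernel_neg, norm_neg]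

/-- Dispersive decay of the propagator kernels, uniformly in time. -/
lemma norm_multKernel_le_one_add_abs_rpow (d : ℕ) (hd : d = 2 ∨ d = 3 ∨ d = 4) {δ : ℝ}
    (hδ : 0 < δ) : ∃ C > (0 : ℝ), ∀ t : ℝ, ∀ x : Fin d → ℤ,
      ‖multKernel d (fun ξ => Real.cos (t * omegaKG d ξ)) x‖ ≤
        C * (1 + |t|) ^ (-sigmaD d δ) ∧
      ‖multKernel d (fun ξ => Real.sin (t * omegaKG d ξ) / omegaKG d ξ) x‖ ≤
        C * (1 + |t|) ^ (-sigmaD d δ) := by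
  obtain ⟨C, hC, h⟩ := norm_multKernel_le_rpow d hd hδ
  refine ⟨(max C 1) * 2 ^ |sigmaD d δ|, by positivity, fun t x => ?_⟩
  have hcmp : max C 1 * max |t| 1 ^ (-sigmaD d δ) ≤
      max C 1 * 2 ^ |sigmaD d δ| * (1 + |t|) ^ (-sigmaD d δ) := by
    rw [mul_assoc]
    refine mul_le_mul_of_nonneg_left (rpow_neg_le_two_rpow_abs_mul (by positivity) ?_ ?_ _)
      (by positivity)
    · exact max_le (by linarith) (by linarith [abs_nonneg t])
    · linarith [le_max_left |t| 1, le_max_right |t| 1]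
  rcases le_total 1 |t| with ht | ht
  · rw [max_eq_left ht] at hcmp
    have h3 : C * |t| ^ (-sigmaD d δ) ≤ max C 1 * |t| ^ (-sigmaD d δ) := by
      gcongr
      exact le_max_left _ _
    have h4 := h |t| ht x
    rw [norm_multKernel_cos_abs, norm_multKernel_sin_abs] at h4
    exact ⟨h4.1.trans (h3.trans hcmp), h4.2.trans (h3.trans hcmp)⟩
  · rw [max_eq_right ht, Real.one_rpow, mul_one] at hcmp
    have h3 := (le_max_right C 1).trans hcmp
    exact ⟨(norm_multKernel_le_one (fun _ => Real.abs_cos_le_one _) x).trans h3,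
      (norm_multKernel_le_one (abs_sin_mul_div_omegaKG_le_one d t) x).trans h3⟩

/-- `ℓ^{p'} → ℓ^p` decay for the linear discrete Klein--Gordon equation in dimensions
`d = 2, 3, 4` (interpolation between the dispersive estimate and `ℓ²` conservation):
`‖u(t)‖_{ℓ^p} ≤ C_p (1+|t|)^{−σ(p−2)/p} (‖f‖_{ℓ^{p'}} + ‖g‖_{ℓ^{p'}})` for `2 ≤ p ≤ ∞`,
where `p'` is the Hölder conjugate of `p` and, for `d = 4`, `σ = 3/2 − δ` with an
arbitrary fixed `δ > 0`.  (Note `1 − 2/p.toReal` equals `(p−2)/p`, also for `p = ∞`.) -/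
theorem lp_decay_linear (d : ℕ) (hd : d = 2 ∨ d = 3 ∨ d = 4) (δ : ℝ) (hδ : 0 < δ)
    (p p' : ℝ≥0∞) (hp : 2 ≤ p) (hp' : 1/p + 1/p' = 1) :
    ∃ C > (0:ℝ), ∀ (f g : (Fin d → ℤ) → ℂ) (t : ℝ),
      eLpNorm (fun x => cosProp d t f x + sinProp d t g x) p Measure.count ≤
        ENNReal.ofReal (C * (1 + |t|) ^ (-(sigmaD d δ) * (1 - 2 / p.toReal))) *
          (eLpNorm f p' Measure.count + eLpNorm g p' Measure.count) := by
  obtain ⟨C, hC, h⟩ := norm_multKernel_le_one_add_abs_rpow d hd hδ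
  refine ⟨C ^ (1 - 2 / p.toReal), by positivity, fun f g t => ?_⟩
  have ht : 0 ≤ 1 + |t| := by positivity
  have hω := continuous_omegaKG d
  have hω0 : ∀ ξ, omegaKG d ξ ≠ 0 := fun ξ => by linarith [one_le_omegaKG d ξ]
  rw [Real.rpow_mul ht, ← Real.mul_rpow hC.le (by positivity), mul_add]
  refine (eLpNorm_add_le (measurable_of_countable (cosProp d t f)).aestronglyMeasurable
    (measurable_of_countable (sinProp d t g)).aestronglyMeasurable
    (le_trans (by norm_num) hp)).trans (add_le_add ?_ ?_)
  · exact eLpNorm_tsum_mul_le (fun x y => (h t (x - y)).1)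
      (norm_sum_multKernel_mul_le (by fun_prop) fun _ => Real.abs_cos_le_one _)
      (by positivity) hp hp' f
  · exact eLpNorm_tsum_mul_le (fun x y => (h t (x - y)).2)
      (norm_sum_multKernel_mul_le (by fun_prop (disch := assumption))
        (abs_sin_mul_div_omegaKG_le_one d t))
      (by positivity) hp hp' g
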